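/- Fix three partitions π, μ and ν such that |π| ≥ |μ|+|ν|−2. Then the structure coefficient g^π_{μ,ν}(α) of Jack characters is a polynomial in b := α−1 with non-negative integer coefficients. -/

import Mathlib

open scoped Classical

noncomputable section

/-- The base field `ℚ(α)` of rational functions in the Jack parameter `α`. -/
abbrev F : Type := RatFunc ℚ

/-- The Jack deformation parameter `α`. -/
def alpha : F := RatFunc.X

/-- An integer partition, encoded as a multiset of positive integers (its parts). -/
abbrev JPartition : Type := Multiset ℕ+

/-- The size `|λ|` of a partition. -/
def psize (l : JPartition) : ℕ := (l.map fun i => (i : ℕ)).sum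

/-- The length `ℓ(λ)` of a partition. -/
def plen (l : JPartition) : ℕ := Multiset.card l

/-- `m_i(λ)`, the number of parts of `λ` equal to `i`. -/
def pmult (l : JPartition) (i : ℕ+) : ℕ := Multiset.count i l

/-- `λ ∪ 1^k`, adjoining `k` parts equal to `1`. -/
def addOnes (l : JPartition) (k : ℕ) : JPartition := l + Multiset.replicate k 1

/-- `λ̃`, the partition obtained by deleting all parts equal to `1`. -/
def removeOnes (l : JPartition) : JPartition := Multiset.filter (fun i => i ≠ 1) l

/-- Exponent vectors of monomials in the power-sum generators `p₁, p₂, …`. -/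
abbrev Exp : Type := ℕ+ →₀ ℕ

/-- The exponent vector of the monomial `p_λ`. -/
def toExp (l : JPartition) : Exp := l.toFinset.sum fun i => Finsupp.single i (Multiset.count i l)

/-- The partition corresponding to an exponent vector. -/
def toPart (m : Exp) : JPartition := m.sum fun i k => Multiset.replicate k i

/-- The weighted degree (`deg p_i = i`) of an exponent vector; this is the size of the
corresponding partition. -/
def wt (m : Exp) : ℕ := m.sum fun i k => k * (i : ℕ)

/-- The algebra `ℚ(α)[p₁, p₂, …]` of symmetric functions written in the power-sum basis. -/
abbrev SymA : Type := MvPolynomial ℕ+ F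

/-- The power-sum monomial `p_λ`. -/
def pPow (l : JPartition) : SymA := (l.map fun i => MvPolynomial.X i).prod

/-- `z_λ α^{ℓ(λ)}`, attached to the exponent vector of `p_λ`. -/
def zalpha (m : Exp) : F :=
  algebraMap ℚ F (m.prod fun i k => (Nat.factorial k : ℚ) * ((i : ℕ) : ℚ) ^ k) *
    alpha ^ (m.sum fun _ k => k)

/-- The `α`-deformed Hall scalar product: `⟨p_λ, p_μ⟩ = δ_{λμ} z_λ α^{ℓ(λ)}`. -/
def hall (f g : SymA) : F :=
  ∑ m ∈ f.support, MvPolynomial.coeff m f * MvPolynomial.coeff m g * zalpha m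

/-- The parts of a partition, sorted in weakly decreasing order. -/
def sortedParts (l : JPartition) : List ℕ := ((l.map fun i => (i : ℕ)).sort (· ≤ ·)).reverse

/-- The sum of the `k` largest parts of a partition. -/
def topSum (l : JPartition) (k : ℕ) : ℕ := ((sortedParts l).take k).sum

/-- The dominance order on partitions: `μ ⊴ λ`. -/
def dominates (mu lam : JPartition) : Prop :=
  psize mu = psize lam ∧ ∀ k, topSum mu k ≤ topSum lam k

/-- Evaluation of a symmetric function (in power-sum coordinates) in `N` variables
`x₁, …, x_N`: it sends `p_i ↦ x₁^i + ⋯ + x_N^i`. -/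
def evalN (N : ℕ) : SymA →ₐ[F] MvPolynomial (Fin N) F :=
  MvPolynomial.aeval fun i : ℕ+ => ∑ j : Fin N, MvPolynomial.X j ^ (i : ℕ)

/-- The exponent of the monomial `x₁^{μ₁} ⋯ x_s^{μ_s}` in `N` variables, for `μ` a
partition; its coefficient in a symmetric polynomial is the coefficient of the monomial
symmetric function `m_μ` (provided `N ≥ ℓ(μ)`). -/
def xexp (mu : JPartition) (N : ℕ) : Fin N →₀ ℕ :=
  Finsupp.equivFunOnFinite.symm fun j => (sortedParts mu).getD (j : ℕ) 0

/-- The defining properties of the family of Jack polynomials `J_λ^{(α)}` (Macdonald's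
characterization): orthogonality for the `α`-deformed Hall product, triangularity with
respect to monomial symmetric functions in dominance order, and normalization
`[p_{1^n}] J_λ^{(α)} = 1`. -/
structure IsJackFamily (J : JPartition → SymA) : Prop where
  orthogonal : ∀ l m : JPartition, l ≠ m → hall (J l) (J m) = 0
  triangular : ∀ l m : JPartition, ¬ dominates m l →
    MvPolynomial.coeff (xexp m (psize l + psize m + plen m))
      (evalN (psize l + psize m + plen m) (J l)) = 0
  normalized : ∀ l : JPartition, MvPolynomial.coeff (Finsupp.single 1 (psize l)) (J l) = 1

/-- The Jack character `θ_μ^{(α)}(λ)`. -/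
def theta (J : JPartition → SymA) (mu lam : JPartition) : F :=
  if psize lam < psize mu then 0
  else (Nat.choose (psize lam - psize mu + pmult mu 1) (pmult mu 1) : F) *
    MvPolynomial.coeff (toExp (addOnes mu (psize lam - psize mu))) (J lam)

/-- `g` is the family of structure coefficients of Jack characters:
`θ_μ^{(α)} θ_ν^{(α)} = ∑_π g^π_{μ,ν}(α) θ_π^{(α)}` (as functions on Young diagrams,
with finitely many nonzero terms). -/
def IsStructCoeffs (J : JPartition → SymA) (g : JPartition → JPartition → JPartition → F) :
    Prop :=
  (∀ mu nu : JPartition, {pi : JPartition | g pi mu nu ≠ 0}.Finite) ∧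
  ∀ mu nu lam : JPartition,
    theta J mu lam * theta J nu lam = ∑ᶠ pi : JPartition, g pi mu nu * theta J pi lam


open scoped Classical
noncomputable section
namespace JackAux

section Ops
variable {k : Type} [Field k]

local notation "SS" => MvPolynomial ℕ k
local notation "SX" => Polynomial (MvPolynomial ℕ k)

/-- The derivation `f ↦ ∑ κ_i ∂_i f X^i`. -/
def nabla (κ : ℕ → k) : SS →ₗ[k] SX :=
  (MvPolynomial.mkDerivation k
    (fun i => (Polynomial.monomial i (MvPolynomial.C (κ i)) : SX))).toLinearMap

lemma nabla_mul (κ : ℕ → k) (f g : SS) :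
    nabla κ (f * g) = Polynomial.C f * nabla κ g + Polynomial.C g * nabla κ f := by
  simp [nabla, Derivation.leibniz, Polynomial.smul_eq_C_mul]

lemma nabla_X (κ : ℕ → k) (i : ℕ) :
    nabla κ (MvPolynomial.X i) = Polynomial.monomial i (MvPolynomial.C (κ i)) := by
  simp [nabla, MvPolynomial.mkDerivation_X]

lemma nabla_C (κ : ℕ → k) (c : k) : nabla κ (MvPolynomial.C c) = 0 := by
  simp [nabla]

lemma coeff_nabla (κ : ℕ → k) (f : SS) (m : ℕ) :
    (nabla κ f).coeff m = MvPolynomial.C (κ m) * MvPolynomial.pderiv m f := by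
  induction f using MvPolynomial.induction_on with
  | C a => simp [nabla_C]
  | add p q hp hq => simp [hp, hq, mul_add]
  | mul_X p i hp =>
    rw [nabla_mul, nabla_X, Polynomial.coeff_add, Polynomial.coeff_C_mul, Polynomial.coeff_C_mul,
      hp, Polynomial.coeff_monomial, Derivation.leibniz, MvPolynomial.pderiv_X]
    by_cases h : i = m
    · subst h; simp; ring
    · simp [h]; ring

/-- lowering operators -/
def Aop (κ : ℕ → k) (ε : k) (m : ℕ) (f : SS) : SS :=
  MvPolynomial.C (κ m) * MvPolynomial.pderiv m f + if m = 0 then MvPolynomial.C ε * f else 0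

def Vop (κ : ℕ → k) (ε : k) : SS →ₗ[k] SX :=
  nabla κ + ε • (Polynomial.monomial 0 : SS →ₗ[SS] SX).restrictScalars k

lemma coeff_Vop (κ : ℕ → k) (ε : k) (f : SS) (m : ℕ) :
    (Vop κ ε f).coeff m = Aop κ ε m f := by
  simp only [Vop, Aop, LinearMap.add_apply, Polynomial.coeff_add, coeff_nabla, LinearMap.smul_apply,
    LinearMap.coe_restrictScalars, Polynomial.coeff_smul, Polynomial.coeff_monomial]
  by_cases h : m = 0
  · simp [h, MvPolynomial.smul_eq_C_mul]
  · simp [h, Ne.symm h]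

def Nab (κ : ℕ → k) (ε : k) : SX →ₗ[k] SX :=
  Polynomial.lsum (fun m => (LinearMap.mulRight k (Polynomial.X ^ (m + 1) : SX)) ∘ₗ Vop κ ε)

def eop (b : k) : SX →ₗ[k] SX :=
  Polynomial.lsum (fun m => (b * (m + 1 : ℕ)) •
    (Polynomial.monomial m : SS →ₗ[SS] SX).restrictScalars k)

def Qop (σ : ℕ → SS) : SX →ₗ[k] SX :=
  Polynomial.lsum (fun m => ∑ r ∈ Finset.range m,
    ((Polynomial.monomial (m - 1 - r) : SS →ₗ[SS] SX).restrictScalars k) ∘ₗ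
      LinearMap.mulLeft k (σ r))

def Sym (σ : ℕ → SS) : SX →ₗ[k] SS :=
  Polynomial.lsum (fun m => LinearMap.mulLeft k (σ m))

def Lop (κ : ℕ → k) (ε b : k) (σ : ℕ → SS) : SX →ₗ[k] SX :=
  Nab κ ε + eop b + Qop σ

def Top (κ : ℕ → k) (ε b : k) (σ : ℕ → SS) (n : ℕ) : SS →ₗ[k] SS :=
  Sym σ ∘ₗ (Lop κ ε b σ ^ n) ∘ₗ Vop κ ε

lemma Nab_mon (κ : ℕ → k) (ε : k) (m : ℕ) (f : SS) :
    Nab κ ε (Polynomial.monomial m f) = Vop κ ε f * Polynomial.X ^ (m + 1) := by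
  simp [Nab, Polynomial.lsum_apply, Polynomial.sum_monomial_index]

lemma eop_mon (b : k) (m : ℕ) (f : SS) :
    eop b (Polynomial.monomial m f) = (b * (m + 1 : ℕ)) • Polynomial.monomial m f := by
  simp [eop, Polynomial.lsum_apply, Polynomial.sum_monomial_index]

lemma Qop_mon (σ : ℕ → SS) (m : ℕ) (f : SS) :
    Qop σ (Polynomial.monomial m f) =
      ∑ r ∈ Finset.range m, Polynomial.monomial (m - 1 - r) (σ r * f) := by
  simp [Qop, Polynomial.lsum_apply, Polynomial.sum_monomial_index]

lemma Sym_mon (σ : ℕ → SS) (m : ℕ) (f : SS) :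
    Sym σ (Polynomial.monomial m f) = σ m * f := by
  simp [Sym, Polynomial.lsum_apply, Polynomial.sum_monomial_index]

lemma coeff_Nab_mon (κ : ℕ → k) (ε : k) (a c : ℕ) (f : SS) :
    (Nab κ ε (Polynomial.monomial a f)).coeff c = if a < c then Aop κ ε (c - 1 - a) f else 0 := by
  rw [Nab_mon, Polynomial.coeff_mul_X_pow']
  by_cases h : a < c
  · rw [if_pos h, if_pos (by omega), coeff_Vop]; congr 1; omega
  · rw [if_neg h, if_neg (by omega)]

lemma coeff_eop_mon (b : k) (a c : ℕ) (f : SS) :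
    (eop b (Polynomial.monomial a f)).coeff c =
      if a = c then MvPolynomial.C (b * (a + 1 : ℕ)) * f else 0 := by
  rw [eop_mon, Polynomial.coeff_smul, Polynomial.coeff_monomial]
  split_ifs <;> simp [MvPolynomial.smul_eq_C_mul]

lemma coeff_Qop_mon (σ : ℕ → SS) (a c : ℕ) (f : SS) :
    (Qop σ (Polynomial.monomial a f)).coeff c = if c < a then σ (a - 1 - c) * f else 0 := by
  rw [Qop_mon, Polynomial.finsetSum_coeff]
  simp only [Polynomial.coeff_monomial]
  by_cases h : c < a
  · rw [if_pos h, Finset.sum_eq_single (a - 1 - c)]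
    · rw [if_pos (by omega)]
    · intro r hr hne
      rw [if_neg]; simp at hr; omega
    · intro hr; simp at hr; omega
  · rw [if_neg h, Finset.sum_eq_zero]
    intro r hr; simp at hr; rw [if_neg]; omega

/-- Extension of a bilinear form to polynomials. -/
def bhat (β : SS →ₗ[k] SS →ₗ[k] k) : SX →ₗ[k] SX →ₗ[k] k :=
  Polynomial.lsum (fun m => β.compl₂ ((Polynomial.lcoeff SS m).restrictScalars k))

lemma bhat_mon (β : SS →ₗ[k] SS →ₗ[k] k) (m : ℕ) (f : SS) (h : SX) :
    bhat β (Polynomial.monomial m f) h = β f (h.coeff m) := by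
  simp [bhat, Polynomial.lsum_apply, Polynomial.sum_monomial_index]

lemma bhat_mon_right (β : SS →ₗ[k] SS →ₗ[k] k) (m : ℕ) (g : SS) (h : SX) :
    bhat β h (Polynomial.monomial m g) = β (h.coeff m) g := by
  induction h using Polynomial.induction_on' with
  | add p q hp hq => simp [hp, hq]
  | monomial n a =>
    rw [bhat_mon, Polynomial.coeff_monomial, Polynomial.coeff_monomial]
    by_cases h : m = n
    · simp [h]
    · simp [h, Ne.symm h]

theorem Top_adjoint (β : SS →ₗ[k] SS →ₗ[k] k) (κ κ' : ℕ → k) (ε ε' b : k) (σ σ' : ℕ → SS)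
    (h1 : ∀ i f g, β (Aop κ ε i f) g = β f (σ' i * g))
    (h2 : ∀ i f g, β (σ i * f) g = β f (Aop κ' ε' i g)) (n : ℕ) (f g : SS) :
    β (Top κ ε b σ n f) g = β f (Top κ' ε' b σ' n g) := by
  have hV : ∀ f h, bhat β (Vop κ ε f) h = β f (Sym σ' h) := by
    intro f h
    induction h using Polynomial.induction_on' with
    | add p q hp hq => simp [hp, hq]
    | monomial m a => rw [bhat_mon_right, coeff_Vop, h1, Sym_mon]
  have hS : ∀ h g, β (Sym σ h) g = bhat β h (Vop κ' ε' g) := by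
    intro h g
    induction h using Polynomial.induction_on' with
    | add p q hp hq => simp [hp, hq]
    | monomial m a => rw [bhat_mon, coeff_Vop, ← h2, Sym_mon]
  have hL : ∀ h h', bhat β (Lop κ ε b σ h) h' = bhat β h (Lop κ' ε' b σ' h') := by
    intro h h'
    induction h using Polynomial.induction_on' with
    | add p q hp hq => simp [hp, hq]
    | monomial a f =>
      induction h' using Polynomial.induction_on' with
      | add p q hp hq => simp [hp, hq]
      | monomial c g =>
        rw [bhat_mon, bhat_mon_right]
        simp only [Lop, LinearMap.add_apply, Polynomial.coeff_add, coeff_Nab_mon, coeff_eop_mon,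
          coeff_Qop_mon, map_add]
        rcases lt_trichotomy a c with h | h | h
        · simp [h, h.ne, h.ne', not_lt.2 h.le, h1]
        · subst h
          simp only [lt_irrefl, if_false, if_true, MvPolynomial.C_mul', map_smul, map_zero,
            LinearMap.smul_apply, LinearMap.zero_apply]
        · simp [h, h.ne, h.ne', not_lt.2 h.le, h2]
  have hLn : ∀ n h h', bhat β ((Lop κ ε b σ ^ n) h) h' = bhat β h ((Lop κ' ε' b σ' ^ n) h') := by
    intro n
    induction n with
    | zero => simp
    | succ n ih =>
      intro h h'
      rw [pow_succ, Module.End.mul_apply, ih, hL, pow_succ', Module.End.mul_apply]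
  simp only [Top, LinearMap.comp_apply]
  rw [hS, hLn, hV]

end Ops
end JackAux
end

open scoped Classical
noncomputable section
namespace JackAux

section Filt
variable {k : Type} [Field k]

local notation "SS" => MvPolynomial ℕ k
local notation "SX" => Polynomial (MvPolynomial ℕ k)

/-- weight of an exponent vector -/
def wt0 : (ℕ →₀ ℕ) →+ ℕ := Finsupp.weight (fun i : ℕ => i + 1)

lemma wt0_single (i n : ℕ) : wt0 (Finsupp.single i n) = n * (i + 1) := by
  simp [wt0, Finsupp.weight_single]

/-- the weight filtration -/
def Fil (k : Type) [Field k] (d : ℤ) : Submodule k (MvPolynomial ℕ k) where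
  carrier := {f | ∀ m, MvPolynomial.coeff m f ≠ 0 → (wt0 m : ℤ) ≤ d}
  zero_mem' := by intro m h; simp at h
  add_mem' := by
    intro f g hf hg m h
    by_cases h1 : MvPolynomial.coeff m f = 0
    · by_cases h2 : MvPolynomial.coeff m g = 0
      · simp [h1, h2] at h
      · exact hg m h2
    · exact hf m h1
  smul_mem' := by
    intro c f hf m h
    apply hf m
    intro h0
    simp [h0] at h

lemma Fil_mono {d e : ℤ} (h : d ≤ e) {f : SS} (hf : f ∈ Fil k d) : f ∈ Fil k e :=
  fun m hm => (hf m hm).trans h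

lemma Fil_mul {d e : ℤ} {f g : SS} (hf : f ∈ Fil k d) (hg : g ∈ Fil k e) :
    f * g ∈ Fil k (d + e) := by
  intro m hm
  rw [MvPolynomial.coeff_mul] at hm
  obtain ⟨⟨a, c⟩, hx, hne⟩ := Finset.exists_ne_zero_of_sum_ne_zero hm
  rw [Finset.HasAntidiagonal.mem_antidiagonal] at hx
  have h1 := hf a (left_ne_zero_of_mul hne)
  have h2 := hg c (right_ne_zero_of_mul hne)
  simp only at hx
  rw [← hx, map_add]
  push_cast; linarith

lemma Fil_mul' {d e u : ℤ} {f g : SS} (hf : f ∈ Fil k d) (hg : g ∈ Fil k e) (h : d + e ≤ u) :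
    f * g ∈ Fil k u := Fil_mono h (Fil_mul hf hg)

lemma Fil_C (c : k) : (MvPolynomial.C c : SS) ∈ Fil k 0 := by
  intro m hm
  rw [MvPolynomial.coeff_C] at hm
  split_ifs at hm with h
  · subst h; simp
  · exact absurd rfl hm

lemma Fil_monomial (m : ℕ →₀ ℕ) (c : k) : (MvPolynomial.monomial m c : SS) ∈ Fil k (wt0 m) := by
  intro n hn
  rw [MvPolynomial.coeff_monomial] at hn
  split_ifs at hn with h
  · subst h; simp
  · exact absurd rfl hn

lemma Fil_X (i : ℕ) : (MvPolynomial.X i : SS) ∈ Fil k (i + 1) := by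
  have := Fil_monomial (k := k) (Finsupp.single i 1) 1
  rw [wt0_single] at this
  simpa [MvPolynomial.X] using this

lemma Fil_C_mul {d : ℤ} (c : k) {f : SS} (hf : f ∈ Fil k d) : MvPolynomial.C c * f ∈ Fil k d := by
  rw [← MvPolynomial.smul_eq_C_mul]; exact (Fil k d).smul_mem c hf

lemma Fil_pderiv {d : ℤ} (i : ℕ) {f : SS} (hf : f ∈ Fil k d) :
    MvPolynomial.pderiv i f ∈ Fil k (d - i - 1) := by
  intro m hm
  rw [MvPolynomial.coeff_pderiv] at hm
  have := hf _ (left_ne_zero_of_mul hm)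
  rw [map_add, wt0_single] at this
  push_cast at this; linarith

lemma Fil_neg {d : ℤ} (hd : d < 0) {f : SS} (hf : f ∈ Fil k d) : f = 0 := by
  ext m
  by_contra h
  have := hf m (by simpa using h)
  omega

lemma Fil_pderiv_zero {d : ℤ} (i : ℕ) {f : SS} (hf : f ∈ Fil k d) (h : d ≤ i) :
    MvPolynomial.pderiv i f = 0 := Fil_neg (by omega) (Fil_pderiv i hf)

/-- filtration on polynomials -/
def OX (k : Type) [Field k] (d : ℤ) : Submodule k (Polynomial (MvPolynomial ℕ k)) where
  carrier := {h | ∀ m : ℕ, h.coeff m ∈ Fil k (d - m - 1)}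
  zero_mem' := by intro m; simp
  add_mem' := by
    intro f g hf hg m
    rw [Polynomial.coeff_add]
    exact add_mem (hf m) (hg m)
  smul_mem' := by
    intro c f hf m
    rw [Polynomial.coeff_smul]
    exact (Fil k _).smul_mem c (hf m)

lemma OX_mono {d e : ℤ} (h : d ≤ e) {f : SX} (hf : f ∈ OX k d) : f ∈ OX k e :=
  fun m => Fil_mono (by linarith) (hf m)

lemma OX_X {d : ℤ} {f : SX} (hf : f ∈ OX k d) : Polynomial.X * f ∈ OX k (d + 1) := by
  intro m
  cases m with
  | zero => simp
  | succ m =>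
    rw [Polynomial.coeff_X_mul]
    exact Fil_mono (by push_cast; linarith) (hf m)

lemma OX_Xpow {d : ℤ} (n : ℕ) {f : SX} (hf : f ∈ OX k d) : Polynomial.X ^ n * f ∈ OX k (d + n) := by
  induction n with
  | zero => simpa using hf
  | succ n ih =>
    rw [pow_succ', mul_assoc]
    exact OX_mono (by push_cast; linarith) (OX_X ih)

lemma OX_monomial {d e : ℤ} (m : ℕ) {f : SS} (hf : f ∈ Fil k d) (h : d + m + 1 ≤ e) :
    Polynomial.monomial m f ∈ OX k e := by
  intro j
  rw [Polynomial.coeff_monomial]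
  split_ifs with hj
  · subst hj; exact Fil_mono (by linarith) hf
  · exact zero_mem _

lemma OX_C {d : ℤ} {f : SS} (hf : f ∈ Fil k d) : Polynomial.C f ∈ OX k (d + 1) := by
  rw [← Polynomial.monomial_zero_left]
  exact OX_monomial 0 hf (by simp)

lemma OX_C_mul {d e : ℤ} {f : SS} {h : SX} (hf : f ∈ Fil k d) (hh : h ∈ OX k e) :
    Polynomial.C f * h ∈ OX k (d + e) := by
  intro m
  rw [Polynomial.coeff_C_mul]
  exact Fil_mul' hf (hh m) (by linarith)

lemma OX_nabla {d : ℤ} {f : SS} (κ : ℕ → k) (hf : f ∈ Fil k d) : nabla κ f ∈ OX k d := by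
  intro m
  rw [coeff_nabla]
  exact Fil_C_mul _ (Fil_pderiv m hf)

lemma OX_ind {d : ℤ} (T : SX →ₗ[k] SX) (P : Submodule k SX)
    (hT : ∀ (m : ℕ) f, f ∈ Fil k (d - m - 1) → T (Polynomial.monomial m f) ∈ P) {h : SX}
    (hh : h ∈ OX k d) : T h ∈ P := by
  rw [h.as_sum_support, map_sum]
  exact sum_mem fun m _ => hT m _ (hh m)

lemma OX_Sym {d : ℤ} (σ : ℕ → SS) (hσ : ∀ i : ℕ, σ i ∈ Fil k (i + 1)) {h : SX} (hh : h ∈ OX k d) :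
    Sym σ h ∈ Fil k d := by
  rw [h.as_sum_support, map_sum]
  refine sum_mem fun m _ => ?_
  rw [Sym_mon]
  exact Fil_mul' (hσ m) (hh m) (by linarith)

lemma Vop_eps (κ : ℕ → k) (ε : k) (f : SS) : Vop κ ε f = nabla κ f + ε • Polynomial.C f := by
  simp [Vop]

lemma OX_Lop {d : ℤ} (κ : ℕ → k) (b : k) (σ : ℕ → SS) (hσ : ∀ i : ℕ, σ i ∈ Fil k (i + 1)) {h : SX}
    (hh : h ∈ OX k d) : Lop κ 0 b σ h ∈ OX k d := by
  refine OX_ind _ _ (fun m f hf => ?_) hh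
  simp only [Lop, LinearMap.add_apply]
  refine add_mem (add_mem ?_ ?_) ?_
  · rw [Nab_mon, Vop_eps, zero_smul, add_zero, mul_comm]
    refine OX_mono ?_ (OX_Xpow (m + 1) (OX_nabla κ hf))
    push_cast; linarith
  · rw [eop_mon]
    exact (OX k d).smul_mem _ (OX_monomial m hf (by linarith))
  · rw [Qop_mon]
    refine sum_mem fun r hr => ?_
    have : r < m := by simpa using hr
    refine OX_monomial _ (Fil_mul (hσ r) hf) ?_
    omega

lemma Lop_one (κ : ℕ → k) (b : k) (σ : ℕ → SS) (h : SX) :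
    Lop κ 1 b σ h = Polynomial.X * h + Lop κ 0 b σ h := by
  induction h using Polynomial.induction_on' with
  | add p q hp hq => rw [map_add, map_add, hp, hq]; ring
  | monomial m f =>
    simp only [Lop, LinearMap.add_apply, Nab_mon, Vop_eps]
    rw [← Polynomial.C_mul_X_pow_eq_monomial]
    simp only [one_smul, zero_smul]
    ring

lemma Lop_C_mul (κ : ℕ → k) (b : k) (σ : ℕ → SS) (f : SS) (h : SX) :
    Lop κ 0 b σ (Polynomial.C f * h) =
      Polynomial.C f * Lop κ 0 b σ h + Polynomial.X * nabla κ f * h := by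
  induction h using Polynomial.induction_on' with
  | add p q hp hq => rw [mul_add, map_add, map_add, hp, hq]; ring
  | monomial m g =>
    rw [Polynomial.C_mul_monomial]
    simp only [Lop, LinearMap.add_apply, Nab_mon, Vop_eps, nabla_mul, eop_mon, Qop_mon, zero_smul,
      add_zero, mul_add, Finset.mul_sum, Polynomial.C_mul_monomial, mul_smul_comm]
    rw [Finset.sum_congr rfl (fun r _ => by rw [mul_left_comm (σ r)])]
    rw [← Polynomial.C_mul_X_pow_eq_monomial (n := m) (a := g)]
    ring

lemma Sym_C_mul (σ : ℕ → SS) (f : SS) (h : SX) :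
    Sym σ (Polynomial.C f * h) = f * Sym σ h := by
  induction h using Polynomial.induction_on' with
  | add p q hp hq => rw [mul_add, map_add, map_add, hp, hq]; ring
  | monomial m g => rw [Polynomial.C_mul_monomial, Sym_mon, Sym_mon]; ring

end Filt
end JackAux
end

open scoped Classical
noncomputable section
namespace JackAux

section Expand
variable {k : Type} [Field k]

local notation "SS" => MvPolynomial ℕ k
local notation "SX" => Polynomial (MvPolynomial ℕ k)

/-- `y_m = (m+1) X_m` -/
def yv (k : Type) [Field k] (m : ℕ) : MvPolynomial ℕ k :=
  MvPolynomial.C ((m + 1 : ℕ) : k) * MvPolynomial.X m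

/-- the raising operators on the functional side -/
def sg (a : k) (m : ℕ) : SS := MvPolynomial.C a * yv k m

lemma Fil_yv (m : ℕ) : yv k m ∈ Fil k (m + 1) := Fil_C_mul _ (Fil_X m)
lemma Fil_sg (a : k) (m : ℕ) : sg a m ∈ Fil k (m + 1) := Fil_C_mul _ (Fil_yv m)

def L0 (a b : k) : SX →ₗ[k] SX := Lop (fun _ => 1) 0 b (sg a)
def L1 (a b : k) : SX →ₗ[k] SX := Lop (fun _ => 1) 1 b (sg a)
def nab : SS →ₗ[k] SX := nabla (fun _ => 1)
def Sm (a : k) : SX →ₗ[k] SS := Sym (sg a)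
def Tt (a b : k) (n : ℕ) : SS →ₗ[k] SS := Top (fun _ => 1) 1 b (sg a) n

/-- shorthand for scalars in `SX` -/
def cc (c : k) : SX := Polynomial.C (MvPolynomial.C c)

lemma cc_add (c d : k) : (cc (c + d) : SX) = cc c + cc d := by simp [cc]
lemma cc_mul (c d : k) : (cc (c * d) : SX) = cc c * cc d := by simp [cc]
lemma smul_cc (c : k) (h : SX) : c • h = cc c * h := by
  rw [cc, ← Polynomial.smul_eq_C_mul, MvPolynomial.C_eq_smul_one]; simp

lemma L0_cc (a b c : k) (h : SX) : L0 a b (cc c * h) = cc c * L0 a b h := by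
  rw [← smul_cc, map_smul, smul_cc]

lemma Sm_cc (a c : k) (h : SX) : Sm a (cc c * h) = MvPolynomial.C c * Sm a h := by
  rw [← smul_cc, map_smul, MvPolynomial.smul_eq_C_mul]

def GG (M : ℕ) (w : ℕ → k) : SX :=
  ∑ r ∈ Finset.range M, cc (w r) * Polynomial.C (yv k r) * Polynomial.X ^ (M - 1 - r)

lemma GG_add (M : ℕ) (w w' : ℕ → k) : GG M (fun r => w r + w' r) = GG M w + GG M w' := by
  simp only [GG, cc_add, add_mul, Finset.sum_add_distrib]

lemma GG_smul (M : ℕ) (c : k) (w : ℕ → k) : GG M (fun r => c * w r) = cc c * GG M w := by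
  simp only [GG, cc_mul, Finset.mul_sum, mul_assoc]

lemma X_GG (M : ℕ) (w : ℕ → k) (h : w M = 0) : Polynomial.X * GG M w = GG (M + 1) w := by
  rw [GG, GG, Finset.sum_range_succ, h, Finset.mul_sum]
  simp only [cc, map_zero, zero_mul, add_zero]
  refine Finset.sum_congr rfl fun r hr => ?_
  have : M + 1 - 1 - r = (M - 1 - r) + 1 := by simp at hr; omega
  rw [this, pow_succ]; ring

lemma Xpow_GG (M j : ℕ) (w : ℕ → k) (h : ∀ r, M ≤ r → w r = 0) :
    Polynomial.X ^ j * GG M w = GG (M + j) w := by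
  induction j with
  | zero => simp
  | succ j ih => rw [pow_succ', mul_assoc, ih, X_GG _ _ (h _ (by omega))]; rfl

lemma GG_congr (M : ℕ) (w w' : ℕ → k) (h : ∀ r, r < M → w r = w' r) : GG M w = GG M w' :=
  Finset.sum_congr rfl fun r hr => by rw [h r (by simpa using hr)]

lemma L0_X (a b : k) (m : ℕ) : L0 a b (Polynomial.X ^ m) =
    cc (b * (m + 1 : ℕ)) * Polynomial.X ^ m + cc a * GG m (fun _ => 1) := by
  rw [Polynomial.X_pow_eq_monomial, L0, Lop]
  simp only [LinearMap.add_apply, Nab_mon, Vop_eps, eop_mon, Qop_mon]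
  rw [← MvPolynomial.C_1, nabla_C]
  simp only [zero_smul, add_zero, zero_mul, zero_add, smul_cc]
  congr 1
  rw [GG, Finset.mul_sum]
  refine Finset.sum_congr rfl fun r hr => ?_
  rw [← Polynomial.C_mul_X_pow_eq_monomial, sg]
  simp [cc]; ring

def vv (a b : k) (n : ℕ) : SX :=
  cc (b * (n + 1).choose 2) * Polynomial.X ^ (n - 1) +
    cc a * GG (n - 1) (fun r => ((n - 1 - r : ℕ) : k))

lemma vv_zero (a b : k) : vv a b 0 = 0 := by simp [vv, GG, cc]

lemma cc_zero : (cc (0 : k) : SX) = 0 := by simp [cc]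
lemma cc_one : (cc (1 : k) : SX) = 1 := by simp [cc]

lemma vv_succ (a b : k) (n : ℕ) :
    vv a b (n + 1) = Polynomial.X * vv a b n + L0 a b (Polynomial.X ^ n) := by
  rw [L0_X]
  cases n with
  | zero => simp [vv, GG, cc_zero]
  | succ n =>
    have hG : GG (n + 1) (fun r => ((n + 1 - r : ℕ) : k)) =
        Polynomial.X * GG n (fun r => ((n - r : ℕ) : k)) + GG (n + 1) (fun _ => 1) := by
      rw [X_GG n _ (by simp), ← GG_add]
      refine GG_congr _ _ _ fun r hr => ?_
      rw [show n + 1 - r = (n - r) + 1 by omega]; push_cast; ring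
    have h1 : vv a b (n + 1 + 1) = cc (b * (n + 1 + 1 + 1).choose 2) * Polynomial.X ^ (n + 1) +
      cc a * GG (n + 1) (fun r => ((n + 1 - r : ℕ) : k)) := rfl
    have h2 : vv a b (n + 1) = cc (b * (n + 1 + 1).choose 2) * Polynomial.X ^ n +
      cc a * GG n (fun r => ((n - r : ℕ) : k)) := rfl
    have h3 : b * ((n + 1 + 1 + 1).choose 2 : ℕ) = b * ((n + 1 + 1).choose 2 : ℕ) +
        b * ((n + 1 + 1 : ℕ) : k) := by
      rw [Nat.choose_succ_succ (n + 1 + 1) 1, Nat.choose_one_right]; push_cast; ring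
    rw [h1, h2, h3, hG, cc_add, pow_succ]
    ring

def ze (a b : k) (c n : ℕ) : SX :=
  cc (b * (3 * (n + 1).choose 3 + (c + 1) * (n + 1).choose 2)) * Polynomial.X ^ (n + c - 1) +
    cc a * GG (n + c - 1) (fun r => ((n - 1 - r).choose 2 : k) + (n + 1).choose 2 -
      (r + 2 - c).choose 2)

lemma choose_three (n : ℕ) : ((n + 2).choose 3 : ℕ) = (n + 1).choose 2 + (n + 1).choose 3 :=
  Nat.choose_succ_succ (n + 1) 2

lemma choose_two (n : ℕ) : ((n + 1).choose 2 : ℕ) = n + n.choose 2 := by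
  rw [Nat.choose_succ_succ n 1, Nat.choose_one_right]

lemma choose_two' [CharZero k] (n : ℕ) : ((n + 1).choose 2 : k) = (n + 1) * n / 2 := by
  induction n with
  | zero => simp
  | succ n ih => rw [choose_two, Nat.cast_add, ih]; push_cast; ring

lemma ze_zero (a b : k) (c : ℕ) : ze a b c 0 = 0 := by
  rw [ze, GG, Finset.sum_eq_zero]
  · simp [cc, Nat.choose_eq_zero_of_lt]
  · intro r hr
    have : r + 2 - c ≤ 1 := by simp at hr; omega
    rw [Nat.choose_eq_zero_of_lt (show r + 2 - c < 2 by omega)]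
    simp [cc]

lemma ze_succ [CharZero k] (a b : k) (c n : ℕ) :
    ze a b c (n + 1) = Polynomial.X * ze a b c n + Polynomial.X ^ (c + 1) * vv a b n +
      cc ((n + 1 : ℕ) : k) * L0 a b (Polynomial.X ^ (n + c)) := by
  rw [L0_X]
  have hG : (Polynomial.X : SX) * GG (n + c - 1) (fun r => ((n - 1 - r).choose 2 : k) +
      (n + 1).choose 2 - (r + 2 - c).choose 2) = GG (n + c) (fun r => ((n - 1 - r).choose 2 : k) +
      (n + 1).choose 2 - (r + 2 - c).choose 2) := by
    rcases Nat.eq_zero_or_pos (n + c) with h | h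
    · simp [h, GG]
    · rw [X_GG, show n + c - 1 + 1 = n + c by omega]
      rw [show n - 1 - (n + c - 1) = 0 by omega]
      rw [show n + c - 1 + 2 - c = n + 1 by omega]; simp
  have hv : (Polynomial.X : SX) ^ (c + 1) * GG (n - 1) (fun r => ((n - 1 - r : ℕ) : k)) =
      GG (n + c) (fun r => ((n - 1 - r : ℕ) : k)) := by
    rcases Nat.eq_zero_or_pos n with h | h
    · subst h; simp [GG, cc]
    · rw [Xpow_GG]
      · congr 1; omega
      · intro r hr; rw [show n - 1 - r = 0 by omega]; simp
  have hsum : GG (n + 1 + c - 1) (fun r => ((n + 1 - 1 - r).choose 2 : k) + (n + 1 + 1).choose 2 -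
      (r + 2 - c).choose 2) = GG (n + c) (fun r => ((n - 1 - r).choose 2 : k) +
      (n + 1).choose 2 - (r + 2 - c).choose 2) + GG (n + c) (fun r => ((n - 1 - r : ℕ) : k)) +
      cc ((n + 1 : ℕ) : k) * GG (n + c) (fun _ => 1) := by
    rw [← GG_smul, ← GG_add, ← GG_add, show n + 1 + c - 1 = n + c by omega]
    refine GG_congr _ _ _ fun r hr => ?_
    rw [choose_two (n + 1)]
    rcases Nat.lt_or_ge r n with h | h
    · rw [show n + 1 - 1 - r = (n - 1 - r) + 1 by omega, choose_two (n - 1 - r)]; push_cast; ring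
    · rw [show n + 1 - 1 - r = 0 by omega, show n - 1 - r = 0 by omega]; push_cast; simp; ring
  have e1 : ze a b c (n + 1) = cc (b * (3 * (n + 1 + 1).choose 3 + (c + 1) * (n + 1 + 1).choose 2)) *
      Polynomial.X ^ (n + c) + cc a * GG (n + 1 + c - 1) (fun r => ((n + 1 - 1 - r).choose 2 : k) +
      (n + 1 + 1).choose 2 - (r + 2 - c).choose 2) := by
    rw [ze]; congr 3; omega
  have e2 : Polynomial.X * ze a b c n = cc (b * (3 * (n + 1).choose 3 + (c + 1) * (n + 1).choose 2)) *
      Polynomial.X ^ (n + c) + cc a * (Polynomial.X * GG (n + c - 1)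
        (fun r => ((n - 1 - r).choose 2 : k) + (n + 1).choose 2 - (r + 2 - c).choose 2)) := by
    rw [ze]
    rcases Nat.eq_zero_or_pos (n + c) with h | h
    · have : n = 0 := by omega
      subst this
      simp only [Nat.choose_eq_zero_of_lt (show 0 + 1 < 3 by omega),
        Nat.choose_eq_zero_of_lt (show 0 + 1 < 2 by omega), Nat.cast_zero, mul_zero, add_zero,
        cc_zero, zero_mul, zero_add]
      ring
    · rw [show n + c = (n + c - 1) + 1 by omega, pow_succ]
      simp only [Nat.add_sub_cancel]; ring
  have e3 : Polynomial.X ^ (c + 1) * vv a b n = cc (b * (n + 1).choose 2) *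
      Polynomial.X ^ (n + c) + cc a * (Polynomial.X ^ (c + 1) *
        GG (n - 1) (fun r => ((n - 1 - r : ℕ) : k))) := by
    rw [vv]
    rcases Nat.eq_zero_or_pos n with h | h
    · subst h
      simp only [Nat.choose_eq_zero_of_lt (show 0 + 1 < 2 by omega), Nat.cast_zero, mul_zero,
        cc_zero, zero_mul, zero_add]
      ring
    · rw [show n + c = (c + 1) + (n - 1) by omega, pow_add]; ring
  rw [e1, e2, e3, hsum, hG, hv]
  have hk : b * (3 * ((n + 1 + 1).choose 3 : k) + (c + 1) * (n + 1 + 1).choose 2) =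
      b * (3 * (n + 1).choose 3 + (c + 1) * (n + 1).choose 2) + b * (n + 1).choose 2 +
      ((n + 1 : ℕ) : k) * (b * (n + c + 1 : ℕ)) := by
    rw [choose_three, choose_two (n + 1)]
    push_cast
    rw [choose_two']; field_simp; ring
  rw [hk, cc_add, cc_add, cc_mul ((n + 1 : ℕ) : k)]
  ring

def zz (a b : k) : ℕ → SX
  | 0 => 0
  | n + 1 => Polynomial.X * zz a b n + L0 a b (vv a b n)

lemma OX_cc {d : ℤ} (c : k) {h : SX} (hh : h ∈ OX k d) : cc c * h ∈ OX k d := by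
  rw [← smul_cc]; exact (OX k d).smul_mem c hh

lemma OX_L0 {d : ℤ} (a b : k) {h : SX} (hh : h ∈ OX k d) : L0 a b h ∈ OX k d :=
  OX_Lop _ _ _ (Fil_sg a) hh

lemma OX_Sm {d : ℤ} (a : k) {h : SX} (hh : h ∈ OX k d) : Sm a h ∈ Fil k d :=
  OX_Sym _ (Fil_sg a) hh

lemma OX_Xp (n : ℕ) : (Polynomial.X ^ n : SX) ∈ OX k (n + 1) := by
  rw [Polynomial.X_pow_eq_monomial]
  exact OX_monomial n (d := 0) (by rw [← MvPolynomial.C_1]; exact Fil_C _) (by simp)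

lemma OX_vv (a b : k) (n : ℕ) : vv a b n ∈ OX k n := by
  induction n with
  | zero => rw [vv_zero]; exact zero_mem _
  | succ n ih =>
    rw [vv_succ]
    refine add_mem ?_ ?_
    · exact OX_mono (by push_cast; simp) (OX_X ih)
    · exact OX_mono (by push_cast; simp) (OX_L0 a b (OX_Xp n))

lemma OX_zz (a b : k) (n : ℕ) : zz a b n ∈ OX k (n - 1) := by
  induction n with
  | zero => exact zero_mem _
  | succ n ih =>
    refine add_mem ?_ ?_
    · exact OX_mono (by push_cast; simp) (OX_X ih)
    · exact OX_mono (by push_cast; simp) (OX_L0 a b (OX_vv a b n))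

def YY (a b : k) (n : ℕ) (f : SS) : SX :=
  cc ((n + 1 : ℕ) : k) * Polynomial.X ^ n * nab f + Polynomial.C f * vv a b n

def HH (K : ℕ) (f : SS) : SX :=
  ∑ c ∈ Finset.range K, Polynomial.X ^ c * nab (MvPolynomial.pderiv c f)

def ZZ (a b : k) (K n : ℕ) (f : SS) : SX :=
  cc ((n + 1).choose 2 : k) * Polynomial.X ^ n * HH K f +
    ∑ c ∈ Finset.range K, Polynomial.C (MvPolynomial.pderiv c f) * ze a b c n +
    Polynomial.C f * zz a b n

lemma L0_C_mul (a b : k) (f : SS) (h : SX) : L0 a b (Polynomial.C f * h) =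
    Polynomial.C f * L0 a b h + Polynomial.X * nab f * h := Lop_C_mul _ _ _ _ _

lemma YY_succ (a b : k) (n : ℕ) (f : SS) :
    YY a b (n + 1) f = Polynomial.X * YY a b n f + L0 a b (Polynomial.C f * Polynomial.X ^ n) := by
  rw [L0_C_mul, YY, YY, vv_succ]
  push_cast
  rw [cc_add ((n : k) + 1) 1]
  simp only [cc, map_one, pow_succ]
  ring

/-- only variables below `K` occur -/
def VK (K : ℕ) (f : SS) : Prop := ∀ c, K ≤ c → MvPolynomial.pderiv c f = 0

lemma nab_eq_sum {K : ℕ} {f : SS} (hf : VK K f) :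
    nab f = ∑ c ∈ Finset.range K, Polynomial.C (MvPolynomial.pderiv c f) * Polynomial.X ^ c := by
  ext1 m
  rw [nab, coeff_nabla, Polynomial.finsetSum_coeff]
  simp only [Polynomial.coeff_C_mul, Polynomial.coeff_X_pow, map_one, one_mul, mul_ite, mul_one,
    mul_zero, Finset.sum_ite_eq, Finset.mem_range]
  split_ifs with h
  · rfl
  · exact hf m (by omega)

lemma ZZ_succ [CharZero k] (a b : k) (K n : ℕ) (f : SS) (hf : VK K f) :
    ZZ a b K (n + 1) f = Polynomial.X * ZZ a b K n f + L0 a b (YY a b n f) := by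
  have e0 : L0 a b (Polynomial.X ^ n * nab f) = ∑ c ∈ Finset.range K,
      Polynomial.C (MvPolynomial.pderiv c f) * L0 a b (Polynomial.X ^ (n + c)) +
      Polynomial.X ^ (n + 1) * HH K f := by
    conv_lhs => rw [nab_eq_sum hf]
    rw [Finset.mul_sum, map_sum, HH, Finset.mul_sum, ← Finset.sum_add_distrib]
    refine Finset.sum_congr rfl fun c _ => ?_
    rw [mul_left_comm, ← pow_add, L0_C_mul]
    rw [pow_add, pow_add]; ring
  have e1 : L0 a b (YY a b n f) = cc ((n + 1 : ℕ) : k) * L0 a b (Polynomial.X ^ n * nab f) +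
      (Polynomial.C f * L0 a b (vv a b n) + Polynomial.X * nab f * vv a b n) := by
    rw [YY, map_add, L0_C_mul, mul_assoc, L0_cc]
  have e2 : ∑ c ∈ Finset.range K, Polynomial.C (MvPolynomial.pderiv c f) * ze a b c (n + 1) =
      Polynomial.X * (∑ c ∈ Finset.range K, Polynomial.C (MvPolynomial.pderiv c f) * ze a b c n) +
      Polynomial.X * nab f * vv a b n + cc ((n + 1 : ℕ) : k) * ∑ c ∈ Finset.range K,
      Polynomial.C (MvPolynomial.pderiv c f) * L0 a b (Polynomial.X ^ (n + c)) := by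
    rw [nab_eq_sum hf, Finset.mul_sum, Finset.mul_sum, Finset.sum_mul, Finset.mul_sum,
      ← Finset.sum_add_distrib, ← Finset.sum_add_distrib]
    refine Finset.sum_congr rfl fun c _ => ?_
    rw [ze_succ, pow_succ]; ring
  have e3 : (cc ((n + 1 + 1).choose 2 : k) : SX) = cc ((n + 1 : ℕ) : k) + cc ((n + 1).choose 2 : k) := by
    rw [← cc_add, choose_two (n + 1)]; push_cast; rfl
  rw [e1, e0, ZZ, ZZ, zz, e2, e3]
  ring

lemma nab_OX {d : ℤ} {f : SS} (hf : f ∈ Fil k d) : nab f ∈ OX k d := OX_nabla _ hf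

lemma VK_of_Fil {d : ℤ} {K : ℕ} {f : SS} (hf : f ∈ Fil k d) (h : d ≤ K) : VK K f :=
  fun c hc => Fil_pderiv_zero c hf (by omega)

lemma L1_eq (a b : k) (h : SX) : L1 a b h = Polynomial.X * h + L0 a b h := Lop_one _ _ _ _

lemma YY_OX {d : ℤ} (a b : k) (n : ℕ) {f : SS} (hf : f ∈ Fil k d) : YY a b n f ∈ OX k (n + d) := by
  refine add_mem ?_ ?_
  · rw [mul_assoc]
    exact OX_cc _ (OX_mono (by linarith) (OX_Xpow n (nab_OX hf)))
  · exact OX_mono (by linarith) (OX_C_mul hf (OX_vv a b n))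

lemma ZZ_OX [CharZero k] {d : ℤ} (a b : k) (K n : ℕ) {f : SS} (hf : f ∈ Fil k d) (h : d ≤ K) :
    ZZ a b K n f ∈ OX k (n + d - 1) := by
  induction n with
  | zero => simp [ZZ, ze_zero, zz, cc]
  | succ n ih =>
    rw [ZZ_succ a b K n f (VK_of_Fil hf h)]
    refine add_mem ?_ ?_
    · exact OX_mono (by push_cast; linarith) (OX_X ih)
    · exact OX_mono (by push_cast; linarith) (OX_L0 a b (YY_OX a b n hf))

theorem L1_expand [CharZero k] {d : ℤ} (a b : k) (K n : ℕ) {f : SS} (hf : f ∈ Fil k d) (h : d ≤ K) :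
    ((L1 a b) ^ n) (Vop (fun _ => 1) 1 f) - (Polynomial.C f * Polynomial.X ^ n + YY a b n f +
      ZZ a b K n f) ∈ OX k (n + d - 2) := by
  induction n with
  | zero =>
    have : ((L1 a b) ^ 0) (Vop (fun _ => 1) 1 f) - (Polynomial.C f * Polynomial.X ^ 0 + YY a b 0 f +
      ZZ a b K 0 f) = 0 := by
      simp [ZZ, ze_zero, zz, YY, cc, vv_zero, Vop_eps, nab]; ring
    rw [this]; exact zero_mem _
  | succ n ih =>
    rw [pow_succ', Module.End.mul_apply, L1_eq]
    set u := ((L1 a b) ^ n) (Vop (fun _ => 1) 1 f) with hu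
    set e := u - (Polynomial.C f * Polynomial.X ^ n + YY a b n f + ZZ a b K n f) with he
    have hue : u = Polynomial.C f * Polynomial.X ^ n + YY a b n f + ZZ a b K n f + e := by
      rw [he]; ring
    have : Polynomial.X * u + L0 a b u - (Polynomial.C f * Polynomial.X ^ (n + 1) +
        YY a b (n + 1) f + ZZ a b K (n + 1) f) = Polynomial.X * e + L0 a b (ZZ a b K n f) +
          L0 a b e := by
      rw [YY_succ, ZZ_succ a b K n f (VK_of_Fil hf h), hue]
      simp only [map_add, pow_succ]; ring
    rw [this]
    refine add_mem (add_mem ?_ ?_) ?_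
    · exact OX_mono (by push_cast; linarith) (OX_X ih)
    · exact OX_mono (by push_cast; linarith) (OX_L0 a b (ZZ_OX a b K n hf h))
    · exact OX_mono (by push_cast; linarith) (OX_L0 a b ih)

end Expand
end JackAux
end

open scoped Classical
noncomputable section
namespace JackAux

section Key
variable {k : Type} [Field k]

local notation "SS" => MvPolynomial ℕ k
local notation "SX" => Polynomial (MvPolynomial ℕ k)

def Ad (k : Type) [Field k] (c : ℕ) : Derivation k (MvPolynomial ℕ k) (MvPolynomial ℕ k) :=
  MvPolynomial.mkDerivation k (fun i => yv k (c + i))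

lemma Ad_X (c i : ℕ) : Ad k c (MvPolynomial.X i) = yv k (c + i) := by
  simp [Ad, MvPolynomial.mkDerivation_X]

lemma Ad_C (c : ℕ) (x : k) : Ad k c (MvPolynomial.C x) = 0 := by
  simp [Ad]

lemma Ad_mul (c : ℕ) (f g : SS) : Ad k c (f * g) = f * Ad k c g + g * Ad k c f := by
  simp [Derivation.leibniz]

lemma Ad_C_mul (c : ℕ) (x : k) (f : SS) :
    Ad k c (MvPolynomial.C x * f) = MvPolynomial.C x * Ad k c f := by
  rw [Ad_mul, Ad_C, mul_zero, add_zero]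

lemma Ad_yv (c m : ℕ) : Ad k c (yv k m) = MvPolynomial.C ((m + 1 : ℕ) : k) * yv k (c + m) := by
  rw [yv, Ad_C_mul, Ad_X]

lemma Ad_eq_sum {K : ℕ} {f : SS} (hf : VK K f) (c : ℕ) :
    Ad k c f = ∑ i ∈ Finset.range K, yv k (c + i) * MvPolynomial.pderiv i f := by
  have h : ∀ f : SS, Ad k c f = Sym (fun i => yv k (c + i)) (nab f) := by
    intro f
    induction f using MvPolynomial.induction_on with
    | C a => simp [nab, nabla_C]
    | add p q hp hq => simp [hp, hq]
    | mul_X p i hp =>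
      rw [Ad_mul, hp, Ad_X, nab, nabla_mul, nabla_X, map_add, Sym_C_mul, Sym_C_mul, Sym_mon]
      simp
  rw [h, nab_eq_sum hf, map_sum]
  refine Finset.sum_congr rfl fun i _ => ?_
  rw [Sym_C_mul, Polynomial.X_pow_eq_monomial, Sym_mon, mul_one, mul_comm]

def SG (M : ℕ) (w : ℕ → k) : SS :=
  ∑ r ∈ Finset.range M, MvPolynomial.C (w r) * (yv k r * yv k (M - 1 - r))

lemma Sm_X (a : k) (m : ℕ) : Sm a (Polynomial.X ^ m) = MvPolynomial.C a * yv k m := by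
  rw [Sm, Polynomial.X_pow_eq_monomial, Sym_mon, mul_one]; rfl

lemma Sm_C_mul (a : k) (f : SS) (h : SX) : Sm a (Polynomial.C f * h) = f * Sm a h :=
  Sym_C_mul _ _ _

lemma Sm_GG (a : k) (M : ℕ) (w : ℕ → k) : Sm a (GG M w) = MvPolynomial.C a * SG M w := by
  rw [GG, SG, map_sum, Finset.mul_sum]
  refine Finset.sum_congr rfl fun r _ => ?_
  rw [mul_assoc, Sm_cc, Sm_C_mul, Sm_X]; ring

lemma SG_reflect (M : ℕ) (w : ℕ → k) : SG M w = SG M (fun r => w (M - 1 - r)) := by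
  rw [SG, ← Finset.sum_range_reflect, SG]
  refine Finset.sum_congr rfl fun r hr => ?_
  rw [show M - 1 - (M - 1 - r) = r by simp at hr; omega, mul_comm (yv k r)]

lemma SG_add (M : ℕ) (w w' : ℕ → k) : SG M (fun r => w r + w' r) = SG M w + SG M w' := by
  simp only [SG, map_add, add_mul, Finset.sum_add_distrib]

lemma SG_sub (M : ℕ) (w w' : ℕ → k) : SG M (fun r => w r - w' r) = SG M w - SG M w' := by
  simp only [SG, map_sub, sub_mul, Finset.sum_sub_distrib]

lemma SG_smul (M : ℕ) (c : k) (w : ℕ → k) :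
    SG M (fun r => c * w r) = MvPolynomial.C c * SG M w := by
  simp only [SG, map_mul, Finset.mul_sum, mul_assoc]

lemma SG_congr (M : ℕ) (w w' : ℕ → k) (h : ∀ r, r < M → w r = w' r) : SG M w = SG M w' :=
  Finset.sum_congr rfl fun r hr => by rw [h r (by simpa using hr)]

lemma SG_symm [CharZero k] (M : ℕ) (w w' : ℕ → k)
    (h : ∀ r, r < M → w r + w (M - 1 - r) = w' r + w' (M - 1 - r)) : SG M w = SG M w' := by
  have key : ∀ w : ℕ → k, SG M w + SG M w = SG M (fun r => w r + w (M - 1 - r)) := by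
    intro w
    rw [SG_add, ← SG_reflect]
  have h2 : SG M w + SG M w = SG M w' + SG M w' := by
    rw [key, key]; exact SG_congr _ _ _ h
  have h3 : (2 : SS) * (SG M w - SG M w') = 0 := by linear_combination h2
  rcases mul_eq_zero.1 h3 with h4 | h4
  · exact absurd h4 two_ne_zero
  · exact sub_eq_zero.1 h4

lemma SG_zero : SG 0 = fun _ : ℕ → k => (0 : SS) := by ext1; simp [SG]

lemma Ad_SG (c n : ℕ) : Ad k c (SG (n - 1) (fun r => ((n - 1 - r : ℕ) : k))) =
    SG (n + c - 1) (fun r => (n : k) * ((n - 1 - r : ℕ) : k)) := by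
  cases n with
  | zero => 
    rw [SG_smul]; simp [SG_zero]
  | succ n =>
    have hl : Ad k c (SG n (fun r => ((n - r : ℕ) : k))) =
        ∑ r ∈ Finset.range n, MvPolynomial.C (((n - r : ℕ) : k) * ((r + 1 : ℕ) : k)) *
          (yv k (n - 1 - r) * yv k (c + r)) +
        ∑ r ∈ Finset.range n, MvPolynomial.C (((n - r : ℕ) : k) * ((n - 1 - r + 1 : ℕ) : k)) *
          (yv k r * yv k (c + (n - 1 - r))) := by
      rw [SG, map_sum, ← Finset.sum_add_distrib]
      refine Finset.sum_congr rfl fun r _ => ?_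
      rw [Ad_C_mul, Ad_mul, Ad_yv, Ad_yv, map_mul, map_mul]; ring
    have hr : SG (n + c) (fun r => ((n + 1 : ℕ) : k) * ((n - r : ℕ) : k)) =
        ∑ r ∈ Finset.range n, MvPolynomial.C (((n + 1 : ℕ) : k) * ((n - r : ℕ) : k)) *
          (yv k r * yv k (c + (n - 1 - r))) := by
      rw [SG, Finset.sum_range_add]
      rw [Finset.sum_eq_zero (s := Finset.range c), add_zero]
      · refine Finset.sum_congr rfl fun r hr => ?_
        rw [show n + c - 1 - r = c + (n - 1 - r) by simp at hr; omega]
      · intro r _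
        rw [show n - (n + r) = 0 by omega]; simp
    rw [show n + 1 - 1 = n by omega, show n + 1 + c - 1 = n + c by omega, hl, hr,
      ← Finset.sum_range_reflect, ← Finset.sum_add_distrib]
    refine Finset.sum_congr rfl fun r hr => ?_
    have hrn : r < n := by simpa using hr
    rw [show n - 1 - (n - 1 - r) = r by omega, ← add_mul, ← map_add]
    congr 2
    rw [show n - (n - 1 - r) = r + 1 by omega, show n - 1 - r + 1 = n - r by omega,
      mul_comm (((r + 1 : ℕ) : k)), ← mul_add, mul_comm, ← Nat.cast_add,
      show r + 1 + (n - r) = n + 1 by omega]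

def RR (a b : k) (n c : ℕ) : SS :=
  MvPolynomial.C (b / 2 * n * c) * yv k (n + c - 1) +
    MvPolynomial.C (a / 2) * SG (n + c - 1)
      (fun r => ((min (min n c) (min (r + 1) (n + c - 1 - r)) : ℕ) : k))

theorem key_lemma [CharZero k] (a b : k) (n c : ℕ) :
    Sm a (ze a b c n) - Ad k c (Sm a (vv a b n)) = MvPolynomial.C ((n + 1 : ℕ) * a) * RR a b n c := by
  have h1 : Sm a (ze a b c n) = MvPolynomial.C (b * (3 * (n + 1).choose 3 + (c + 1) * (n + 1).choose 2))
      * (MvPolynomial.C a * yv k (n + c - 1)) + MvPolynomial.C a * (MvPolynomial.C a *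
      SG (n + c - 1) (fun r => ((n - 1 - r).choose 2 : k) + (n + 1).choose 2 -
      (r + 2 - c).choose 2)) := by
    rw [ze, map_add, Sm_cc, Sm_cc, Sm_X, Sm_GG]
  have h2 : Ad k c (Sm a (vv a b n)) = MvPolynomial.C (b * (n + 1).choose 2 * n) *
      (MvPolynomial.C a * yv k (n + c - 1)) + MvPolynomial.C a * (MvPolynomial.C a *
      SG (n + c - 1) (fun r => (n : k) * ((n - 1 - r : ℕ) : k))) := by
    rw [vv, map_add, Sm_cc, Sm_cc, Sm_X, Sm_GG, map_add, Ad_C_mul, Ad_C_mul, Ad_C_mul, Ad_C_mul,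
      Ad_SG, Ad_yv]
    congr 1
    rcases Nat.eq_zero_or_pos n with h | h
    · subst h; simp
    · rw [show n - 1 + 1 = n by omega, show c + (n - 1) = n + c - 1 by omega]
      simp only [map_mul]; ring
  have h3 : SG (n + c - 1) (fun r => ((n - 1 - r).choose 2 : k) + (n + 1).choose 2 -
      (r + 2 - c).choose 2 - (n : k) * ((n - 1 - r : ℕ) : k)) = SG (n + c - 1)
      (fun r => ((n + 1 : ℕ) : k) * 2⁻¹ *
        ((min (min n c) (min (r + 1) (n + c - 1 - r)) : ℕ) : k)) := by
    apply SG_symm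
    intro r hr
    set s := n + c - 1 - 1 - r with hs
    have hmin : n + c - 1 - s = r + 1 := by omega
    have hmin' : n + c - 1 - r = s + 1 := by omega
    rw [hmin, hmin', min_comm (s + 1)]
    have e1 : r + 2 - c = n - s := by omega
    have e2 : s + 2 - c = n - r := by omega
    rw [e1, e2]
    have t : ∀ r : ℕ, (((n - r).choose 2 : ℕ) : k) = ((n - 1 - r).choose 2 : ℕ) + ((n - 1 - r : ℕ) : k) := by
      intro r
      rcases Nat.lt_or_ge r n with h | h
      · rw [show n - r = (n - 1 - r) + 1 by omega, choose_two]; push_cast; ring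
      · rw [show n - r = 0 by omega, show n - 1 - r = 0 by omega]; simp
    rw [t r, t s, choose_two']
    have m : (n : ℤ) - (n - 1 - r : ℕ) - (n - 1 - s : ℕ) = (min (min n c) (min (r + 1) (s + 1)) : ℕ) := by
      omega
    have m' : ((min (min n c) (min (r + 1) (s + 1)) : ℕ) : k) =
        (n : k) - (n - 1 - r : ℕ) - (n - 1 - s : ℕ) := by
      have := congrArg (fun z : ℤ => (z : k)) m
      simp only [Int.cast_sub, Int.cast_natCast] at this
      exact this.symm
    rw [m']
    push_cast
    field_simp
    ring
  rw [SG_sub, SG_smul _ (((n + 1 : ℕ) : k) * 2⁻¹)] at h3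
  have h4 : b * (3 * ((n + 1).choose 3 : k) + (c + 1) * (n + 1).choose 2) -
      b * (n + 1).choose 2 * n = (n + 1 : ℕ) * (b / 2 * n * c) := by
    have : (3 * (n + 1).choose 3 : k) = (n - 1) * (n + 1).choose 2 := by
      have := Nat.choose_succ_right_eq (n + 1) 2
      have h' := congrArg (fun z : ℕ => (z : k)) this
      rcases Nat.eq_zero_or_pos n with h | h
      · subst h; simp [Nat.choose_eq_zero_of_lt]
      · rw [show n + 1 - 2 = n - 1 by omega] at h'
        simp only [Nat.cast_mul] at h'
        rw [Nat.cast_sub h] at h'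
        push_cast at h'
        linear_combination h'
    rw [this, choose_two']; push_cast; field_simp; ring
  rw [h1, h2, RR]
  have h4' := congrArg (fun z => (MvPolynomial.C z : SS)) h4
  have h5 : (MvPolynomial.C (a / 2) : SS) = MvPolynomial.C a * MvPolynomial.C (2⁻¹ : k) := by
    rw [← map_mul, div_eq_mul_inv]
  simp only [map_sub, map_mul] at h4' h3 ⊢
  rw [h5]
  linear_combination (MvPolynomial.C a * yv k (n + c - 1)) * h4' + MvPolynomial.C a * MvPolynomial.C a * h3

end Key
end JackAux
end

open scoped Classical
noncomputable section
namespace JackAux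

section Stars
variable {k : Type} [Field k]

local notation "SS" => MvPolynomial ℕ k
local notation "SX" => Polynomial (MvPolynomial ℕ k)

/-- partial derivatives, as plain linear maps -/
def D (a : ℕ) : SS →ₗ[k] SS := (MvPolynomial.pderiv a).toLinearMap

lemma D_def (a : ℕ) (f : SS) : D a f = MvPolynomial.pderiv a f := rfl

lemma D_mul (a : ℕ) (f g : SS) : D a (f * g) = f * D a g + g * D a f := by
  simp [D_def, Derivation.leibniz]

lemma D_X_mul (a j : ℕ) (f : SS) : D a (MvPolynomial.X j * f) =
    MvPolynomial.X j * D a f + if a = j then f else 0 := by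
  rw [D_mul, D_def a (MvPolynomial.X j), MvPolynomial.pderiv_X]
  by_cases h : a = j
  · subst h; simp
  · simp [h, Ne.symm h]

lemma D_C_mul (a : ℕ) (c : k) (f : SS) : D a (MvPolynomial.C c * f) = MvPolynomial.C c * D a f := by
  rw [← MvPolynomial.smul_eq_C_mul, map_smul, MvPolynomial.smul_eq_C_mul]

lemma D_comm (a c : ℕ) (f : SS) : D a (D c f) = D c (D a f) := by
  simp only [D_def]
  ext m
  rw [MvPolynomial.coeff_pderiv, MvPolynomial.coeff_pderiv, MvPolynomial.coeff_pderiv,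
    MvPolynomial.coeff_pderiv, add_right_comm]
  by_cases h : a = c
  · subst h; rfl
  · simp [h, Ne.symm h]; ring

lemma D_Fil {d : ℤ} (i : ℕ) {f : SS} (hf : f ∈ Fil k d) : D i f ∈ Fil k (d - i - 1) :=
  Fil_pderiv i hf

def S2 (K n : ℕ) (g : SS) : SS := MvPolynomial.C ((n : k) / 2) *
  ∑ c ∈ Finset.range K, ∑ d ∈ Finset.range K, yv k (n + c + d) * D c (D d g)

def R1 (a b : k) (K n : ℕ) (g : SS) : SS := ∑ c ∈ Finset.range K, RR a b n c * D c g

def BB (a b : k) (K n : ℕ) (g : SS) : SS := R1 a b K n g + S2 K n g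

def WW (K a a' : ℕ) (g : SS) : SS :=
  ∑ c ∈ Finset.range K, ∑ c' ∈ Finset.range K, yv k (a + c) * yv k (a' + c') * D c (D c' g)

def st1 (K : ℕ) (f g : SS) : SS := ∑ a ∈ Finset.range K, D a f * Ad k a g

def st2 (a b : k) (K : ℕ) (f g : SS) : SS :=
  ∑ i ∈ Finset.range K, D i f * BB a b K i g + ∑ i ∈ Finset.range K, D i g * S2 K i f +
    MvPolynomial.C (2⁻¹ : k) * ∑ i ∈ Finset.range K, ∑ j ∈ Finset.range K, D i (D j f) * WW K i j g

lemma WW_comm (K a a' : ℕ) (g : SS) : WW K a a' g = WW K a' a g := by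
  rw [WW, Finset.sum_comm, WW]
  refine Finset.sum_congr rfl fun c _ => Finset.sum_congr rfl fun c' _ => ?_
  rw [D_comm c' c]; ring

lemma st1_X (K j : ℕ) (hj : j < K) (f g : SS) :
    st1 K (MvPolynomial.X j * f) g = MvPolynomial.X j * st1 K f g + f * Ad k j g := by
  simp only [st1, D_X_mul, add_mul, ite_mul, zero_mul, Finset.sum_add_distrib, Finset.mul_sum,
    Finset.sum_ite_eq', Finset.mem_range, hj, if_true, mul_assoc]

lemma D_X (a i : ℕ) : D a (MvPolynomial.X i : SS) = if a = i then 1 else 0 := by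
  rw [D_def, MvPolynomial.pderiv_X, Pi.single_apply]
  simp [eq_comm]

lemma C_two : (MvPolynomial.C (2 : k) : SS) = 2 := map_ofNat MvPolynomial.C 2

lemma D_Ad (a j : ℕ) (f : SS) : D a (Ad k j f) = Ad k j (D a f) +
    if j ≤ a then MvPolynomial.C ((a + 1 : ℕ) : k) * D (a - j) f else 0 := by
  induction f using MvPolynomial.induction_on with
  | C c => simp [D_def]
  | add p q hp hq =>
    simp only [map_add, hp, hq]
    split_ifs <;> ring
  | mul_X p i hp =>
    have e1 : (Ad k j) (if a = i then p else 0) = if a = i then Ad k j p else 0 := by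
      split_ifs <;> simp
    rw [mul_comm p, D_X_mul, Ad_mul, map_add, Ad_X, map_add, D_X_mul, D_mul, hp, Ad_mul, Ad_X,
      yv, D_C_mul, D_X, D_X_mul, e1]
    by_cases h2 : j ≤ a
    · by_cases h3 : a = j + i
      · have h4 : a - j = i := by omega
        simp only [h2, h4, if_true, ← h3]
        split_ifs <;> ring
      · have h4 : ¬ (a - j = i) := by omega
        simp only [h2, h3, h4, if_true, if_false]
        split_ifs <;> ring
    · have h3 : ¬ (a = j + i) := by omega
      simp only [h2, h3, if_false]
      split_ifs <;> ring

lemma sum_DX (K l j : ℕ) (hj : j < K) (f : SS) [CharZero k] : S2 K l (MvPolynomial.X j * f) =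
    MvPolynomial.X j * S2 K l f +
      MvPolynomial.C (l : k) * ∑ c ∈ Finset.range K, yv k (l + j + c) * D c f := by
  have h : ∑ c ∈ Finset.range K, ∑ d ∈ Finset.range K,
      yv k (l + c + d) * D c (D d (MvPolynomial.X j * f)) =
      MvPolynomial.X j * (∑ c ∈ Finset.range K, ∑ d ∈ Finset.range K,
        yv k (l + c + d) * D c (D d f)) + (∑ c ∈ Finset.range K, yv k (l + j + c) * D c f) +
        ∑ c ∈ Finset.range K, yv k (l + j + c) * D c f := by
    have : ∀ c d : ℕ, yv k (l + c + d) * D c (D d (MvPolynomial.X j * f)) =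
        MvPolynomial.X j * (yv k (l + c + d) * D c (D d f)) +
        (if c = j then yv k (l + j + d) * D d f else 0) +
        (if d = j then yv k (l + j + c) * D c f else 0) := by
      intro c d
      rw [D_X_mul, map_add, D_X_mul]
      by_cases h1 : c = j <;> by_cases h2 : d = j <;> simp [h1, h2] <;>
        first
          | ring1
          | (rw [show l + c + j = l + j + c by ring]; ring)
    simp only [this, Finset.sum_add_distrib, Finset.mul_sum]
    congr 1
    · congr 1
      rw [Finset.sum_comm]
      simp [hj]
    · simp [hj]
  rw [S2, S2, h]
  have h2 : (MvPolynomial.C (l : k) : SS) = MvPolynomial.C ((l : k) / 2) * 2 := by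
    rw [← C_two, ← map_mul, div_mul_cancel₀ _ two_ne_zero]
  rw [h2]; ring

lemma S2_mul [CharZero k] (K n : ℕ) (f g : SS) : S2 K n (f * g) = f * S2 K n g + g * S2 K n f +
    MvPolynomial.C (n : k) * ∑ c ∈ Finset.range K, ∑ d ∈ Finset.range K,
      yv k (n + c + d) * (D c f * D d g) := by
  have h2 : (MvPolynomial.C (n : k) : SS) = MvPolynomial.C ((n : k) / 2) * 2 := by
    rw [← C_two, ← map_mul, div_mul_cancel₀ _ two_ne_zero]
  have h3 : ∑ c ∈ Finset.range K, ∑ d ∈ Finset.range K, yv k (n + c + d) * (D c f * D d g) =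
      ∑ c ∈ Finset.range K, ∑ d ∈ Finset.range K, yv k (n + c + d) * (D d f * D c g) := by
    rw [Finset.sum_comm]
    refine Finset.sum_congr rfl fun c _ => Finset.sum_congr rfl fun c' _ => ?_
    rw [add_right_comm]
  have h4 : ∑ c ∈ Finset.range K, ∑ d ∈ Finset.range K, yv k (n + c + d) * D c (D d (f * g)) =
      f * (∑ c ∈ Finset.range K, ∑ d ∈ Finset.range K, yv k (n + c + d) * D c (D d g)) +
      g * (∑ c ∈ Finset.range K, ∑ d ∈ Finset.range K, yv k (n + c + d) * D c (D d f)) +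
      (∑ c ∈ Finset.range K, ∑ d ∈ Finset.range K, yv k (n + c + d) * (D c f * D d g)) +
      ∑ c ∈ Finset.range K, ∑ d ∈ Finset.range K, yv k (n + c + d) * (D d f * D c g) := by
    simp only [Finset.mul_sum, ← Finset.sum_add_distrib]
    refine Finset.sum_congr rfl fun c _ => Finset.sum_congr rfl fun c' _ => ?_
    rw [D_mul, map_add, D_mul, D_mul]; ring
  rw [S2, S2, S2, h4, ← h3, h2]; ring

lemma R1_mul (a b : k) (K n : ℕ) (f g : SS) :
    R1 a b K n (f * g) = f * R1 a b K n g + g * R1 a b K n f := by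
  simp only [R1, Finset.mul_sum, ← Finset.sum_add_distrib]
  refine Finset.sum_congr rfl fun c _ => ?_
  rw [D_mul]; ring

lemma BB_mul [CharZero k] (a b : k) (K n : ℕ) (f g : SS) :
    BB a b K n (f * g) = f * BB a b K n g + g * BB a b K n f +
    MvPolynomial.C (n : k) * ∑ c ∈ Finset.range K, ∑ d ∈ Finset.range K,
      yv k (n + c + d) * (D c f * D d g) := by
  rw [BB, BB, BB, S2_mul, R1_mul]; ring

lemma VK_D {K : ℕ} {g : SS} (hg : VK K g) (c : ℕ) : VK K (D c g) := by
  intro d hd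
  have := D_comm d c g
  rw [D_def d g, hg d hd, map_zero] at this
  exact this

lemma Ad_Ad {K : ℕ} {g : SS} (hg : VK K g) (j a : ℕ) : Ad k j (Ad k a g) =
    ∑ c ∈ Finset.range K, MvPolynomial.C ((a + c + 1 : ℕ) : k) * (yv k (j + a + c) * D c g) +
      WW K j a g := by
  have h : ∀ c, Ad k j (yv k (a + c) * D c g) =
      MvPolynomial.C ((a + c + 1 : ℕ) : k) * (yv k (j + a + c) * D c g) +
      ∑ d ∈ Finset.range K, yv k (a + c) * yv k (j + d) * D c (D d g) := by
    intro c
    have e : yv k (a + c) * ∑ d ∈ Finset.range K, yv k (j + d) * MvPolynomial.pderiv d (D c g) =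
        ∑ d ∈ Finset.range K, yv k (a + c) * yv k (j + d) * D c (D d g) := by
      rw [Finset.mul_sum]
      refine Finset.sum_congr rfl fun d _ => ?_
      rw [← D_def, D_comm d c, mul_assoc]
    rw [Ad_mul, Ad_yv, Ad_eq_sum (VK_D hg c) j, e, add_assoc j a c]
    ring
  rw [Ad_eq_sum hg a, map_sum, WW_comm, WW, ← Finset.sum_add_distrib]
  exact Finset.sum_congr rfl fun c _ => h c

lemma st2_X [CharZero k] (a b : k) (K j : ℕ) (hj : j < K) (f g : SS) :
    st2 a b K (MvPolynomial.X j * f) g = MvPolynomial.X j * st2 a b K f g + f * BB a b K j g +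
    (∑ l ∈ Finset.range K, D l g * (MvPolynomial.C (l : k) *
      ∑ c ∈ Finset.range K, yv k (l + j + c) * D c f)) +
    ∑ i ∈ Finset.range K, D i f * WW K j i g := by
  have h1 : ∑ i ∈ Finset.range K, D i (MvPolynomial.X j * f) * BB a b K i g =
      MvPolynomial.X j * (∑ i ∈ Finset.range K, D i f * BB a b K i g) + f * BB a b K j g := by
    simp only [D_X_mul, add_mul, ite_mul, zero_mul, Finset.sum_add_distrib, Finset.mul_sum,
      Finset.sum_ite_eq', Finset.mem_range, hj, if_true, mul_assoc]
  have h2 : ∑ i ∈ Finset.range K, D i g * S2 K i (MvPolynomial.X j * f) =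
      MvPolynomial.X j * (∑ i ∈ Finset.range K, D i g * S2 K i f) +
      ∑ l ∈ Finset.range K, D l g * (MvPolynomial.C (l : k) *
      ∑ c ∈ Finset.range K, yv k (l + j + c) * D c f) := by
    rw [Finset.mul_sum, ← Finset.sum_add_distrib]
    refine Finset.sum_congr rfl fun i _ => ?_
    rw [sum_DX _ _ _ hj]; ring
  have h3 : ∑ i ∈ Finset.range K, ∑ i' ∈ Finset.range K,
      D i (D i' (MvPolynomial.X j * f)) * WW K i i' g =
      MvPolynomial.X j * (∑ i ∈ Finset.range K, ∑ i' ∈ Finset.range K, D i (D i' f) * WW K i i' g) +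
      2 * ∑ i ∈ Finset.range K, D i f * WW K j i g := by
    have : ∀ i i' : ℕ, D i (D i' (MvPolynomial.X j * f)) * WW K i i' g =
        MvPolynomial.X j * (D i (D i' f) * WW K i i' g) +
        (if i = j then D i' f * WW K j i' g else 0) +
        (if i' = j then D i f * WW K j i g else 0) := by
      intro c d
      rw [D_X_mul, map_add, D_X_mul]
      by_cases h1 : c = j <;> by_cases h2 : d = j <;> simp [h1, h2] <;>
        first
          | ring1
          | (rw [WW_comm K c j]; ring)
    simp only [this, Finset.sum_add_distrib, two_mul, Finset.mul_sum]
    rw [add_assoc]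
    congr 1
    congr 1
    · rw [Finset.sum_comm]; simp [hj]
    · simp [hj]
  have h4 : (MvPolynomial.C (2⁻¹ : k) : SS) * 2 = 1 := by
    rw [← C_two, ← map_mul, inv_mul_cancel₀ two_ne_zero, map_one]
  rw [st2, st2, h1, h2, h3]
  linear_combination (∑ i ∈ Finset.range K, D i f * WW K j i g) * h4

theorem star_I2 [CharZero k] (a b : k) (K j : ℕ) (hj : j < K) (f g : SS) (hg : VK K g)
    (hf : ∀ m, K ≤ m + j → D m f = 0) :
    st2 a b K (MvPolynomial.X j * f) g = MvPolynomial.X j * st2 a b K f g + Ad k j (st1 K f g) -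
      st1 K (Ad k j f) g + BB a b K j (f * g) - BB a b K j f * g := by
  have h1 : Ad k j (st1 K f g) - st1 K (Ad k j f) g = 
      ∑ m ∈ Finset.range K, D m f * Ad k j (Ad k m g) -
      ∑ m ∈ Finset.range K, MvPolynomial.C ((m + j + 1 : ℕ) : k) * D m f * Ad k (m + j) g := by
    have e : ∑ m ∈ Finset.range K, MvPolynomial.C ((m + j + 1 : ℕ) : k) * D m f * Ad k (m + j) g =
        ∑ m ∈ Finset.range K, (if j ≤ m then MvPolynomial.C ((m + 1 : ℕ) : k) * D (m - j) f
          else 0) * Ad k m g := by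
      have hK : K = (K - j) + j := by omega
      conv_rhs => rw [hK, add_comm (K - j), Finset.sum_range_add]
      rw [Finset.sum_eq_zero (s := Finset.range j), zero_add]
      · conv_lhs => rw [hK, Finset.sum_range_add]
        rw [Finset.sum_eq_zero (s := Finset.range j), add_zero]
        · refine Finset.sum_congr rfl fun m _ => ?_
          rw [if_pos (by omega), show j + m - j = m by omega, add_comm m j]
        · intro m _
          rw [hf _ (by omega)]; simp
      · intro m hm
        simp at hm
        rw [if_neg (by omega), zero_mul]
    rw [e, st1, st1, map_sum, ← Finset.sum_sub_distrib, ← Finset.sum_sub_distrib]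
    refine Finset.sum_congr rfl fun m _ => ?_
    rw [Ad_mul, D_Ad]; ring
  rw [st2_X a b K j hj, BB_mul]
  have h2 : ∑ m ∈ Finset.range K, D m f * Ad k j (Ad k m g) -
      ∑ m ∈ Finset.range K, MvPolynomial.C ((m + j + 1 : ℕ) : k) * D m f * Ad k (m + j) g +
      MvPolynomial.C (j : k) * ∑ c ∈ Finset.range K, ∑ d ∈ Finset.range K,
      yv k (j + c + d) * (D c f * D d g) = (∑ l ∈ Finset.range K, D l g * (MvPolynomial.C (l : k) *
      ∑ c ∈ Finset.range K, yv k (l + j + c) * D c f)) +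
      ∑ i ∈ Finset.range K, D i f * WW K j i g := by
    have e : ∑ l ∈ Finset.range K, D l g * (MvPolynomial.C (l : k) *
        ∑ c ∈ Finset.range K, yv k (l + j + c) * D c f) = ∑ m ∈ Finset.range K,
        ∑ l ∈ Finset.range K, MvPolynomial.C (l : k) * (yv k (j + m + l) * (D m f * D l g)) := by
      rw [Finset.sum_comm]
      refine Finset.sum_congr rfl fun l _ => ?_
      simp only [Finset.mul_sum]
      refine Finset.sum_congr rfl fun m _ => ?_
      rw [show l + j + m = j + m + l by ring]; ring
    rw [e, Finset.mul_sum, ← Finset.sum_add_distrib, ← Finset.sum_sub_distrib,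
      ← Finset.sum_add_distrib]
    refine Finset.sum_congr rfl fun m _ => ?_
    rw [Ad_Ad hg, Ad_eq_sum hg]
    simp only [mul_add, Finset.mul_sum]
    rw [add_sub_right_comm, add_right_comm, ← Finset.sum_sub_distrib, ← Finset.sum_add_distrib]
    congr 1
    refine Finset.sum_congr rfl fun l _ => ?_
    rw [show m + j + l = j + m + l by ring, ← D_def]
    push_cast
    simp only [map_add, map_natCast, map_one]
    ring
  linear_combination (-1 : SS) * h1 - h2

end Stars
end JackAux
end

open scoped Classical
set_option linter.all false
noncomputable section
namespace JackAux

section Claim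
variable {k : Type} [Field k]

local notation "SS" => MvPolynomial ℕ k
local notation "SX" => Polynomial (MvPolynomial ℕ k)

lemma Fil_Ad {d : ℤ} (c : ℕ) {f : SS} (hf : f ∈ Fil k d) : Ad k c f ∈ Fil k (d + c) := by
  rw [Ad_eq_sum (VK_of_Fil hf (Int.self_le_toNat d)) c]
  refine sum_mem fun i _ => Fil_mul' (Fil_yv _) (Fil_pderiv i hf) ?_
  push_cast; linarith

lemma Fil_SG (M : ℕ) (w : ℕ → k) : SG M w ∈ Fil k (M + 1) := by
  refine sum_mem fun r hr => Fil_C_mul _ (Fil_mul' (Fil_yv _) (Fil_yv _) ?_)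
  have : r < M := by simpa using hr
  omega

lemma Fil_RR (a b : k) (n c : ℕ) : RR a b n c ∈ Fil k (n + c) := by
  rcases Nat.eq_zero_or_pos (n + c) with h | h
  · have h1 : n = 0 := by omega
    have h2 : c = 0 := by omega
    subst h1 h2
    simp [RR, SG_zero]
  · refine add_mem (Fil_C_mul _ (Fil_mono ?_ (Fil_yv _))) (Fil_C_mul _ (Fil_mono ?_ (Fil_SG _ _))) <;>
    omega

lemma Fil_S2 {d : ℤ} (K n : ℕ) {g : SS} (hg : g ∈ Fil k d) : S2 K n g ∈ Fil k (d + n - 1) := by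
  refine Fil_C_mul _ (sum_mem fun i _ => sum_mem fun j _ => ?_)
  refine Fil_mul' (Fil_yv _) (D_Fil _ (D_Fil _ hg)) ?_
  push_cast; linarith

lemma Fil_BB {d : ℤ} (a b : k) (K n : ℕ) {g : SS} (hg : g ∈ Fil k d) :
    BB a b K n g ∈ Fil k (d + n - 1) := by
  refine add_mem (sum_mem fun i _ => ?_) (Fil_S2 _ _ hg)
  refine Fil_mul' (Fil_RR _ _ _ _) (D_Fil _ hg) ?_
  linarith

lemma Fil_WW {d : ℤ} (K i j : ℕ) {g : SS} (hg : g ∈ Fil k d) : WW K i j g ∈ Fil k (d + i + j) := by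
  refine sum_mem fun c _ => sum_mem fun c' _ => ?_
  refine Fil_mul' (Fil_mul (Fil_yv _) (Fil_yv _)) (D_Fil _ (D_Fil _ hg)) ?_
  push_cast; linarith

lemma Fil_st1 {d e : ℤ} (K : ℕ) {f g : SS} (hf : f ∈ Fil k d) (hg : g ∈ Fil k e) :
    st1 K f g ∈ Fil k (d + e - 1) := by
  refine sum_mem fun i _ => Fil_mul' (D_Fil _ hf) (Fil_Ad _ hg) ?_
  linarith

lemma Fil_st2 {d e : ℤ} (a b : k) (K : ℕ) {f g : SS} (hf : f ∈ Fil k d) (hg : g ∈ Fil k e) :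
    st2 a b K f g ∈ Fil k (d + e - 2) := by
  refine add_mem (add_mem (sum_mem fun i _ => ?_) (sum_mem fun i _ => ?_)) (Fil_C_mul _
    (sum_mem fun i _ => sum_mem fun j _ => ?_))
  · exact Fil_mul' (D_Fil _ hf) (Fil_BB _ _ _ _ hg) (by linarith)
  · exact Fil_mul' (D_Fil _ hg) (Fil_S2 _ _ hf) (by linarith)
  · exact Fil_mul' (D_Fil _ (D_Fil _ hf)) (Fil_WW _ _ _ hg) (by linarith)

lemma S2_add (K n : ℕ) (f g : SS) : S2 K n (f + g) = S2 K n f + S2 K n g := by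
  simp only [S2, map_add, mul_add, Finset.sum_add_distrib]

lemma BB_add (a b : k) (K n : ℕ) (f g : SS) : BB a b K n (f + g) = BB a b K n f + BB a b K n g := by
  simp only [BB, S2_add, R1, map_add, mul_add, Finset.sum_add_distrib]; ring

lemma st1_add (K : ℕ) (f f' g : SS) : st1 K (f + f') g = st1 K f g + st1 K f' g := by
  simp only [st1, map_add, add_mul, Finset.sum_add_distrib]

lemma st2_add (a b : k) (K : ℕ) (f f' g : SS) :
    st2 a b K (f + f') g = st2 a b K f g + st2 a b K f' g := by
  simp only [st2, S2_add, map_add, add_mul, mul_add, Finset.sum_add_distrib]; ring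

lemma st1_zero (K : ℕ) (g : SS) : st1 K 0 g = 0 := by simp [st1]
lemma st2_zero (a b : k) (K : ℕ) (g : SS) : st2 a b K 0 g = 0 := by
  simp [st2, S2]

lemma st1_C (K : ℕ) (c : k) (g : SS) : st1 K (MvPolynomial.C c) g = 0 := by simp [st1, D_def]
lemma st2_C (a b : k) (K : ℕ) (c : k) (g : SS) : st2 a b K (MvPolynomial.C c) g = 0 := by
  simp [st2, S2, D_def]

lemma st1_comm {K : ℕ} {f g : SS} (hf : VK K f) (hg : VK K g) : st1 K f g = st1 K g f := by
  have : ∀ f g : SS, VK K g → st1 K f g = ∑ i ∈ Finset.range K, ∑ j ∈ Finset.range K,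
      yv k (i + j) * (D i f * D j g) := by
    intro f g hg
    refine Finset.sum_congr rfl fun i _ => ?_
    rw [Ad_eq_sum hg, Finset.mul_sum]
    refine Finset.sum_congr rfl fun j _ => ?_
    rw [← D_def]; ring
  rw [this f g hg, this g f hf, Finset.sum_comm]
  refine Finset.sum_congr rfl fun i _ => Finset.sum_congr rfl fun j _ => ?_
  rw [add_comm j i]; ring

def MM {R : Type} [CommRing R] [Algebra k R] (Φ : MvPolynomial ℕ k →ₗ[k] R) (d : ℤ) :
    Submodule k R := Submodule.map Φ (Fil k d)

variable {R : Type} [CommRing R] [Algebra k R] {Φ : MvPolynomial ℕ k →ₗ[k] R}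

lemma MM_mem {d : ℤ} {f : SS} (hf : f ∈ Fil k d) : Φ f ∈ MM Φ d := Submodule.mem_map_of_mem hf

lemma MM_mono {d e : ℤ} (h : d ≤ e) {x : R} (hx : x ∈ MM Φ d) : x ∈ MM Φ e :=
  Submodule.map_mono (fun _ hf => Fil_mono h hf) hx

variable (Φ) in
def Good (a b : k) (K : ℕ) (u : ℤ) (f g : SS) : Prop :=
  Φ f * Φ g - Φ (f * g + st1 K f g + st2 a b K f g) ∈ MM Φ u

lemma Good_add {a b : k} {K : ℕ} {u : ℤ} {f f' g : SS} (h : Good Φ a b K u f g)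
    (h' : Good Φ a b K u f' g) : Good Φ a b K u (f + f') g := by
  have := add_mem h h'
  unfold Good
  convert this using 1
  rw [st1_add, st2_add, add_mul]
  simp only [map_add]; ring

lemma Good_zero {a b : k} {K : ℕ} {u : ℤ} {g : SS} : Good Φ a b K u 0 g := by
  unfold Good
  simp [st1_zero, st2_zero]

lemma Good_sum {ι : Type} {a b : k} {K : ℕ} {u : ℤ} {g : SS} (s : Finset ι) (f : ι → SS)
    (h : ∀ i ∈ s, Good Φ a b K u (f i) g) : Good Φ a b K u (∑ i ∈ s, f i) g := by
  induction s using Finset.induction_on with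
  | empty => simpa using Good_zero
  | insert i s hi ih =>
    rw [Finset.sum_insert hi]
    exact Good_add (h i (by simp)) (ih fun j hj => h j (by simp [hj]))

variable (Φ) in
/-- the inductive claim -/
def PP (a b : k) (K : ℕ) (n : ℕ) : Prop := ∀ (d e : ℤ) (f g : SS), d ≤ n → 0 ≤ e → e ≤ K →
  d + e ≤ K → f ∈ Fil k d → g ∈ Fil k e → Good Φ a b K (d + e - 3) f g

lemma PP_mono {a b : k} {K m n : ℕ} (h : m ≤ n) (H : PP Φ a b K n) : PP Φ a b K m :=
  fun d e f g hd => H d e f g (hd.trans (by exact_mod_cast h))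

lemma PP_1 {a b : k} {K n : ℕ} (H : PP Φ a b K n) (d e : ℤ) {f g : SS} (hd : d ≤ n) (he : 0 ≤ e)
    (he' : e ≤ K) (hde : d + e ≤ K) (hf : f ∈ Fil k d) (hg : g ∈ Fil k e) :
    Φ f * Φ g - Φ (f * g + st1 K f g) ∈ MM Φ (d + e - 2) := by
  have h1 := MM_mono (by linarith) (H d e f g hd he he' hde hf hg) (e := d + e - 2)
  have h2 := MM_mem (Φ := Φ) (Fil_st2 a b K hf hg)
  convert add_mem h1 h2 using 1
  simp only [map_add]; ring

lemma PP_0 {a b : k} {K n : ℕ} (H : PP Φ a b K n) (d e : ℤ) {f g : SS} (hd : d ≤ n) (he : 0 ≤ e)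
    (he' : e ≤ K) (hde : d + e ≤ K) (hf : f ∈ Fil k d) (hg : g ∈ Fil k e) :
    Φ f * Φ g - Φ (f * g) ∈ MM Φ (d + e - 1) := by
  have h1 := MM_mono (by linarith) (PP_1 H d e hd he he' hde hf hg) (e := d + e - 1)
  have h2 := MM_mem (Φ := Φ) (Fil_st1 K hf hg)
  convert add_mem h1 h2 using 1
  simp only [map_add]; ring

lemma PP_m {a b : k} {K n : ℕ} (H : PP Φ a b K n) (d e : ℤ) {f g : SS} (hd : d ≤ n) (he : 0 ≤ e)
    (he' : e ≤ K) (hde : d + e ≤ K) (hf : f ∈ Fil k d) (hg : g ∈ Fil k e) :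
    Φ f * Φ g ∈ MM Φ (d + e) := by
  have h1 := MM_mono (by linarith) (PP_0 H d e hd he he' hde hf hg) (e := d + e)
  have h2 := MM_mem (Φ := Φ) (Fil_mul hf hg)
  convert add_mem h1 h2 using 1
  ring

lemma Sm_YY {K : ℕ} (a b : k) (n : ℕ) {f : SS} (hf : VK K f) : Sm a (YY a b n f) =
    MvPolynomial.C ((n + 1 : ℕ) : k) * (MvPolynomial.C a * Ad k n f) + f * Sm a (vv a b n) := by
  rw [YY, map_add, Sm_C_mul, mul_assoc, Sm_cc, nab_eq_sum hf, Finset.mul_sum, map_sum,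
    Ad_eq_sum hf, Finset.mul_sum]
  congr 1
  rw [Finset.mul_sum, Finset.mul_sum]
  refine Finset.sum_congr rfl fun i _ => ?_
  rw [mul_left_comm, ← pow_add, Sm_C_mul, Sm_X]; ring

lemma Sm_HH {K : ℕ} (a : k) (n : ℕ) {f : SS} (hf : VK K f) :
    Sm a (Polynomial.X ^ n * HH K f) = MvPolynomial.C a *
      ∑ c ∈ Finset.range K, ∑ d ∈ Finset.range K, yv k (n + c + d) * D c (D d f) := by
  rw [HH, Finset.mul_sum, map_sum, Finset.mul_sum]
  refine Finset.sum_congr rfl fun i _ => ?_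
  rw [← D_def, nab_eq_sum (VK_D hf i), Finset.mul_sum, Finset.mul_sum, map_sum, Finset.mul_sum]
  refine Finset.sum_congr rfl fun j _ => ?_
  have e : ∀ p : SX, Polynomial.X ^ n * (Polynomial.X ^ i * (p * Polynomial.X ^ j)) =
      p * Polynomial.X ^ (n + i + j) := fun p => by ring
  rw [← D_def, e, Sm_C_mul, Sm_X, D_comm j i]
  ring

/-- expansion of the operators `Tt` -/
lemma Tt_expand [CharZero k] {d : ℤ} (a b : k) (K n : ℕ) {f : SS} (hf : f ∈ Fil k d) (h : d ≤ K) :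
    Tt a b n f - (MvPolynomial.C (((n + 1 : ℕ) : k) * a) *
      (MvPolynomial.X n * f + Ad k n f + S2 K n f) + f * Sm a (vv a b n) +
      (∑ c ∈ Finset.range K, D c f * Sm a (ze a b c n)) + f * Sm a (zz a b n)) ∈
      Fil k (n + d - 2) := by
  have hV := VK_of_Fil hf h
  have := OX_Sm a (L1_expand a b K n hf h)
  convert this using 1
  rw [map_sub]
  congr 1
  rw [map_add, map_add, Sm_C_mul, Sm_YY a b n hV, ZZ, map_add, map_add, mul_assoc, Sm_cc, Sm_HH a n hV,
    Sm_X, map_sum, Sm_C_mul, S2, choose_two', yv]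
  simp only [Sm_C_mul, D_def]
  have e : ((n : k) + 1) * n / 2 = ((n + 1 : ℕ) : k) * ((n : k) / 2) := by push_cast; ring
  rw [e]
  simp only [map_mul]
  ring

theorem base_step [CharZero k] {a b : k} (ha : a ≠ 0) (h1 : Φ 1 = 1)
    (hT : ∀ n f, Φ (Tt a b n f) = Φ (Tt a b n 1) * Φ f) {K n : ℕ} (H : PP Φ a b K n) (e : ℤ)
    (he : 0 ≤ e) (hK : n + 1 + e ≤ K) {h : SS} (hh : h ∈ Fil k e) :
    Φ (MvPolynomial.X n) * Φ h - Φ (MvPolynomial.X n * h + Ad k n h + BB a b K n h) ∈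
      MM Φ (n + e - 2) := by
  have hV := VK_of_Fil hh (show e ≤ K by omega)
  set q : k := ((n + 1 : ℕ) : k) * a with hq
  have hq0 : q ≠ 0 := mul_ne_zero (by exact_mod_cast Nat.succ_ne_zero n) ha
  set v := Sm a (vv a b n) with hv
  set z := Sm a (zz a b n) with hz
  have hvF : v ∈ Fil k n := OX_Sm a (OX_vv a b n)
  have hzF : z ∈ Fil k (n - 1) := OX_Sm a (OX_zz a b n)
  have x1 := Tt_expand a b K n hh (by omega)
  have x2 := Tt_expand a b K n (f := 1) (d := 0) (by rw [← MvPolynomial.C_1]; exact Fil_C _) (by omega)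
  rw [← hq, ← hv, ← hz] at x1 x2
  have y2 : Tt a b n 1 - (MvPolynomial.C q * MvPolynomial.X n + v + z) ∈ Fil k (n - 2) := by
    convert x2 using 1
    · ring_nf
    · have z1 : Ad k n (1 : SS) = 0 := (Ad k n).map_one_eq_zero
      have z2 : ∀ c, D c (1 : SS) = 0 := fun c => (MvPolynomial.pderiv c).map_one_eq_zero
      simp [S2, z1, z2]
  set r1 := Tt a b n h - _ with hr1
  set r2 := Tt a b n 1 - _ with hr2
  have m1 := MM_mem (Φ := Φ) x1
  have m2 := PP_m H (n - 2) e (by omega) he (by omega) (by omega) y2 hh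
  have m3 := PP_1 H n e le_rfl he (by omega) (by omega) hvF hh
  have m4 := PP_0 H (n - 1) e (by omega) he (by omega) (by omega) hzF hh
  have e1 : Tt a b n h = r1 + (MvPolynomial.C q *
      (MvPolynomial.X n * h + Ad k n h + S2 K n h) + h * v +
      (∑ c ∈ Finset.range K, D c h * Sm a (ze a b c n)) + h * z) := by rw [hr1]; ring
  have e2 : Tt a b n 1 = r2 + (MvPolynomial.C q * MvPolynomial.X n + v + z) := by rw [hr2]; ring
  have e3 : (∑ c ∈ Finset.range K, D c h * Sm a (ze a b c n)) =
      st1 K v h + MvPolynomial.C q * R1 a b K n h := by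
    rw [st1_comm (VK_of_Fil hvF (by omega)) hV, st1, R1, Finset.mul_sum, ← Finset.sum_add_distrib]
    refine Finset.sum_congr rfl fun c _ => ?_
    have := key_lemma a b n c
    rw [← hq, ← hv] at this
    rw [sub_eq_iff_eq_add.1 this]; ring
  have hTh := hT n h
  rw [e1, e2, e3] at hTh
  have e4 : (MvPolynomial.C q * (MvPolynomial.X n * h + Ad k n h + S2 K n h) + h * v +
      (st1 K v h + MvPolynomial.C q * R1 a b K n h) + h * z) =
      q • (MvPolynomial.X n * h + Ad k n h + BB a b K n h) + (v * h + st1 K v h) + z * h := by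
    rw [BB, MvPolynomial.smul_eq_C_mul]; ring
  rw [e4, ← MvPolynomial.smul_eq_C_mul] at hTh
  simp only [map_add Φ r1, map_add Φ r2, map_add Φ (_ + _) (z * h), map_add Φ (q • _) (v * h + _),
    map_add Φ _ z, map_add Φ _ v, map_smul Φ] at hTh
  have fin : q • (Φ (MvPolynomial.X n) * Φ h -
      Φ (MvPolynomial.X n * h + Ad k n h + BB a b K n h)) ∈ MM Φ (n + e - 2) := by
    have : q • (Φ (MvPolynomial.X n) * Φ h -
      Φ (MvPolynomial.X n * h + Ad k n h + BB a b K n h)) = Φ r1 - Φ r2 * Φ h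
        - (Φ v * Φ h - Φ (v * h + st1 K v h)) - (Φ z * Φ h - Φ (z * h)) := by
      rw [smul_sub, ← smul_mul_assoc]
      linear_combination (-1 : R) * hTh
    rw [this]
    refine sub_mem (sub_mem (sub_mem m1 ?_) ?_) ?_
    · exact MM_mono (by linarith) m2
    · exact MM_mono (by linarith) m3
    · exact MM_mono (by linarith) m4
  exact (Submodule.smul_mem_iff _ hq0).1 fin

theorem main_claim [CharZero k] {a b : k} (ha : a ≠ 0) (h1 : Φ 1 = 1)
    (hT : ∀ n f, Φ (Tt a b n f) = Φ (Tt a b n 1) * Φ f) (K n : ℕ) : PP Φ a b K n := by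
  have hC : ∀ (c : k) (u : ℤ) (g : SS), Good Φ a b K u (MvPolynomial.C c) g := by
    intro c u g
    unfold Good
    rw [st1_C, st2_C, add_zero, add_zero, ← MvPolynomial.smul_eq_C_mul, MvPolynomial.C_eq_smul_one,
      map_smul, map_smul, h1]
    simp
  induction n with
  | zero =>
    intro d e f g hd he heK hde hf hg
    have : f = MvPolynomial.C (MvPolynomial.coeff 0 f) := by
      ext m
      rw [MvPolynomial.coeff_C]
      split_ifs with h
      · rw [h]
      · by_contra h'
        have := hf m h'
        have h0 : wt0 m ≤ 0 := by omega
        apply h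
        ext i
        by_contra hi
        have hle : Finsupp.single i 1 ≤ m := by
          rw [Finsupp.single_le_iff]
          have : m i ≠ 0 := fun h => hi (by simp [h])
          omega
        have hh : wt0 m = wt0 (m - Finsupp.single i 1) + wt0 (Finsupp.single i 1) := by
          rw [← map_add, tsub_add_cancel_of_le hle]
        rw [wt0_single] at hh
        omega
    rw [this]
    exact hC _ _ _
  | succ n ih =>
    intro d e f g hd he heK hde hf hg
    rw [f.as_sum]
    refine Good_sum _ _ fun m hm => ?_
    have hmd := hf m (by simpa using hm)
    set c := MvPolynomial.coeff m f with hc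
    by_cases hmn : wt0 m ≤ n
    · have := ih (wt0 m) e (MvPolynomial.monomial m c) g (by omega) he heK (by omega)
        (Fil_monomial m c) hg
      exact MM_mono (by omega) this
    · have hwn : wt0 m = n + 1 := by omega
      have hd' : d = n + 1 := by omega
      have hm0 : m ≠ 0 := by
        rintro rfl
        simp at hwn
      obtain ⟨j, hj⟩ := Finsupp.ne_iff.1 hm0
      have hle : Finsupp.single j 1 ≤ m := by
        rw [Finsupp.single_le_iff]
        have : m j ≠ 0 := by simpa using hj
        omega
      set m' := m - Finsupp.single j 1 with hm'
      have hmm : m = Finsupp.single j 1 + m' := by rw [hm', add_tsub_cancel_of_le hle]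
      have hwt : (wt0 m : ℤ) = j + 1 + wt0 m' := by
        rw [hmm, map_add, wt0_single]; push_cast; ring
      set F' : SS := MvPolynomial.monomial m' c with hF'
      have hFm : (MvPolynomial.monomial m c : SS) = MvPolynomial.X j * F' := by
        rw [hF', MvPolynomial.X, MvPolynomial.monomial_mul, one_mul, ← hmm]
      have hF : F' ∈ Fil k (n - j) := Fil_mono (by omega) (Fil_monomial m' c)
      rw [hFm, hd']
      have hjn : j ≤ n := by omega
      have hjK : j < K := by omega
      have hVg := VK_of_Fil hg heK
      have Hj := PP_mono hjn ih
      -- three ingredients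
      set h := F' * g + st1 K F' g + st2 a b K F' g with hh
      have hhF : h ∈ Fil k (n - j + e) := by
        refine add_mem (add_mem (Fil_mul hF hg) ?_) ?_
        · exact Fil_mono (by omega) (Fil_st1 K hF hg)
        · exact Fil_mono (by omega) (Fil_st2 a b K hF hg)
      have g2 := ih (n - j) e F' g (by omega) he heK (by omega) hF hg
      obtain ⟨r2, hr2, hr2'⟩ := g2
      have g1 := base_step ha h1 hT Hj (n - j) (by omega) (by omega) hF
      obtain ⟨r1, hr1, hr1'⟩ := g1
      have hr2F : r2 ∈ Fil k (n - j + e - 3) := hr2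
      have hr1F : r1 ∈ Fil k (n - 2) := Fil_mono (by omega) hr1
      have g3 := base_step ha h1 hT Hj (n - j + e) (by omega) (by omega)
        (add_mem hhF (Fil_mono (by omega) hr2F))
      have hAF : Ad k j F' ∈ Fil k n := Fil_mono (by omega) (Fil_Ad j hF)
      have hBF : BB a b K j F' ∈ Fil k (n - 1) := Fil_mono (by omega) (Fil_BB a b K j hF)
      have g4 := PP_1 ih n e le_rfl he heK (by omega) hAF hg
      have g5 := PP_0 ih (n - 1) e (by omega) he heK (by omega) hBF hg
      have g6 := PP_m ih (n - 2) e (by omega) he heK (by omega) hr1F hg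
      have i1 := st1_X K j hjK F' g
      have i2 := star_I2 a b K j hjK F' g hVg (fun m hm => Fil_pderiv_zero m hF (by omega))
      unfold Good
      rw [i1, i2]
      -- error terms
      have t1 : MvPolynomial.X j * r2 ∈ Fil k (n + e - 2) := Fil_mul' (Fil_X j) hr2F (by omega)
      have t2 : Ad k j (st2 a b K F' g) ∈ Fil k (n + e - 2) :=
        Fil_mono (by omega) (Fil_Ad j (Fil_st2 a b K hF hg))
      have t3 : Ad k j r2 ∈ Fil k (n + e - 2) := Fil_mono (by omega) (Fil_Ad j hr2F)
      have t4 : BB a b K j (st1 K F' g) ∈ Fil k (n + e - 2) :=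
        Fil_mono (by omega) (Fil_BB a b K j (Fil_st1 K hF hg))
      have t5 : BB a b K j (st2 a b K F' g) ∈ Fil k (n + e - 2) :=
        Fil_mono (by omega) (Fil_BB a b K j (Fil_st2 a b K hF hg))
      have t6 : BB a b K j r2 ∈ Fil k (n + e - 2) := Fil_mono (by omega) (Fil_BB a b K j hr2F)
      have tt := MM_mem (Φ := Φ) (add_mem (add_mem (add_mem (add_mem (add_mem t1 t2) t3) t4) t5) t6)
      have big := sub_mem (sub_mem (sub_mem (add_mem (MM_mono (by omega) g3 (e := n + e - 2)) tt)
        (MM_mono (by omega) g4 (e := n + e - 2))) (MM_mono (by omega) g5 (e := n + e - 2)))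
        (MM_mono (by omega) g6 (e := n + e - 2))
      rw [show (n : ℤ) + 1 + e - 3 = n + e - 2 by ring]
      convert big using 1
      have a1 : Φ (MvPolynomial.X j * F') = Φ (MvPolynomial.X j) * Φ F' - Φ (Ad k j F') -
          Φ (BB a b K j F') - Φ r1 := by
        rw [hr1', map_add, map_add]; ring
      have a2 : Φ F' * Φ g = Φ (h + r2) := by
        rw [map_add, hr2']; ring
      have a3 : Φ (MvPolynomial.X j * F') * Φ g = Φ (MvPolynomial.X j) * Φ (h + r2) -
          Φ (Ad k j F') * Φ g - Φ (BB a b K j F') * Φ g - Φ r1 * Φ g := by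
        rw [← a2, a1]; ring
      rw [a3, hh]
      simp only [BB_add, mul_add, map_add, map_sub, Ad_mul, mul_assoc]
      rw [mul_comm (Ad k j F') g]
      ring

end Claim
end JackAux
end

open scoped Classical
set_option linter.all false
noncomputable section
namespace JackAux
section Deg
variable {k : Type} [Field k]
local notation "SS" => MvPolynomial ℕ k
local notation "SX" => Polynomial (MvPolynomial ℕ k)

/-- evaluation in `N` variables -/
def ev (k : Type) [Field k] (N : ℕ) : MvPolynomial ℕ k →ₐ[k] MvPolynomial (Fin N) k :=
  MvPolynomial.aeval fun i : ℕ => ∑ j : Fin N, MvPolynomial.X j ^ (i + 1)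

lemma ev_X (N i : ℕ) : ev k N (MvPolynomial.X i) = ∑ j : Fin N, MvPolynomial.X j ^ (i + 1) := by
  simp [ev]

/-- grading by the variables of `A` -/
def psi {N : ℕ} (A : Finset (Fin N)) :
    MvPolynomial (Fin N) k →ₐ[k] Polynomial (MvPolynomial (Fin N) k) :=
  MvPolynomial.aeval fun i => Polynomial.monomial (if i ∈ A then 1 else 0) (MvPolynomial.X i)

lemma psi_X {N : ℕ} (A : Finset (Fin N)) (i : Fin N) : psi (k := k) A (MvPolynomial.X i) =
    Polynomial.monomial (if i ∈ A then 1 else 0) (MvPolynomial.X i) := by simp [psi]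

lemma psi_monomial {N : ℕ} (A : Finset (Fin N)) (e : Fin N →₀ ℕ) (c : k) :
    psi A (MvPolynomial.monomial e c) =
      Polynomial.monomial (∑ i ∈ A, e i) (MvPolynomial.monomial e c) := by
  induction e using Finsupp.induction_linear generalizing c with
  | zero =>
    simp only [Finsupp.coe_zero, Pi.zero_apply, Finset.sum_const_zero]
    change psi A (MvPolynomial.C c) = Polynomial.C (MvPolynomial.C c)
    rw [← MvPolynomial.algebraMap_eq, AlgHom.commutes]
    rfl
  | add f g hf hg =>
    rw [← mul_one c, ← MvPolynomial.monomial_mul, map_mul, hf, hg, Polynomial.monomial_mul_monomial]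
    simp [Finset.sum_add_distrib]
  | single i n =>
    rw [MvPolynomial.monomial_eq]
    have h1 : psi A (MvPolynomial.C c) = Polynomial.monomial 0 (MvPolynomial.C c) := by
      rw [← MvPolynomial.algebraMap_eq, AlgHom.commutes]; rfl
    rw [map_mul, h1]
    simp only [pow_zero, Finsupp.prod_single_index, map_pow, psi_X, Polynomial.monomial_pow,
      Polynomial.monomial_mul_monomial]
    congr 1
    simp only [Finsupp.single_apply, Finset.sum_ite_eq]
    split_ifs <;> simp

lemma coeff_psi {N : ℕ} (A : Finset (Fin N)) (p : MvPolynomial (Fin N) k) (n : ℕ)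
    (e : Fin N →₀ ℕ) : MvPolynomial.coeff e ((psi A p).coeff n) =
      if ∑ i ∈ A, e i = n then MvPolynomial.coeff e p else 0 := by
  induction p using MvPolynomial.induction_on' with
  | monomial u a =>
    rw [psi_monomial, Polynomial.coeff_monomial]
    by_cases h : u = e
    · subst h; split_ifs <;> simp
    · split_ifs <;> simp [h]
  | add p q hp hq =>
    rw [map_add, Polynomial.coeff_add, MvPolynomial.coeff_add, hp, hq, MvPolynomial.coeff_add]
    split_ifs <;> simp

/-- `A`-degree -/
def dg {N : ℕ} (A : Finset (Fin N)) (p : MvPolynomial (Fin N) k) : ℕ := (psi A p).natDegree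

lemma dg_le_iff {N : ℕ} (A : Finset (Fin N)) (p : MvPolynomial (Fin N) k) (t : ℕ) :
    dg A p ≤ t ↔ ∀ e, MvPolynomial.coeff e p ≠ 0 → ∑ i ∈ A, e i ≤ t := by
  rw [dg, Polynomial.natDegree_le_iff_coeff_eq_zero]
  constructor
  · intro h e he
    by_contra hlt
    have := coeff_psi A p (∑ i ∈ A, e i) e
    rw [h _ (by omega)] at this
    simp at this
    exact he this.symm
  · intro h n hn
    ext e
    rw [coeff_psi]
    split_ifs with h1
    · by_contra h2
      have := h e (by simpa using h2)
      omega
    · simp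

lemma psi_inj {N : ℕ} (A : Finset (Fin N)) {p : MvPolynomial (Fin N) k} (h : psi A p = 0) :
    p = 0 := by
  ext e
  have := coeff_psi A p (∑ i ∈ A, e i) e
  rw [h] at this
  simpa using this.symm

lemma dg_mul {N : ℕ} (A : Finset (Fin N)) {p q : MvPolynomial (Fin N) k} (hp : p ≠ 0)
    (hq : q ≠ 0) : dg A (p * q) = dg A p + dg A q := by
  rw [dg, map_mul, Polynomial.natDegree_mul]
  · rfl
  · exact fun h => hp (psi_inj A h)
  · exact fun h => hq (psi_inj A h)

lemma dg_mul_le {N : ℕ} (A : Finset (Fin N)) (p q : MvPolynomial (Fin N) k) :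
    dg A (p * q) ≤ dg A p + dg A q := by
  rw [dg, map_mul]; exact Polynomial.natDegree_mul_le

lemma dg_add_le {N : ℕ} (A : Finset (Fin N)) {p q : MvPolynomial (Fin N) k} {t : ℕ}
    (hp : dg A p ≤ t) (hq : dg A q ≤ t) : dg A (p + q) ≤ t := by
  rw [dg, map_add]; exact Polynomial.natDegree_add_le_of_degree_le hp hq

lemma dg_sub_le {N : ℕ} (A : Finset (Fin N)) {p q : MvPolynomial (Fin N) k} {t : ℕ}
    (hp : dg A p ≤ t) (hq : dg A q ≤ t) : dg A (p - q) ≤ t := by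
  rw [dg, map_sub]; exact Polynomial.natDegree_sub_le_of_le hp hq |>.trans (by simp)

lemma dg_zero {N : ℕ} (A : Finset (Fin N)) : dg A (0 : MvPolynomial (Fin N) k) = 0 := by
  simp [dg]

lemma dg_sum_le {N : ℕ} (A : Finset (Fin N)) {ι : Type} (s : Finset ι)
    (p : ι → MvPolynomial (Fin N) k) {t : ℕ}
    (hp : ∀ i ∈ s, dg A (p i) ≤ t) : dg A (∑ i ∈ s, p i) ≤ t := by
  induction s using Finset.induction_on with
  | empty => simp [dg_zero]
  | insert i s hi ih =>
    rw [Finset.sum_insert hi]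
    exact dg_add_le A (hp i (by simp)) (ih fun j hj => hp j (by simp [hj]))

lemma coeff_Xpderiv {N : ℕ} (i : Fin N) (p : MvPolynomial (Fin N) k) (e : Fin N →₀ ℕ) :
    MvPolynomial.coeff e (MvPolynomial.X i * MvPolynomial.pderiv i p) =
      e i * MvPolynomial.coeff e p := by
  rw [MvPolynomial.coeff_X_mul']
  by_cases h : i ∈ e.support
  · rw [if_pos h, MvPolynomial.coeff_pderiv]
    have hle : Finsupp.single i 1 ≤ e := by
      rw [Finsupp.single_le_iff]; simp at h; omega
    rw [tsub_add_cancel_of_le hle]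
    simp at h
    have : ((e i - 1 : ℕ) : k) + 1 = e i := by
      rw [← Nat.cast_succ, Nat.succ_eq_add_one, Nat.sub_add_cancel (by omega)]
    simp [this, mul_comm]
  · rw [if_neg h]; simp at h; simp [h]

lemma dg_Xpderiv {N : ℕ} (A : Finset (Fin N)) (i : Fin N) {p : MvPolynomial (Fin N) k} {t : ℕ}
    (h : dg A p ≤ t) : dg A (MvPolynomial.X i * MvPolynomial.pderiv i p) ≤ t := by
  rw [dg_le_iff] at *
  intro e he
  rw [coeff_Xpderiv] at he
  exact h e (right_ne_zero_of_mul he)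

lemma dg_C {N : ℕ} (A : Finset (Fin N)) (c : k) : dg A (MvPolynomial.C c) = 0 := by
  rw [← Nat.le_zero, dg_le_iff]
  intro e he
  rw [MvPolynomial.coeff_C] at he
  have : 0 = e := by by_contra h; simp [h] at he
  simp [← this]

lemma dg_C_mul {N : ℕ} (A : Finset (Fin N)) (c : k) {p : MvPolynomial (Fin N) k} {t : ℕ}
    (h : dg A p ≤ t) : dg A (MvPolynomial.C c * p) ≤ t := by
  refine (dg_mul_le A _ _).trans ?_
  rw [dg_C]; omega

lemma dg_X {N : ℕ} (A : Finset (Fin N)) (i : Fin N) :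
    dg A (MvPolynomial.X i : MvPolynomial (Fin N) k) = if i ∈ A then 1 else 0 := by
  rw [dg, psi_X, Polynomial.natDegree_monomial_eq]
  exact MvPolynomial.X_ne_zero i

lemma XX_ne {N : ℕ} {i j : Fin N} (h : i ≠ j) :
    (MvPolynomial.X i - MvPolynomial.X j : MvPolynomial (Fin N) k) ≠ 0 := by
  intro h'
  exact h (MvPolynomial.X_injective (sub_eq_zero.1 h'))

lemma dg_XX {N : ℕ} (A : Finset (Fin N)) {i j : Fin N} (h : i ≠ j) (h2 : i ∈ A ∨ j ∈ A) :
    1 ≤ dg A (MvPolynomial.X i - MvPolynomial.X j : MvPolynomial (Fin N) k) := by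
  by_contra hlt
  have h0 : dg A (MvPolynomial.X i - MvPolynomial.X j : MvPolynomial (Fin N) k) ≤ 0 := by omega
  rw [dg_le_iff] at h0
  rcases h2 with h2 | h2
  · have := h0 (Finsupp.single i 1) (by
      rw [MvPolynomial.coeff_sub, MvPolynomial.coeff_X', MvPolynomial.coeff_X', if_pos rfl]
      rw [if_neg (by rw [Finsupp.single_left_inj one_ne_zero]; exact h.symm)]; simp)
    simp [Finsupp.single_apply, h2] at this
  · have := h0 (Finsupp.single j 1) (by
      rw [MvPolynomial.coeff_sub, MvPolynomial.coeff_X', MvPolynomial.coeff_X', if_pos rfl]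
      rw [if_neg (by rw [Finsupp.single_left_inj one_ne_zero]; exact h)]; simp)
    simp [Finsupp.single_apply, h2] at this

/-- divided differences do not increase the degree -/
lemma dg_divdiff {N : ℕ} (A : Finset (Fin N)) {i j : Fin N} (h : i ≠ j)
    {w u v : MvPolynomial (Fin N) k} {t : ℕ} (hu : dg A u ≤ t) (hv : dg A v ≤ t)
    (hw : (MvPolynomial.X i - MvPolynomial.X j) * w =
      MvPolynomial.X j * u - MvPolynomial.X i * v) : dg A w ≤ t := by
  by_cases hw0 : w = 0
  · rw [hw0, dg_zero]; omega
  have h1 := dg_mul A (XX_ne (k := k) h) hw0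
  rw [hw] at h1
  by_cases h2 : i ∈ A ∨ j ∈ A
  · have h3 := dg_XX (k := k) A h h2
    have h4 : dg A (MvPolynomial.X j * u - MvPolynomial.X i * v) ≤ t + 1 := by
      apply dg_sub_le
      · refine (dg_mul_le A _ _).trans ?_
        rw [dg_X]; split_ifs <;> omega
      · refine (dg_mul_le A _ _).trans ?_
        rw [dg_X]; split_ifs <;> omega
    omega
  · push Not at h2
    have h4 : dg A (MvPolynomial.X j * u - MvPolynomial.X i * v) ≤ t := by
      apply dg_sub_le
      · refine (dg_mul_le A _ _).trans ?_
        rw [dg_X, if_neg h2.2]; omega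
      · refine (dg_mul_le A _ _).trans ?_
        rw [dg_X, if_neg h2.1]; omega
    omega

/-- `E_i h = ∑ ev(h_m) x_i^{m+1}` -/
def EE {N : ℕ} (i : Fin N) : SX →ₗ[k] MvPolynomial (Fin N) k :=
  Polynomial.lsum fun m =>
    (LinearMap.mulRight k (MvPolynomial.X i ^ (m + 1))) ∘ₗ (ev k N).toLinearMap

lemma EE_mon {N : ℕ} (i : Fin N) (m : ℕ) (f : SS) : EE i (Polynomial.monomial m f) =
    ev k N f * MvPolynomial.X i ^ (m + 1) := by
  simp [EE, Polynomial.lsum_apply, Polynomial.sum_monomial_index]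

lemma EE_mul_X {N : ℕ} (i : Fin N) (m : ℕ) (h : SX) : EE i (h * Polynomial.X ^ m) =
    EE i h * MvPolynomial.X i ^ m := by
  induction h using Polynomial.induction_on' with
  | add p q hp hq => rw [add_mul, map_add, hp, hq, map_add, add_mul]
  | monomial n a =>
    rw [Polynomial.monomial_mul_X_pow, EE_mon, EE_mon]; ring

lemma EE_C_mul {N : ℕ} (i : Fin N) (f : SS) (h : SX) : EE i (Polynomial.C f * h) =
    ev k N f * EE i h := by
  induction h using Polynomial.induction_on' with
  | add p q hp hq => rw [mul_add, map_add, hp, hq, map_add, mul_add]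
  | monomial n a =>
    rw [Polynomial.C_mul_monomial, EE_mon, EE_mon, map_mul]; ring

lemma EE_nabla {N : ℕ} (i : Fin N) (al : k) (f : SS) :
    EE i (nabla (fun m => al * (m + 1 : ℕ)) f) =
      MvPolynomial.C al * (MvPolynomial.X i * MvPolynomial.pderiv i (ev k N f)) := by
  induction f using MvPolynomial.induction_on with
  | C a => simp [nabla_C]
  | add p q hp hq => simp only [map_add, hp, hq]; ring
  | mul_X p j hp =>
    rw [nabla_mul, nabla_X, map_add, EE_C_mul, EE_C_mul, hp, EE_mon, map_mul (ev k N) p,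
      Derivation.leibniz, ev_X, map_sum]
    have : ∀ x : Fin N, MvPolynomial.pderiv i (MvPolynomial.X x ^ (j + 1) : MvPolynomial (Fin N) k) =
        if x = i then MvPolynomial.C ((j + 1 : ℕ) : k) * MvPolynomial.X i ^ j else 0 := by
      intro x
      rw [MvPolynomial.pderiv_pow, MvPolynomial.pderiv_X]
      by_cases h : x = i
      · subst h; simp
      · simp [h]
    rw [Finset.sum_congr rfl fun x _ => this x, Finset.sum_ite_eq' , if_pos (Finset.mem_univ _)]
    have hc : ev k N (MvPolynomial.C (al * ((j + 1 : ℕ) : k))) =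
        MvPolynomial.C al * MvPolynomial.C ((j + 1 : ℕ) : k) := by
      rw [← MvPolynomial.C_mul]; exact (ev k N).commutes _
    rw [hc]
    simp only [smul_eq_mul]
    ring

lemma EE_Sym {N : ℕ} (h : SX) : ev k N (Sym (fun m => MvPolynomial.X m) h) = ∑ i, EE i h := by
  induction h using Polynomial.induction_on' with
  | add p q hp hq => simp only [map_add, hp, hq, Finset.sum_add_distrib]
  | monomial n a =>
    rw [Sym_mon, map_mul, ev_X, Finset.sum_mul]
    refine Finset.sum_congr rfl fun i _ => ?_
    rw [EE_mon]; ring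

/-- divided difference part -/
def ww {N : ℕ} (i j : Fin N) : SX →ₗ[k] MvPolynomial (Fin N) k :=
  Polynomial.lsum fun m => ∑ r ∈ Finset.range m,
    (LinearMap.mulRight k (MvPolynomial.X j ^ (r + 1) * MvPolynomial.X i ^ (m - r))) ∘ₗ
      (ev k N).toLinearMap

lemma ww_mon {N : ℕ} (i j : Fin N) (m : ℕ) (f : SS) : ww i j (Polynomial.monomial m f) =
    ∑ r ∈ Finset.range m, ev k N f * (MvPolynomial.X j ^ (r + 1) * MvPolynomial.X i ^ (m - r)) := by
  simp [ww, Polynomial.lsum_apply, Polynomial.sum_monomial_index, mul_assoc]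

lemma ww_eq {N : ℕ} (i j : Fin N) (h : SX) : (MvPolynomial.X i - MvPolynomial.X j) * ww i j h =
    MvPolynomial.X j * EE i h - MvPolynomial.X i * EE j h := by
  induction h using Polynomial.induction_on' with
  | add p q hp hq => rw [map_add, mul_add, hp, hq, map_add, map_add]; ring
  | monomial m a =>
    rw [ww_mon, EE_mon, EE_mon]
    have key := Commute.geom_sum₂_mul (Commute.all (MvPolynomial.X i : MvPolynomial (Fin N) k)
      (MvPolynomial.X j)) m
    have : ∑ r ∈ Finset.range m, ev k N a * (MvPolynomial.X j ^ (r + 1) * MvPolynomial.X i ^ (m - r)) =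
        ev k N a * MvPolynomial.X i * MvPolynomial.X j *
        ∑ r ∈ Finset.range m, MvPolynomial.X i ^ r * MvPolynomial.X j ^ (m - 1 - r) := by
      rw [← Finset.sum_range_reflect, Finset.mul_sum]
      refine Finset.sum_congr rfl fun r hr => ?_
      rw [Finset.mem_range] at hr
      rw [show m - (m - 1 - r) = r + 1 by omega]
      ring
    rw [this]
    linear_combination (ev k N a * MvPolynomial.X i * MvPolynomial.X j) * key

lemma EE_Lop {N : ℕ} (i : Fin N) (al : k) (h : SX) :
    EE i (Lop (fun m => al * (m + 1 : ℕ)) 0 (al - 1) (fun m => MvPolynomial.X m) h) =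
      MvPolynomial.C al * (MvPolynomial.X i * MvPolynomial.pderiv i (EE i h)) - EE i h +
        ∑ j ∈ Finset.univ.erase i, ww i j h := by
  induction h using Polynomial.induction_on' with
  | add p q hp hq =>
    simp only [map_add, hp, hq, Finset.sum_add_distrib]; ring
  | monomial m f =>
    have hV : Vop (fun m => al * (m + 1 : ℕ)) 0 f = nabla (fun m => al * (m + 1 : ℕ)) f := by
      simp [Vop]
    simp only [Lop, LinearMap.add_apply, map_add, Nab_mon, eop_mon, Qop_mon, hV, EE_mul_X,
      EE_nabla, map_smul, EE_mon, map_sum, ww_mon]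
    have e1 : ∑ r ∈ Finset.range m, ev k N (MvPolynomial.X r * f) *
        MvPolynomial.X i ^ (m - 1 - r + 1) = MvPolynomial.C (m : k) *
          (ev k N f * MvPolynomial.X i ^ (m + 1)) + ∑ j ∈ Finset.univ.erase i,
          ∑ r ∈ Finset.range m, ev k N f * (MvPolynomial.X j ^ (r + 1) * MvPolynomial.X i ^ (m - r)) := by
      have : MvPolynomial.C (m : k) * (ev k N f * MvPolynomial.X i ^ (m + 1)) =
          ∑ r ∈ Finset.range m, ev k N f * (MvPolynomial.X i ^ (r + 1) * MvPolynomial.X i ^ (m - r)) := by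
        rw [Finset.sum_congr rfl (g := fun _ => ev k N f * MvPolynomial.X i ^ (m + 1))]
        · simp
        · intro r hr
          rw [Finset.mem_range] at hr
          rw [← pow_add, show r + 1 + (m - r) = m + 1 by omega]
      rw [this, Finset.add_sum_erase Finset.univ (fun j => ∑ r ∈ Finset.range m,
        ev k N f * (MvPolynomial.X j ^ (r + 1) * MvPolynomial.X i ^ (m - r))) (Finset.mem_univ i),
        Finset.sum_comm]
      refine Finset.sum_congr rfl fun r hr => ?_
      rw [Finset.mem_range] at hr
      rw [map_mul, ev_X, Finset.sum_mul, Finset.sum_mul, show m - 1 - r + 1 = m - r by omega]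
      refine Finset.sum_congr rfl fun j _ => ?_
      ring
    rw [e1, Derivation.leibniz, MvPolynomial.pderiv_pow, MvPolynomial.pderiv_X_self,
      MvPolynomial.smul_eq_C_mul]
    simp only [smul_eq_mul, map_mul, map_sub, map_natCast, Nat.cast_add, Nat.cast_one, map_one,
      Nat.add_sub_cancel, map_add]
    ring

lemma dg_Top {N : ℕ} (A : Finset (Fin N)) (al : k) (n : ℕ) (f : SS) {t : ℕ}
    (h : dg A (ev k N f) ≤ t) :
    dg A (ev k N (Top (fun m => al * (m + 1 : ℕ)) 0 (al - 1) (fun m => MvPolynomial.X m) n f)) ≤ t := by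
  have hV : Vop (fun m => al * (m + 1 : ℕ)) 0 f = nabla (fun m => al * (m + 1 : ℕ)) f := by
    simp [Vop]
  simp only [Top, LinearMap.comp_apply, EE_Sym]
  refine dg_sum_le A _ _ fun i _ => ?_
  induction n generalizing i with
  | zero =>
    simp only [pow_zero, Module.End.one_apply, hV, EE_nabla]
    exact dg_C_mul A _ (dg_Xpderiv A _ h)
  | succ n ih =>
    rw [pow_succ', Module.End.mul_apply, EE_Lop]
    refine dg_add_le A (dg_sub_le A (dg_C_mul A _ (dg_Xpderiv A _ (ih i (by simp)))) (ih i (by simp)))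
      (dg_sum_le A _ _ fun j hj => ?_)
    rw [Finset.mem_erase] at hj
    exact dg_divdiff A hj.1.symm (ih i (by simp)) (ih j (by simp)) (ww_eq i j _)

end Deg
end JackAux
end

open scoped Classical
set_option linter.all false
noncomputable section
namespace JackAux
section Part
variable {k : Type} [Field k]
local notation "SS" => MvPolynomial ℕ k
local notation "SX" => Polynomial (MvPolynomial ℕ k)

lemma eval_map_nabla {N : ℕ} (i : Fin N) (h : SX) :
    EE i h = MvPolynomial.X i * (h.map (ev k N).toRingHom).eval (MvPolynomial.X i) := by
  induction h using Polynomial.induction_on' with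
  | add p q hp hq => rw [map_add, hp, hq, Polynomial.map_add, Polynomial.eval_add]; ring
  | monomial m f =>
    rw [EE_mon, Polynomial.map_monomial, Polynomial.eval_monomial]
    simp only [AlgHom.toRingHom_eq_coe, RingHom.coe_coe]
    ring

/-- power sums are algebraically independent -/
lemma ev_inj [CharZero k] (n : ℕ) : ∀ f : SS, f ∈ Fil k n → (∃ N0, ∀ N ≥ N0, ev k N f = 0) →
    f = 0 := by
  induction n with
  | zero =>
    rintro f hf ⟨N0, h⟩
    have : f = MvPolynomial.C (MvPolynomial.coeff 0 f) := by
      ext m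
      by_cases h0 : m = 0
      · subst h0; simp
      · rw [MvPolynomial.coeff_C, if_neg (Ne.symm h0)]
        by_contra hne
        have h1 := hf m hne
        obtain ⟨i, hi⟩ := Finsupp.ne_iff.1 h0
        have hle : Finsupp.single i 1 ≤ m := by
          rw [Finsupp.single_le_iff]
          have : m i ≠ 0 := by simpa using hi
          omega
        have hh : wt0 m = wt0 (m - Finsupp.single i 1) + wt0 (Finsupp.single i 1) := by
          rw [← map_add, tsub_add_cancel_of_le hle]
        rw [wt0_single] at hh
        push_cast at h1
        omega
    have h2 := h N0 le_rfl
    rw [this] at h2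
    have h3 : ev k N0 (MvPolynomial.C (MvPolynomial.coeff 0 f)) =
      MvPolynomial.C (MvPolynomial.coeff 0 f) := (ev k N0).commutes _
    rw [h3, ← MvPolynomial.C_0] at h2
    rw [this, MvPolynomial.C_injective _ _ h2, MvPolynomial.C_0]
  | succ n ih =>
    rintro f hf ⟨N0, h⟩
    have hd : ∀ j, MvPolynomial.pderiv j f = 0 := by
      intro j
      apply ih
      · exact Fil_mono (by push_cast; omega) (Fil_pderiv j hf)
      refine ⟨max N0 (n + 2), fun N hN => ?_⟩
      have hN1 : N0 ≤ N := le_trans (le_max_left _ _) hN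
      have hN2 : n + 2 ≤ N := le_trans (le_max_right _ _) hN
      set q := nabla (fun m => (1 : k) * (m + 1 : ℕ)) f with hq
      have hq0 : q.map (ev k N).toRingHom = 0 := by
        apply Polynomial.eq_zero_of_natDegree_lt_card_of_eval_eq_zero
          (ι := Fin N) _ (MvPolynomial.X_injective (R := k) (σ := Fin N))
        · intro i
          have h1 := EE_nabla i (1 : k) f
          rw [← hq, eval_map_nabla, h N hN1, map_zero, mul_zero, mul_zero] at h1
          exact (mul_eq_zero.1 h1).resolve_left (MvPolynomial.X_ne_zero i)
        · rw [Fintype.card_fin]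
          refine lt_of_le_of_lt Polynomial.natDegree_map_le ?_
          refine lt_of_le_of_lt (b := n + 1) ?_ (by omega)
          rw [Polynomial.natDegree_le_iff_coeff_eq_zero]
          intro c hc
          rw [hq, coeff_nabla, Fil_pderiv_zero c hf (by omega), mul_zero]
      have h2 := congrArg (fun p => Polynomial.coeff p j) hq0
      simp only [Polynomial.coeff_map, hq, coeff_nabla, Polynomial.coeff_zero] at h2
      rw [map_mul] at h2
      refine (mul_eq_zero.1 h2).resolve_left ?_
      have h3 : (ev k N).toRingHom (MvPolynomial.C ((1 : k) * (j + 1 : ℕ))) =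
        MvPolynomial.C ((1 : k) * (j + 1 : ℕ)) := (ev k N).commutes _
      rw [h3, one_mul]
      intro h4
      rw [← MvPolynomial.C_0] at h4
      have := MvPolynomial.C_injective _ _ h4
      exact absurd this (by exact_mod_cast Nat.succ_ne_zero j)
    refine ih f ?_ ⟨N0, h⟩
    intro m hm
    have hm0 : m = 0 := by
      ext i
      by_contra hi
      have hle : Finsupp.single i 1 ≤ m := by
        rw [Finsupp.single_le_iff]
        have : m i ≠ 0 := by simpa using hi
        omega
      have := congrArg (MvPolynomial.coeff (m - Finsupp.single i 1)) (hd i)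
      rw [MvPolynomial.coeff_pderiv, tsub_add_cancel_of_le hle, MvPolynomial.coeff_zero] at this
      refine hm ((mul_eq_zero.1 this).resolve_right ?_)
      exact Nat.cast_add_one_ne_zero _
    subst hm0; simp

lemma Fil_exists (f : SS) : ∃ n : ℕ, f ∈ Fil k n := by
  refine ⟨f.support.sup wt0, fun m hm => ?_⟩
  exact_mod_cast Finset.le_sup (f := wt0) (MvPolynomial.mem_support_iff.2 hm)

lemma ev_inj' [CharZero k] {f : SS} (h : ∀ N, ev k N f = 0) : f = 0 := by
  obtain ⟨n, hn⟩ := Fil_exists f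
  exact ev_inj n f hn ⟨0, fun N _ => h N⟩

lemma dg_ev_bounded (f : SS) : ∃ n : ℕ, ∀ N (A : Finset (Fin N)), dg A (ev k N f) ≤ n := by
  induction f using MvPolynomial.induction_on with
  | C a =>
    refine ⟨0, fun N A => ?_⟩
    have h3 : ev k N (MvPolynomial.C a) = MvPolynomial.C a := (ev k N).commutes _
    rw [h3, dg_C]
  | add p q hp hq =>
    obtain ⟨n, hn⟩ := hp
    obtain ⟨m, hm⟩ := hq
    refine ⟨max n m, fun N A => ?_⟩
    rw [map_add]
    exact dg_add_le A ((hn N A).trans (le_max_left _ _)) ((hm N A).trans (le_max_right _ _))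
  | mul_X p i hp =>
    obtain ⟨n, hn⟩ := hp
    refine ⟨n + (i + 1), fun N A => ?_⟩
    rw [map_mul]
    refine (dg_mul_le A _ _).trans (add_le_add (hn N A) ?_)
    rw [ev_X]
    refine dg_sum_le A _ _ fun j _ => ?_
    have : ∀ r, dg A (MvPolynomial.X j ^ r : MvPolynomial (Fin N) k) ≤ r := by
      intro r
      induction r with
      | zero => rw [pow_zero, ← MvPolynomial.C_1, dg_C]
      | succ r ih =>
        rw [pow_succ]
        refine (dg_mul_le A _ _).trans (add_le_add ih ?_)
        rw [dg_X]; split_ifs <;> simp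
    exact this _

lemma ev_kill {M N : ℕ} {ι : Fin M → Fin N} (hι : Function.Injective ι) (f : SS) :
    MvPolynomial.killCompl hι (ev k N f) = ev k M f := by
  have : (MvPolynomial.killCompl hι).comp (ev k N) = ev k M := by
    apply MvPolynomial.algHom_ext
    intro i
    rw [AlgHom.comp_apply, ev_X, ev_X, map_sum]
    symm
    have hs : ∑ j : Fin N, MvPolynomial.killCompl hι (MvPolynomial.X j ^ (i + 1) : MvPolynomial (Fin N) k)
      = ∑ j ∈ Finset.univ.image ι, MvPolynomial.killCompl hι (MvPolynomial.X j ^ (i + 1)) := by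
      symm
      apply Finset.sum_subset (Finset.subset_univ _)
      intro j _ hj
      have : j ∉ Set.range ι := by simpa using hj
      rw [map_pow, MvPolynomial.killCompl, MvPolynomial.aeval_X, dif_neg this]
      simp
    rw [hs, Finset.sum_image (fun a _ b _ h => hι h)]
    refine Finset.sum_congr rfl fun j _ => ?_
    rw [map_pow]
    congr 1
    rw [← MvPolynomial.rename_X (R := k) ι j, MvPolynomial.killCompl_rename_app]
  rw [← this]; rfl

lemma coeff_ev {M N : ℕ} {ι : Fin M → Fin N} (hι : Function.Injective ι) (f : SS)
    (e : Fin M →₀ ℕ) : MvPolynomial.coeff (e.mapDomain ι) (ev k N f) =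
      MvPolynomial.coeff e (ev k M f) := by
  rw [← ev_kill hι, MvPolynomial.coeff_killCompl]

/-! combinatorics of partitions -/

lemma do_eq (m : JPartition) : (Multiset.map (fun i : ℕ => i) (do
    let a ← m
    pure (a : ℕ))) = Multiset.map (fun i : ℕ+ => (i : ℕ)) m := by
  rw [Multiset.map_id']
  simp only [Multiset.bind_def, Multiset.pure_def, Multiset.bind_singleton]

lemma sortedParts_coe (m : JPartition) : (sortedParts m : Multiset ℕ) = m.map (fun i : ℕ+ => (i : ℕ)) := by
  rw [sortedParts, Multiset.coe_reverse, Multiset.sort_eq, do_eq]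

lemma sortedParts_length (m : JPartition) : (sortedParts m).length = plen m := by
  rw [← Multiset.coe_card, sortedParts_coe, Multiset.card_map, plen]

lemma sortedParts_pairwise (m : JPartition) : (sortedParts m).Pairwise (fun a b => b ≤ a) := by
  rw [sortedParts, List.pairwise_reverse]
  exact Multiset.pairwise_sort _ _

lemma sortedParts_pos (m : JPartition) : ∀ a ∈ sortedParts m, 0 < a := by
  intro a ha
  rw [← Multiset.mem_coe, sortedParts_coe, Multiset.mem_map] at ha
  obtain ⟨i, _, rfl⟩ := ha
  exact i.pos

lemma sortedParts_inj {m l : JPartition} (h : sortedParts m = sortedParts l) : m = l := by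
  have := congrArg (fun L : List ℕ => (L : Multiset ℕ)) h
  simp only [sortedParts_coe] at this
  exact Multiset.map_injective PNat.coe_injective this

lemma take_sum_inj : ∀ L L' : List ℕ, (∀ a ∈ L, 0 < a) → (∀ a ∈ L', 0 < a) →
    (∀ n, (L.take n).sum = (L'.take n).sum) → L = L'
  | [], [], _, _, _ => rfl
  | [], a :: L', _, h2, h => by
    have := h 1
    have h3 := h2 a (by simp)
    simp at this
    omega
  | a :: L, [], h1, _, h => by
    have := h 1
    have h3 := h1 a (by simp)
    simp at this
    omega
  | a :: L, b :: L', h1, h2, h => by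
    have e : a = b := by simpa using h 1
    subst e
    rw [take_sum_inj L L' (fun x hx => h1 x (by simp [hx])) (fun x hx => h2 x (by simp [hx]))
      (fun n => by simpa using h (n + 1))]

lemma topSum_inj {m l : JPartition} (h : ∀ n, topSum m n = topSum l n) : m = l :=
  sortedParts_inj (take_sum_inj _ _ (sortedParts_pos m) (sortedParts_pos l) h)

lemma topSum_mono (m : JPartition) {a b : ℕ} (h : a ≤ b) : topSum m a ≤ topSum m b :=
  (List.take_sublist_take_left h).sum_le_sum (fun _ _ => Nat.zero_le _)

lemma psize_def (m : JPartition) : psize m = (m.map (fun i : ℕ+ => (i : ℕ))).sum := by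
  rw [psize, do_eq]

lemma psize_eq (m : JPartition) : psize m = (sortedParts m).sum := by
  rw [psize_def, ← sortedParts_coe, Multiset.sum_coe]

lemma topSum_le_psize (m : JPartition) (n : ℕ) : topSum m n ≤ psize m := by
  rw [psize_eq]
  exact (List.take_sublist _ _).sum_le_sum (fun _ _ => Nat.zero_le _)

lemma topSum_plen (m : JPartition) : topSum m (plen m) = psize m := by
  rw [psize_eq, topSum, ← sortedParts_length, List.take_length]

lemma multiset_sum_le_take : ∀ (L : List ℕ) (n : ℕ) (s : Multiset ℕ), L.Pairwise (fun a b => b ≤ a) →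
    s ≤ L → Multiset.card s ≤ n → s.sum ≤ (L.take n).sum := by
  intro L
  induction L with
  | nil =>
    intro n s _ hs _
    have : s = 0 := by simpa using hs
    simp [this]
  | cons a L ih =>
    intro n s hL hs hn
    rcases Nat.eq_zero_or_pos n with rfl | hpos
    · have : s = 0 := by simpa using hn
      simp [this]
    obtain ⟨n, rfl⟩ : ∃ n', n = n' + 1 := ⟨n - 1, by omega⟩
    rw [List.pairwise_cons] at hL
    rw [List.take_succ_cons, List.sum_cons]
    rw [← Multiset.cons_coe] at hs
    by_cases ha : a ∈ s
    · obtain ⟨s', rfl⟩ := Multiset.exists_cons_of_mem ha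
      rw [Multiset.sum_cons]
      rw [Multiset.cons_le_cons_iff] at hs
      simp at hn
      exact Nat.add_le_add_left (ih n s' hL.2 hs hn) a
    · have hs' : s ≤ L := (Multiset.le_cons_of_notMem ha).1 hs
      rcases s.empty_or_exists_mem with rfl | ⟨b, hb⟩
      · simp
      · obtain ⟨s', rfl⟩ := Multiset.exists_cons_of_mem hb
        rw [Multiset.sum_cons]
        simp at hn
        have hbL : b ∈ L := by simpa using Multiset.mem_of_le hs' hb
        have := ih n s' hL.2 ((Multiset.le_cons_self _ _).trans hs') hn
        have := hL.1 b hbL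
        omega

lemma map_eq_coe {α : Type} (f : α → ℕ) : ∀ (L : List ℕ) (s : Multiset α),
    s.map f = L → ∃ l : List α, (l : Multiset α) = s ∧ l.map f = L := by
  intro L
  induction L with
  | nil =>
    intro s hs
    have : s = 0 := by simpa using hs
    exact ⟨[], by simp [this]⟩
  | cons a L ih =>
    intro s hs
    have ha : a ∈ s.map f := by rw [hs]; simp
    rw [Multiset.mem_map] at ha
    obtain ⟨x, hx, rfl⟩ := ha
    obtain ⟨s', rfl⟩ := Multiset.exists_cons_of_mem hx
    rw [Multiset.map_cons, ← Multiset.cons_coe, Multiset.cons_inj_right] at hs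
    obtain ⟨l, rfl, hl⟩ := ih s' hs
    exact ⟨x :: l, by simp, by simp [hl]⟩

/-- the partition attached to an exponent vector -/
def partOf {N : ℕ} (e : Fin N →₀ ℕ) : JPartition := e.support.val.map fun i => Nat.toPNat' (e i)

lemma partOf_coe {N : ℕ} (e : Fin N →₀ ℕ) :
    (partOf e).map (fun i : ℕ+ => (i : ℕ)) = e.support.val.map e := by
  rw [partOf, Multiset.map_map]
  refine Multiset.map_congr rfl fun i hi => ?_
  have : e i ≠ 0 := by simpa using hi
  simp [Nat.toPNat'_coe, Nat.pos_of_ne_zero this]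

lemma partOf_list {N : ℕ} (e : Fin N →₀ ℕ) : ∃ l : List (Fin N), l.Nodup ∧
    l.map e = sortedParts (partOf e) ∧ ∀ i, i ∈ l ↔ e i ≠ 0 := by
  obtain ⟨l, hl, hl'⟩ := map_eq_coe e (sortedParts (partOf e)) e.support.val
    (by rw [sortedParts_coe, partOf_coe])
  refine ⟨l, ?_, hl', fun i => ?_⟩
  · rw [← Multiset.coe_nodup, hl]; exact e.support.nodup
  · rw [← Multiset.mem_coe, hl]; simp

lemma sum_le_topSum {N : ℕ} (e : Fin N →₀ ℕ) (A : Finset (Fin N)) :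
    ∑ i ∈ A, e i ≤ topSum (partOf e) A.card := by
  have h1 : ∑ i ∈ A, e i = ∑ i ∈ A ∩ e.support, e i := by
    symm
    apply Finset.sum_subset Finset.inter_subset_left
    intro i hi hi'
    simp [hi] at hi'
    exact hi'
  rw [h1]
  apply multiset_sum_le_take _ _ ((A ∩ e.support).val.map e) (sortedParts_pairwise _)
  · rw [sortedParts_coe, partOf_coe]
    exact Multiset.map_le_map (Finset.val_le_iff.2 Finset.inter_subset_right)
  · rw [Multiset.card_map]
    exact Finset.card_le_card Finset.inter_subset_left

lemma topSum_eq_sum {N : ℕ} (e : Fin N →₀ ℕ) (n : ℕ) : ∃ A : Finset (Fin N), A.card ≤ n ∧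
    topSum (partOf e) n = ∑ i ∈ A, e i := by
  obtain ⟨l, hn, hl, _⟩ := partOf_list e
  refine ⟨(l.take n).toFinset, ?_, ?_⟩
  · exact (List.toFinset_card_le _).trans (List.length_take_le _ _)
  · rw [List.sum_toFinset _ (hn.sublist (List.take_sublist _ _)), topSum, ← hl, List.map_take]

lemma xexp_apply (m : JPartition) (N : ℕ) (j : Fin N) :
    xexp m N j = (sortedParts m).getD (j : ℕ) 0 := rfl

lemma coeff_ev_partOf {N : ℕ} (e : Fin N →₀ ℕ) (f : SS) :
    MvPolynomial.coeff e (ev k N f) =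
      MvPolynomial.coeff (xexp (partOf e) (plen (partOf e))) (ev k (plen (partOf e)) f) := by
  obtain ⟨l, hn, hl, hm⟩ := partOf_list e
  have hlen : l.length = plen (partOf e) := by
    rw [← sortedParts_length, ← hl, List.length_map]
  set ι : Fin (plen (partOf e)) → Fin N := fun i => l.get (i.cast hlen.symm) with hι
  have hinj : Function.Injective ι := by
    intro a b h
    have := (List.nodup_iff_injective_get.1 hn) h
    simpa [Fin.ext_iff] using this
  have he : (xexp (partOf e) (plen (partOf e))).mapDomain ι = e := by
    ext i
    by_cases hi : i ∈ Set.range ι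
    · obtain ⟨j, rfl⟩ := hi
      rw [Finsupp.mapDomain_apply hinj, xexp_apply, ← hl]
      have : (j : ℕ) < l.length := by rw [hlen]; exact j.2
      simp [hι, this]
    · rw [Finsupp.mapDomain_notin_range _ _ hi]
      by_contra hne
      have : i ∈ l := (hm i).2 (Ne.symm hne)
      obtain ⟨j, hj⟩ := List.get_of_mem this
      exact hi ⟨j.cast hlen, by simpa [hι] using hj⟩
  conv_lhs => rw [← he]
  exact coeff_ev hinj f _

lemma coeff_ev_xexp {N : ℕ} (m : JPartition) (h : plen m ≤ N) (f : SS) :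
    MvPolynomial.coeff (xexp m N) (ev k N f) =
      MvPolynomial.coeff (xexp m (plen m)) (ev k (plen m) f) := by
  have he : (xexp m (plen m)).mapDomain (Fin.castLE h) = xexp m N := by
    ext i
    by_cases hi : i ∈ Set.range (Fin.castLE h)
    · obtain ⟨j, rfl⟩ := hi
      rw [Finsupp.mapDomain_apply (Fin.castLE_injective h), xexp_apply, xexp_apply]
      simp
    · rw [Finsupp.mapDomain_notin_range _ _ hi, xexp_apply]
      have : plen m ≤ (i : ℕ) := by
        by_contra hlt
        exact hi ⟨⟨i, by omega⟩, rfl⟩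
      rw [List.getD_eq_default]
      rw [sortedParts_length]; exact this
  rw [← he, coeff_ev (Fin.castLE_injective h)]

lemma finite_psize (n : ℕ) : {m : JPartition | psize m ≤ n}.Finite := by
  refine (Set.finite_Iic (n • (Finset.Icc (1 : ℕ+) (Nat.succPNat n)).val : Multiset ℕ+)).subset ?_
  intro m hm
  rw [Set.mem_Iic, Multiset.le_iff_count]
  intro a
  rw [Multiset.count_nsmul]
  have h0 : Multiset.count a m * (a : ℕ) ≤ psize m := by
    have : Multiset.replicate (Multiset.count a m) a ≤ m := Multiset.le_count_iff_replicate_le.1 le_rfl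
    obtain ⟨c, hc⟩ := Multiset.le_iff_exists_add.1 this
    rw [psize_def]
    conv_rhs => rw [hc]
    simp
  have hm' : psize m ≤ n := hm
  by_cases ha : a ∈ m
  · have h1 : 1 ≤ Multiset.count a m := Multiset.one_le_count_iff_mem.2 ha
    have h2 : (a : ℕ) ≤ n := by nlinarith
    have h3 : a ∈ (Finset.Icc (1 : ℕ+) (Nat.succPNat n)).val := by
      rw [Finset.mem_val, Finset.mem_Icc]
      refine ⟨PNat.one_le a, ?_⟩
      rw [← PNat.coe_le_coe, Nat.succPNat_coe]; omega
    have h4 := Multiset.one_le_count_iff_mem.2 h3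
    have := a.pos
    nlinarith
  · rw [Multiset.count_eq_zero_of_notMem ha]; exact Nat.zero_le _

end Part
end JackAux
end

open scoped Classical
set_option linter.all false
noncomputable section
namespace JackAux
section Eig
variable {k : Type} [Field k]
local notation "SS" => MvPolynomial ℕ k
local notation "SX" => Polynomial (MvPolynomial ℕ k)

/-- extended dominance order -/
def ord (m l : JPartition) : Prop := ∀ n, topSum m n ≤ topSum l n

lemma ord_refl (l : JPartition) : ord l l := fun _ => le_rfl
lemma ord_trans {a b c : JPartition} (h : ord a b) (h' : ord b c) : ord a c :=
  fun n => (h n).trans (h' n)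
lemma ord_antisymm {a b : JPartition} (h : ord a b) (h' : ord b a) : a = b :=
  topSum_inj fun n => le_antisymm (h n) (h' n)

lemma ord_finite (l : JPartition) : {m | ord m l}.Finite := by
  refine (finite_psize (psize l)).subset ?_
  intro m hm
  have := hm (plen m)
  rw [topSum_plen] at this
  exact this.trans (topSum_le_psize _ _)

/-- symmetric functions supported below `l` -/
def Bd (k : Type) [Field k] (l : JPartition) : Submodule k (MvPolynomial ℕ k) where
  carrier := {f | ∀ N (A : Finset (Fin N)), dg A (ev k N f) ≤ topSum l A.card}
  zero_mem' := by intro N A; rw [map_zero, dg_zero]; exact Nat.zero_le _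
  add_mem' := by
    intro f g hf hg N A
    rw [map_add]; exact dg_add_le A (hf N A) (hg N A)
  smul_mem' := by
    intro c f hf N A
    rw [map_smul, MvPolynomial.smul_eq_C_mul]
    exact dg_C_mul A c (hf N A)

lemma Bd_mono {m l : JPartition} (h : ord m l) {f : SS} (hf : f ∈ Bd k m) : f ∈ Bd k l :=
  fun N A => (hf N A).trans (h _)

lemma Bd_Top (al : k) (n : ℕ) {l : JPartition} {f : SS} (hf : f ∈ Bd k l) :
    Top (fun m => al * (m + 1 : ℕ)) 0 (al - 1) (fun m => MvPolynomial.X m) n f ∈ Bd k l :=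
  fun N A => dg_Top A al n f (hf N A)

/-- monomial coefficients -/
def mcoef (m : JPartition) : SS →ₗ[k] k :=
  (MvPolynomial.lcoeff k (xexp m (plen m))) ∘ₗ (ev k (plen m)).toLinearMap

lemma mcoef_apply (m : JPartition) (f : SS) :
    mcoef m f = MvPolynomial.coeff (xexp m (plen m)) (ev k (plen m) f) := rfl

lemma Bd_of_mcoef {l : JPartition} {f : SS} (h : ∀ m, mcoef m f ≠ 0 → ord m l) : f ∈ Bd k l := by
  intro N A
  rw [dg_le_iff]
  intro e he
  rw [coeff_ev_partOf] at he
  exact (sum_le_topSum e A).trans (h _ he _)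

lemma eq_zero_of_mcoef [CharZero k] {l : JPartition} {f : SS} (hf : f ∈ Bd k l)
    (h : ∀ m, ord m l → mcoef m f = 0) : f = 0 := by
  apply ev_inj'
  intro N
  ext e
  rw [MvPolynomial.coeff_zero]
  by_contra hne
  have hord : ord (partOf e) l := by
    intro n
    obtain ⟨A, hA, hA'⟩ := topSum_eq_sum e n
    rw [hA']
    exact ((dg_le_iff A _ _).1 (hf N A) e hne).trans (topSum_mono l hA)
  have := h _ hord
  rw [mcoef_apply, ← coeff_ev_partOf] at this
  exact hne this

variable {J : JPartition → MvPolynomial ℕ k} {β : MvPolynomial ℕ k →ₗ[k] MvPolynomial ℕ k →ₗ[k] k}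

lemma J_linInd (han : ∀ f, β f f = 0 → f = 0) (horth : ∀ l m, l ≠ m → β (J l) (J m) = 0)
    (hne : ∀ l, J l ≠ 0) : LinearIndependent k J := by
  apply LinearMap.linearIndependent_of_isOrthoᵢ (B := β)
  · intro l m h
    exact horth l m h
  · intro l h
    exact hne l (han _ h)

lemma Bd_span [CharZero k] (han : ∀ f, β f f = 0 → f = 0)
    (horth : ∀ l m, l ≠ m → β (J l) (J m) = 0)
    (hne : ∀ l, J l ≠ 0) (htri : ∀ l, J l ∈ Bd k l) (l : JPartition) :
    Bd k l ≤ Submodule.span k (Set.range fun m : {m // ord m l} => J m) := by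
  have hli := J_linInd han horth hne
  haveI : Finite {m // ord m l} := (ord_finite l).to_subtype
  haveI : Fintype {m // ord m l} := Fintype.ofFinite _
  -- coefficient map
  set Ψ : Bd k l →ₗ[k] ({m // ord m l} → k) :=
    LinearMap.pi (fun m => mcoef m.1 ∘ₗ (Bd k l).subtype) with hΨ
  have hinj : Function.Injective Ψ := by
    rw [← LinearMap.ker_eq_bot, LinearMap.ker_eq_bot']
    rintro ⟨f, hf⟩ h
    have : f = 0 := eq_zero_of_mcoef hf fun m hm => congrFun h ⟨m, hm⟩
    exact Subtype.ext this
  haveI : FiniteDimensional k (Bd k l) := FiniteDimensional.of_injective Ψ hinj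
  have hd : Module.finrank k (Bd k l) ≤ Fintype.card {m // ord m l} := by
    have := LinearMap.finrank_le_finrank_of_injective hinj
    rwa [Module.finrank_fintype_fun_eq_card] at this
  set v : {m // ord m l} → Bd k l := fun m => ⟨J m, Bd_mono m.2 (htri m)⟩ with hv
  have hvli : LinearIndependent k v := by
    apply LinearIndependent.of_comp (Bd k l).subtype
    exact hli.comp _ Subtype.val_injective
  have hcard : Fintype.card {m // ord m l} = Module.finrank k (Bd k l) :=
    le_antisymm hvli.fintype_card_le_finrank hd
  have htop := hvli.span_eq_top_of_card_eq_finrank' hcard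
  intro f hf
  have h1 : (⟨f, hf⟩ : Bd k l) ∈ Submodule.span k (Set.range v) := by rw [htop]; trivial
  have h2 := Submodule.mem_map_of_mem (f := (Bd k l).subtype) h1
  rw [Submodule.map_span, ← Set.range_comp] at h2
  exact h2

lemma J_span [CharZero k] (han : ∀ f, β f f = 0 → f = 0)
    (horth : ∀ l m, l ≠ m → β (J l) (J m) = 0)
    (hne : ∀ l, J l ≠ 0) (htri : ∀ l, J l ∈ Bd k l) : Submodule.span k (Set.range J) = ⊤ := by
  rw [eq_top_iff]
  intro f _
  obtain ⟨n, hn⟩ := dg_ev_bounded f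
  set l : JPartition := {Nat.succPNat n} with hl
  have hs : sortedParts l = [n + 1] := by
    apply List.perm_singleton.1
    rw [← Multiset.coe_eq_coe, sortedParts_coe, hl]
    simp
  have hf : f ∈ Bd k l := by
    intro N A
    rcases Nat.eq_zero_or_pos A.card with h0 | h0
    · rw [Finset.card_eq_zero] at h0
      subst h0
      rw [dg_le_iff]; simp
    · refine (hn N A).trans ?_
      rw [topSum, hs]
      obtain ⟨c, hc⟩ : ∃ c, A.card = c + 1 := ⟨A.card - 1, by omega⟩
      rw [hc]; simp
  have := Bd_span han horth hne htri l hf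
  refine Submodule.span_mono ?_ this
  rintro _ ⟨m, rfl⟩
  exact ⟨m, rfl⟩

theorem J_eigen [CharZero k] (al : k) (hsymm : ∀ f g, β f g = β g f) (han : ∀ f, β f f = 0 → f = 0)
    (hX : ∀ i f g, β (MvPolynomial.X i * f) g =
      β f (MvPolynomial.C (al * (i + 1 : ℕ)) * MvPolynomial.pderiv i g))
    (horth : ∀ l m, l ≠ m → β (J l) (J m) = 0)
    (hne : ∀ l, J l ≠ 0) (htri : ∀ l, J l ∈ Bd k l) (n : ℕ) (l : JPartition) :
    ∃ τ : k, Top (fun m => al * (m + 1 : ℕ)) 0 (al - 1) (fun m => MvPolynomial.X m) n (J l) =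
      τ • J l := by
  set T := Top (fun m => al * (m + 1 : ℕ)) 0 (al - 1) (fun m => (MvPolynomial.X m : SS)) n with hT
  have hadj : ∀ f g, β (T f) g = β f (T g) := by
    have hA : ∀ i (g : SS), Aop (fun m => al * (m + 1 : ℕ)) 0 i g =
        MvPolynomial.C (al * (i + 1 : ℕ)) * MvPolynomial.pderiv i g := by
      intro i g; simp [Aop]
    apply Top_adjoint
    · intro i f g
      rw [hsymm f, hX, hsymm, hA]
    · intro i f g
      rw [hX, hA]
  have hspan : ∀ l, T (J l) ∈ Submodule.span k (Set.range fun m : {m // ord m l} => J m) :=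
    fun l => Bd_span han horth hne htri l (Bd_Top al n (htri l))
  -- vanishing of off-diagonal entries
  have hoff : ∀ m, m ≠ l → β (T (J l)) (J m) = 0 := by
    intro m hm
    have key : ∀ l m, ¬ ord m l → β (T (J l)) (J m) = 0 := by
      intro l m h
      have : Submodule.span k (Set.range fun m : {m // ord m l} => J m) ≤ LinearMap.ker (β.flip (J m)) := by
        rw [Submodule.span_le]
        rintro _ ⟨⟨p, hp⟩, rfl⟩
        change β (J p) (J m) = 0
        apply horth
        rintro rfl
        exact h hp
      exact this (hspan l)
    by_cases h : ord m l
    · rw [hadj, hsymm]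
      exact key _ _ fun h' => hm (ord_antisymm h h')
    · exact key _ _ h
  refine ⟨β (T (J l)) (J l) / β (J l) (J l), ?_⟩
  have hll : β (J l) (J l) ≠ 0 := fun h => hne l (han _ h)
  set r := T (J l) - (β (T (J l)) (J l) / β (J l) (J l)) • J l with hr
  have hr0 : ∀ m, β r (J m) = 0 := by
    intro m
    rw [hr, map_sub, map_smul, LinearMap.sub_apply, LinearMap.smul_apply, smul_eq_mul]
    by_cases hm : m = l
    · subst hm; field_simp; ring
    · rw [hoff m hm, horth l m (Ne.symm hm)]; ring
  have hall : ∀ f, β r f = 0 := by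
    intro f
    have : (⊤ : Submodule k SS) ≤ LinearMap.ker (β r) := by
      rw [← J_span han horth hne htri, Submodule.span_le]
      rintro _ ⟨m, rfl⟩
      exact hr0 m
    exact this (Submodule.mem_top (x := f))
  have := han r (hall r)
  rw [hr, sub_eq_zero] at this
  exact this

end Eig
end JackAux
end

open scoped Classical
set_option linter.all false
noncomputable section
namespace JackAux
section Form
variable {k : Type} [Field k]
local notation "SS" => MvPolynomial ℕ k
local notation "SX" => Polynomial (MvPolynomial ℕ k)

/-- diagonal bilinear form -/
def dform (w : (ℕ →₀ ℕ) → k) : MvPolynomial ℕ k →ₗ[k] MvPolynomial ℕ k →ₗ[k] k :=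
  (MvPolynomial.basisMonomials ℕ k).constr k (fun m => w m • MvPolynomial.lcoeff k m)

lemma dform_mon (w : (ℕ →₀ ℕ) → k) (m : ℕ →₀ ℕ) (c : k) (g : SS) :
    dform w (MvPolynomial.monomial m c) g = c * (w m * MvPolynomial.coeff m g) := by
  have h1 : (MvPolynomial.monomial m c : SS) = c • MvPolynomial.basisMonomials ℕ k m := by
    rw [MvPolynomial.coe_basisMonomials, MvPolynomial.smul_monomial, smul_eq_mul, mul_one]
  rw [h1, map_smul, dform, Module.Basis.constr_basis]
  simp [MvPolynomial.lcoeff_apply]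

lemma dform_symm (w : (ℕ →₀ ℕ) → k) (f g : SS) : dform w f g = dform w g f := by
  induction f using MvPolynomial.induction_on' with
  | add p q hp hq => simp [hp, hq]
  | monomial m c =>
    induction g using MvPolynomial.induction_on' with
    | add p q hp hq => simp [hp, hq]
    | monomial u d =>
      rw [dform_mon, dform_mon, MvPolynomial.coeff_monomial, MvPolynomial.coeff_monomial]
      by_cases h : u = m
      · subst h; simp; ring
      · simp [h, Ne.symm h]

lemma dform_eq_sum (w : (ℕ →₀ ℕ) → k) (f g : SS) : dform w f g =
    ∑ m ∈ f.support, MvPolynomial.coeff m f * MvPolynomial.coeff m g * w m := by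
  conv_lhs => rw [f.as_sum, map_sum, LinearMap.sum_apply]
  refine Finset.sum_congr rfl fun m _ => ?_
  rw [dform_mon]; ring

def zk (κ : ℕ → k) (m : ℕ →₀ ℕ) : k := m.prod fun i n => (Nat.factorial n : k) * κ i ^ n

lemma zk_add (κ : ℕ → k) (m : ℕ →₀ ℕ) (i : ℕ) :
    zk κ (m + Finsupp.single i 1) = zk κ m * (κ i * ((m i : k) + 1)) := by
  have h : ∀ u : ℕ →₀ ℕ, u.support ⊆ insert i m.support → zk κ u = (Nat.factorial (u i) : k) * κ i ^ (u i) *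
      ∏ j ∈ (insert i m.support).erase i, (Nat.factorial (u j) : k) * κ j ^ (u j) := by
    intro u hu
    rw [zk, Finsupp.prod_of_support_subset _ hu _ (by simp)]
    exact (Finset.mul_prod_erase (insert i m.support) (fun j => (Nat.factorial (u j) : k) * κ j ^ (u j))
      (Finset.mem_insert_self _ _)).symm
  rw [h m (Finset.subset_insert _ _), h (m + Finsupp.single i 1)]
  · have : ∏ j ∈ (insert i m.support).erase i, (Nat.factorial ((m + Finsupp.single i 1 : ℕ →₀ ℕ) j) : k) *
        κ j ^ ((m + Finsupp.single i 1 : ℕ →₀ ℕ) j) =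
        ∏ j ∈ (insert i m.support).erase i, (Nat.factorial (m j) : k) * κ j ^ (m j) := by
      refine Finset.prod_congr rfl fun j hj => ?_
      rw [Finset.mem_erase] at hj
      simp [Finsupp.single_apply, Ne.symm hj.1]
    rw [this]
    simp only [Finsupp.add_apply, Finsupp.single_eq_same, Nat.factorial_succ, pow_succ]
    push_cast; ring
  · intro j hj
    simp only [Finsupp.mem_support_iff, Finsupp.add_apply, Finset.mem_insert] at *
    by_cases h : j = i
    · exact Or.inl h
    · right; simpa [Finsupp.single_apply, Ne.symm h] using hj

lemma dform_X (κ : ℕ → k) (i : ℕ) (f g : SS) : dform (zk κ) (MvPolynomial.X i * f) g =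
    dform (zk κ) f (MvPolynomial.C (κ i) * MvPolynomial.pderiv i g) := by
  induction f using MvPolynomial.induction_on' with
  | add p q hp hq => rw [mul_add, map_add, LinearMap.add_apply, hp, hq, map_add, LinearMap.add_apply]
  | monomial m c =>
    rw [MvPolynomial.X, MvPolynomial.monomial_mul, one_mul, dform_mon, dform_mon,
      MvPolynomial.coeff_C_mul, MvPolynomial.coeff_pderiv, add_comm (Finsupp.single i 1) m, zk_add]
    ring

/-- the factorial form -/
def Bf (k : Type) [Field k] : MvPolynomial ℕ k →ₗ[k] MvPolynomial ℕ k →ₗ[k] k := dform (zk fun _ => 1)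

lemma Bf_X (i : ℕ) (f g : SS) : Bf k (MvPolynomial.X i * f) g = Bf k f (MvPolynomial.pderiv i g) := by
  rw [Bf, dform_X]; simp

lemma Bf_pderiv (i : ℕ) (f g : SS) : Bf k (MvPolynomial.pderiv i f) g = Bf k f (MvPolynomial.X i * g) := by
  rw [Bf, dform_symm, dform_symm _ f, ← Bf, Bf_X]

/-- the shift `p_1 ↦ p_1 + 1` -/
def sh (k : Type) [Field k] : MvPolynomial ℕ k →ₐ[k] MvPolynomial ℕ k :=
  MvPolynomial.aeval fun i => MvPolynomial.X i + if i = 0 then 1 else 0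

lemma sh_X (i : ℕ) : sh k (MvPolynomial.X i) = MvPolynomial.X i + if i = 0 then 1 else 0 := by
  simp [sh]

lemma sh_C (c : k) : sh k (MvPolynomial.C c) = MvPolynomial.C c := (sh k).commutes c

lemma sh_surj : Function.Surjective (sh k) := by
  intro f
  induction f using MvPolynomial.induction_on with
  | C a => exact ⟨_, sh_C a⟩
  | add p q hp hq =>
    obtain ⟨a, rfl⟩ := hp
    obtain ⟨b, rfl⟩ := hq
    exact ⟨a + b, map_add _ _ _⟩
  | mul_X p i hp =>
    obtain ⟨a, rfl⟩ := hp
    refine ⟨a * (MvPolynomial.X i - if i = 0 then 1 else 0), ?_⟩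
    rw [map_mul, map_sub, sh_X]
    split_ifs <;> simp

lemma sh_pderiv (i : ℕ) (f : SS) : MvPolynomial.pderiv i (sh k f) = sh k (MvPolynomial.pderiv i f) := by
  induction f using MvPolynomial.induction_on with
  | C a => simp [sh_C]
  | add p q hp hq => simp [hp, hq]
  | mul_X p j hp =>
    rw [map_mul, Derivation.leibniz, Derivation.leibniz, hp, map_add, sh_X, map_add]
    have : MvPolynomial.pderiv i (if j = 0 then 1 else 0 : SS) = 0 := by
      split_ifs <;> simp
    rw [this, add_zero, smul_eq_mul, smul_eq_mul, smul_eq_mul, smul_eq_mul, map_mul, map_mul, sh_X]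
    congr 2
    rw [MvPolynomial.pderiv_X]
    by_cases h : j = i
    · subst h; simp
    · simp [h]

/-- the pairing -/
def pairing (k : Type) [Field k] : MvPolynomial ℕ k →ₗ[k] MvPolynomial ℕ k →ₗ[k] k :=
  (Bf k).compl₂ (sh k).toLinearMap

lemma pairing_apply (f g : SS) : pairing k f g = Bf k f (sh k g) := rfl

lemma pairing_Tt (al : k) (n : ℕ) (f g : SS) : pairing k (Tt al (al - 1) n f) g =
    pairing k f (Top (fun m => al * (m + 1 : ℕ)) 0 (al - 1) (fun m => MvPolynomial.X m) n g) := by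
  apply Top_adjoint
  · intro i f g
    rw [pairing_apply, pairing_apply, map_mul, sh_X, Aop, add_mul, map_add, map_add,
      LinearMap.add_apply, ← Bf_pderiv]
    congr 1
    · simp
    · split_ifs <;> simp
  · intro i f g
    rw [pairing_apply, pairing_apply, Aop]
    simp only [map_zero, zero_mul, ite_self, add_zero, map_mul (sh k), sh_C, ← sh_pderiv]
    rw [sg, yv, mul_assoc, mul_assoc, ← MvPolynomial.smul_eq_C_mul, ← MvPolynomial.smul_eq_C_mul, map_smul,
      map_smul, LinearMap.smul_apply, LinearMap.smul_apply, Bf_X, map_mul MvPolynomial.C, mul_assoc,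
      ← MvPolynomial.smul_eq_C_mul, ← MvPolynomial.smul_eq_C_mul, map_smul, map_smul]

lemma sh_monomial (u : ℕ →₀ ℕ) (c : k) : sh k (MvPolynomial.monomial u c) =
    ∑ j ∈ Finset.range (u 0 + 1), MvPolynomial.monomial (u.erase 0 + Finsupp.single 0 j)
      (c * (Nat.choose (u 0) j : k)) := by
  have h1 : sh k (MvPolynomial.monomial (u.erase 0) c) = MvPolynomial.monomial (u.erase 0) c := by
    rw [MvPolynomial.monomial_eq, map_mul, sh_C, Finsupp.prod, map_prod]
    congr 1
    refine Finset.prod_congr rfl fun i hi => ?_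
    rw [map_pow, sh_X]
    have : i ≠ 0 := by
      rw [Finsupp.support_erase, Finset.mem_erase] at hi; exact hi.1
    simp [this]
  have h2 : (MvPolynomial.monomial u c : SS) = MvPolynomial.monomial (u.erase 0) c *
      MvPolynomial.X 0 ^ (u 0) := by
    rw [MvPolynomial.X_pow_eq_monomial, MvPolynomial.monomial_mul, mul_one, Finsupp.erase_add_single]
  rw [h2, map_mul, h1, map_pow, sh_X, if_pos rfl, add_pow, Finset.mul_sum]
  refine Finset.sum_congr rfl fun j _ => ?_
  rw [one_pow, mul_one, MvPolynomial.X_pow_eq_monomial]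
  have : ((Nat.choose (u 0) j : ℕ) : SS) = MvPolynomial.C (Nat.choose (u 0) j : k) := by simp
  rw [this, ← mul_assoc, MvPolynomial.monomial_mul, mul_one, mul_comm, MvPolynomial.C_mul_monomial, mul_comm c]

lemma wt0_erase (u : ℕ →₀ ℕ) : wt0 u = wt0 (u.erase 0) + u 0 := by
  conv_lhs => rw [← Finsupp.erase_add_single 0 u, map_add, wt0_single]
  simp

lemma coeff_sh_mon (u m : ℕ →₀ ℕ) (c : k) : MvPolynomial.coeff m (sh k (MvPolynomial.monomial u c)) =
    if wt0 u < wt0 m then 0 else (Nat.choose (wt0 u - wt0 m + m 0) (m 0) : k) *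
      MvPolynomial.coeff (m + Finsupp.single 0 (wt0 u - wt0 m)) (MvPolynomial.monomial u c) := by
  rw [sh_monomial, MvPolynomial.coeff_sum]
  simp only [MvPolynomial.coeff_monomial]
  by_cases h : u.erase 0 = m.erase 0
  · have e1 : ∀ j, (u.erase 0 + Finsupp.single 0 j = m) ↔ j = m 0 := by
      intro j
      constructor
      · intro h'
        have := DFunLike.congr_fun h' 0
        simpa using this
      · rintro rfl
        rw [h, Finsupp.erase_add_single]
    simp only [e1]
    rw [Finset.sum_ite_eq']
    have hu := wt0_erase u
    have hm := wt0_erase m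
    rw [h] at hu
    by_cases h2 : wt0 u < wt0 m
    · rw [if_pos h2, if_neg]
      simp; omega
    · rw [if_neg h2, if_pos (by simp; omega), if_pos]
      · rw [show wt0 u - wt0 m + m 0 = u 0 by omega]; ring
      · rw [show wt0 u - wt0 m = u 0 - m 0 by omega]
        ext i
        by_cases hi : i = 0
        · subst hi; simp; omega
        · have := DFunLike.congr_fun h i
          simpa [hi, Finsupp.single_apply, Ne.symm hi] using this
  · rw [Finset.sum_eq_zero]
    · split_ifs with h1 h2
      · rfl
      · exfalso; apply h
        rw [h2]
        ext i
        by_cases hi : i = 0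
        · subst hi; simp
        · simp [hi, Finsupp.single_apply, Ne.symm hi]
      · simp
    · intro j _
      rw [if_neg]
      rintro rfl
      apply h
      ext i
      by_cases hi : i = 0
      · subst hi; simp
      · simp [hi, Finsupp.single_apply, Ne.symm hi]

lemma coeff_sh (m : ℕ →₀ ℕ) (s : ℕ) (g : SS) (hg : ∀ u, MvPolynomial.coeff u g ≠ 0 → wt0 u = s) :
    MvPolynomial.coeff m (sh k g) =
    if s < wt0 m then 0 else (Nat.choose (s - wt0 m + m 0) (m 0) : k) *
      MvPolynomial.coeff (m + Finsupp.single 0 (s - wt0 m)) g := by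
  conv_lhs => rw [g.as_sum, map_sum, MvPolynomial.coeff_sum]
  have h1 : ∀ u ∈ g.support, MvPolynomial.coeff m (sh k (MvPolynomial.monomial u (MvPolynomial.coeff u g)))
      = if s < wt0 m then 0 else (Nat.choose (s - wt0 m + m 0) (m 0) : k) *
      MvPolynomial.coeff (m + Finsupp.single 0 (s - wt0 m))
        (MvPolynomial.monomial u (MvPolynomial.coeff u g)) := by
    intro u hu
    rw [coeff_sh_mon, hg u (MvPolynomial.mem_support_iff.1 hu)]
  rw [Finset.sum_congr rfl h1]
  split_ifs with h
  · simp
  · rw [← Finset.mul_sum, ← MvPolynomial.coeff_sum, ← g.as_sum]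

lemma coeff_T0 (al : k) (f : SS) (m : ℕ →₀ ℕ) :
    MvPolynomial.coeff m (Top (fun m => al * (m + 1 : ℕ)) 0 (al - 1) (fun m => MvPolynomial.X m) 0 f)
      = al * wt0 m * MvPolynomial.coeff m f := by
  have hV : ∀ f : SS, Top (fun m => al * (m + 1 : ℕ)) 0 (al - 1) (fun m => MvPolynomial.X m) 0 f =
      Sym (fun m => MvPolynomial.X m) (nabla (fun m => al * (m + 1 : ℕ)) f) := by
    intro f
    simp [Top, Vop]
  have hS : ∀ (p : SS) (h : SX), Sym (fun m => (MvPolynomial.X m : SS)) (Polynomial.C p * h) =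
      p * Sym (fun m => MvPolynomial.X m) h := by
    intro p h
    induction h using Polynomial.induction_on' with
    | add a b ha hb => rw [mul_add, map_add, ha, hb, map_add, mul_add]
    | monomial n a => rw [Polynomial.C_mul_monomial, Sym_mon, Sym_mon]; ring
  rw [hV]
  induction f using MvPolynomial.induction_on generalizing m with
  | C a =>
    rw [nabla_C, map_zero, MvPolynomial.coeff_zero, MvPolynomial.coeff_C]
    by_cases h : 0 = m
    · subst h; simp
    · simp [h]
  | add p q hp hq => rw [map_add, map_add, MvPolynomial.coeff_add, hp, hq, MvPolynomial.coeff_add]; ring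
  | mul_X p i hp =>
    rw [nabla_mul, map_add, hS, hS, nabla_X, Sym_mon, MvPolynomial.coeff_add,
      MvPolynomial.coeff_X_mul', hp, mul_comm (MvPolynomial.X i) (MvPolynomial.C _), mul_left_comm,
      MvPolynomial.coeff_C_mul, MvPolynomial.coeff_mul_X']
    by_cases h : i ∈ m.support
    · rw [if_pos h, if_pos h]
      have hle : Finsupp.single i 1 ≤ m := by
        rw [Finsupp.single_le_iff]; simp at h; omega
      have hh : wt0 m = wt0 (m - Finsupp.single i 1) + wt0 (Finsupp.single i 1) := by
        rw [← map_add, tsub_add_cancel_of_le hle]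
      rw [wt0_single] at hh
      rw [hh]; push_cast; ring
    · rw [if_neg h, if_neg h]; ring

end Form
end JackAux
end

open scoped Classical
set_option linter.all false
noncomputable section
namespace JackAux

/-- index shift -/
def ph : ℕ+ ≃ ℕ := Equiv.pnatEquivNat

lemma ph_succ (i : ℕ+) : ph i + 1 = (i : ℕ) := by
  simp [ph]

lemma ph_one : ph 1 = 0 := rfl

/-- transport to `ℕ`-indexed variables -/
def tr : SymA →ₐ[F] MvPolynomial ℕ F := MvPolynomial.rename ph

lemma coeff_tr (f : SymA) (m : Exp) : MvPolynomial.coeff (m.mapDomain ph) (tr f) =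
    MvPolynomial.coeff m f := MvPolynomial.coeff_rename_mapDomain _ ph.injective _ _

lemma evalN_tr (N : ℕ) (f : SymA) : evalN N f = ev F N (tr f) := by
  have : evalN N = (ev F N).comp tr := by
    apply MvPolynomial.algHom_ext
    intro i
    simp [evalN, tr, ev_X, ph_succ]
  rw [this]; rfl

lemma zalpha_eq (m : Exp) : zalpha m = zk (fun i => alpha * ((i + 1 : ℕ) : F)) (m.mapDomain ph) := by
  rw [zk, Finsupp.prod_mapDomain_index_inj ph.injective, zalpha]
  simp only [ph_succ, Finsupp.prod, Finsupp.sum, map_prod, map_mul, map_pow, map_natCast]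
  rw [← Finset.prod_pow_eq_pow_sum, ← Finset.prod_mul_distrib]
  refine Finset.prod_congr rfl fun i _ => ?_
  rw [mul_pow]; ring

/-- the Hall form in the new variables -/
def Hf : MvPolynomial ℕ F →ₗ[F] MvPolynomial ℕ F →ₗ[F] F :=
  dform (zk (fun i => alpha * ((i + 1 : ℕ) : F)))

lemma hall_eq (f g : SymA) : hall f g = Hf (tr f) (tr g) := by
  rw [Hf, dform_eq_sum, tr, MvPolynomial.support_rename_of_injective ph.injective,
    Finset.sum_image (fun a _ b _ h => Finsupp.mapDomain_injective ph.injective h), hall]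
  refine Finset.sum_congr rfl fun m _ => ?_
  rw [← tr, coeff_tr, coeff_tr, zalpha_eq]

lemma exists_real_hom : ∃ σ : F →+* ℝ, 0 < σ alpha := by
  have h1 : Transcendental ℤ (liouvilleNumber (2 : ℕ)) := transcendental_liouvilleNumber le_rfl
  have h2 : Transcendental ℚ (liouvilleNumber (2 : ℕ)) := by
    intro h
    exact h1 ((IsFractionRing.isAlgebraic_iff ℤ ℚ ℝ).2 h)
  have h3 : Transcendental ℚ ((liouvilleNumber (2 : ℕ)) ^ 2) := h2.pow (by norm_num)
  set x : ℝ := (liouvilleNumber (2 : ℕ)) ^ 2 with hx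
  have hinj : Function.Injective (Polynomial.aeval (R := ℚ) x : Polynomial ℚ →ₐ[ℚ] ℝ).toRingHom :=
    transcendental_iff_injective.1 h3
  refine ⟨IsFractionRing.lift hinj, ?_⟩
  have : (IsFractionRing.lift hinj : F →+* ℝ) alpha = x := by
    rw [alpha, ← RatFunc.algebraMap_X, IsFractionRing.lift_algebraMap]
    simp
  rw [this, hx]
  refine lt_of_le_of_ne (sq_nonneg _) fun h => ?_
  rw [← hx] at h
  rw [← h] at h3
  exact h3 isAlgebraic_zero

lemma Hf_an (f : MvPolynomial ℕ F) (h : Hf f f = 0) : f = 0 := by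
  obtain ⟨σ, hσ⟩ := exists_real_hom
  have h2 := congrArg σ h
  rw [Hf, dform_eq_sum, map_sum, map_zero] at h2
  have hz : ∀ m, 0 < σ (zk (fun i => alpha * ((i + 1 : ℕ) : F)) m) := by
    intro m
    rw [zk, Finsupp.prod, map_prod]
    refine Finset.prod_pos fun i _ => ?_
    rw [map_mul, map_pow, map_mul, map_natCast, map_natCast]
    have := Nat.factorial_pos (m i)
    positivity
  have h3 := (Finset.sum_eq_zero_iff_of_nonneg (fun m _ => by
    rw [map_mul, map_mul]
    exact mul_nonneg (mul_self_nonneg _) (hz m).le)).1 h2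
  ext m
  rw [MvPolynomial.coeff_zero]
  by_contra hne
  have := h3 m (MvPolynomial.mem_support_iff.2 hne)
  rw [map_mul, map_mul] at this
  rcases mul_eq_zero.1 this with h4 | h4
  · rw [mul_self_eq_zero, map_eq_zero] at h4
    exact hne h4
  · exact (hz m).ne' h4

/-- exponent vector of a partition -/
def ex (m : JPartition) : ℕ →₀ ℕ := (toExp m).mapDomain ph

lemma toExp_eq (m : JPartition) : toExp m = Multiset.toFinsupp m := by
  ext i
  rw [toExp, Finset.sum_apply', Multiset.toFinsupp_apply]
  simp only [Finsupp.single_apply, Finset.sum_ite_eq', Multiset.mem_toFinset]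
  split_ifs with h
  · rfl
  · rw [Multiset.count_eq_zero_of_notMem h]

lemma ex_add (m l : JPartition) : ex (m + l) = ex m + ex l := by
  rw [ex, toExp_eq, map_add, Finsupp.mapDomain_add, ex, ex, toExp_eq, toExp_eq]

lemma ex_singleton (i : ℕ+) : ex {i} = Finsupp.single (ph i) 1 := by
  rw [ex, toExp_eq, Multiset.toFinsupp_singleton, Finsupp.mapDomain_single]

lemma ex_zero : ex 0 = 0 := by
  rw [ex, toExp_eq, map_zero, Finsupp.mapDomain_zero]

lemma ex_replicate (j : ℕ) : ex (Multiset.replicate j 1) = Finsupp.single 0 j := by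
  induction j with
  | zero => simp [ex_zero]
  | succ j ih => rw [Multiset.replicate_succ, ← Multiset.singleton_add, ex_add, ih, ex_singleton, ph_one,
      add_comm, ← Finsupp.single_add]

lemma ex_addOnes (m : JPartition) (j : ℕ) : ex (addOnes m j) = ex m + Finsupp.single 0 j := by
  rw [addOnes, ex_add, ex_replicate]

lemma ex_zero_apply (m : JPartition) : ex m 0 = pmult m 1 := by
  have h : ex m (ph 1) = toExp m 1 := Finsupp.mapDomain_apply ph.injective _ _
  rw [ph_one] at h
  rw [h, toExp_eq, Multiset.toFinsupp_apply, pmult]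

lemma wt0_ex (m : JPartition) : wt0 (ex m) = psize m := by
  rw [psize_def]
  induction m using Multiset.induction_on with
  | empty => simp [ex_zero]
  | cons i m ih =>
    rw [← Multiset.singleton_add, ex_add, map_add, ih, ex_singleton, wt0_single, Multiset.map_add,
      Multiset.sum_add, Multiset.map_singleton, Multiset.sum_singleton, ← ph_succ]
    ring

lemma ex_inj : Function.Injective ex := by
  intro m l h
  have := Finsupp.mapDomain_injective ph.injective h
  rw [toExp_eq, toExp_eq] at this
  exact Multiset.toFinsupp.injective this

lemma ex_surj (u : ℕ →₀ ℕ) : ∃ m, ex m = u := by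
  refine ⟨Multiset.toFinsupp.symm (u.mapDomain ph.symm), ?_⟩
  rw [ex, toExp_eq, AddEquiv.apply_symm_apply, ← Finsupp.mapDomain_comp]
  simp

/-- product of factorials -/
def fz (u : ℕ →₀ ℕ) : F := zk (fun _ => 1) u

lemma fz_ne (u : ℕ →₀ ℕ) : fz u ≠ 0 := by
  rw [fz, zk, Finsupp.prod, Finset.prod_ne_zero_iff]
  intro i _
  simp [Nat.factorial_ne_zero]

/-- normalised power sum -/
def Pm (m : JPartition) : MvPolynomial ℕ F := MvPolynomial.monomial (ex m) (fz (ex m))⁻¹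

lemma pairing_mon (u : ℕ →₀ ℕ) (c : F) (g : MvPolynomial ℕ F) :
    pairing F (MvPolynomial.monomial u c) g = c * (fz u * MvPolynomial.coeff u (sh F g)) := by
  rw [pairing_apply, Bf, dform_mon, fz]

lemma alpha_ne : (alpha : F) ≠ 0 := RatFunc.X_ne_zero

section Fam

lemma tr_orth {J : JPartition → SymA} (hJ : IsJackFamily J) (l m : JPartition) (h : l ≠ m) : Hf (tr (J l)) (tr (J m)) = 0 := by
  rw [← hall_eq]; exact hJ.orthogonal l m h

lemma tr_norm {J : JPartition → SymA} (hJ : IsJackFamily J) (l : JPartition) : MvPolynomial.coeff (Finsupp.single 0 (psize l)) (tr (J l)) = 1 := by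
  rw [← ph_one, ← Finsupp.mapDomain_single, coeff_tr]
  exact hJ.normalized l

lemma tr_ne {J : JPartition → SymA} (hJ : IsJackFamily J) (l : JPartition) : tr (J l) ≠ 0 := by
  intro h
  have := tr_norm hJ l
  rw [h] at this
  simp at this

lemma tr_tri {J : JPartition → SymA} (hJ : IsJackFamily J) (l : JPartition) : tr (J l) ∈ Bd F l := by
  apply Bd_of_mcoef
  intro m hm
  by_contra hc
  have h1 : ¬ dominates m l := fun h => hc h.2
  have h2 := hJ.triangular l m h1
  rw [evalN_tr, coeff_ev_xexp m (by omega)] at h2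
  exact hm (by rw [mcoef_apply]; exact h2)

lemma tr_span {J : JPartition → SymA} (hJ : IsJackFamily J) : Submodule.span F (Set.range fun l => tr (J l)) = ⊤ :=
  J_span (β := Hf) Hf_an (tr_orth hJ) (tr_ne hJ) (tr_tri hJ)

lemma tr_eigen {J : JPartition → SymA} (hJ : IsJackFamily J) (n : ℕ) (l : JPartition) : ∃ τ : F,
    Top (fun m => alpha * (m + 1 : ℕ)) 0 (alpha - 1) (fun m => MvPolynomial.X m) n (tr (J l)) =
      τ • tr (J l) :=
  J_eigen (β := Hf) (J := fun l => tr (J l)) alpha (dform_symm _) Hf_an (dform_X _) (tr_orth hJ) (tr_ne hJ) (tr_tri hJ) n l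

lemma tr_hom {J : JPartition → SymA} (hJ : IsJackFamily J) (l : JPartition) (u : ℕ →₀ ℕ) (hu : MvPolynomial.coeff u (tr (J l)) ≠ 0) :
    wt0 u = psize l := by
  obtain ⟨τ, hτ⟩ := tr_eigen hJ 0 l
  have h1 := congrArg (MvPolynomial.coeff u) hτ
  have h2 := congrArg (MvPolynomial.coeff (Finsupp.single 0 (psize l))) hτ
  rw [coeff_T0, MvPolynomial.coeff_smul, smul_eq_mul] at h1 h2
  rw [tr_norm hJ l, mul_one, mul_one, wt0_single] at h2
  have h3 := mul_right_cancel₀ hu h1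
  rw [← h2] at h3
  have h4 := mul_left_cancel₀ RatFunc.X_ne_zero h3
  have h5 : wt0 u = psize l * (0 + 1) := by exact_mod_cast h4
  simpa using h5

/-- evaluation on partitions -/
def Ph (J : JPartition → SymA) : MvPolynomial ℕ F →ₗ[F] (JPartition → F) :=
  LinearMap.pi fun l => (pairing F).flip (tr (J l))

lemma Ph_Pm {J : JPartition → SymA} (hJ : IsJackFamily J) (m l : JPartition) : Ph J (Pm m) l = theta J m l := by
  change pairing F (Pm m) (tr (J l)) = _
  rw [Pm, pairing_mon, inv_mul_cancel_left₀ (fz_ne _), coeff_sh _ (psize l) _ (tr_hom hJ l), wt0_ex, theta,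
    ex_zero_apply, ← ex_addOnes, ex, coeff_tr]

lemma Ph_one {J : JPartition → SymA} (hJ : IsJackFamily J) : Ph J 1 = 1 := by
  funext l
  change pairing F 1 (tr (J l)) = 1
  have : (1 : MvPolynomial ℕ F) = MvPolynomial.monomial 0 1 := rfl
  rw [this, pairing_mon, coeff_sh _ (psize l) _ (tr_hom hJ l)]
  simp [tr_norm hJ l, fz, zk]

lemma Ph_T {J : JPartition → SymA} (hJ : IsJackFamily J) (n : ℕ) (f : MvPolynomial ℕ F) : Ph J (Tt alpha (alpha - 1) n f) =
    Ph J (Tt alpha (alpha - 1) n 1) * Ph J f := by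
  have h : ∃ τ : JPartition → F, ∀ f, Ph J (Tt alpha (alpha - 1) n f) = τ * Ph J f := by
    choose τ hτ using tr_eigen hJ n
    refine ⟨τ, fun f => ?_⟩
    funext l
    change pairing F (Tt alpha (alpha - 1) n f) (tr (J l)) = τ l * pairing F f (tr (J l))
    rw [pairing_Tt, hτ, map_smul, smul_eq_mul]
  obtain ⟨τ, hτ⟩ := h
  rw [hτ, hτ, Ph_one hJ, mul_one]

lemma Ph_inj {J : JPartition → SymA} (hJ : IsJackFamily J) : Function.Injective (Ph J) := by
  rw [← LinearMap.ker_eq_bot, LinearMap.ker_eq_bot']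
  intro f hf
  have h1 : ∀ g, pairing F f g = 0 := by
    intro g
    have : Submodule.span F (Set.range fun l => tr (J l)) ≤ LinearMap.ker (pairing F f) := by
      rw [Submodule.span_le]
      rintro _ ⟨l, rfl⟩
      exact congrFun hf l
    rw [tr_span hJ] at this
    exact this (Submodule.mem_top (x := g))
  ext u
  obtain ⟨g, hg⟩ := sh_surj (k := F) (MvPolynomial.monomial u 1)
  have h2 := h1 g
  rw [pairing_apply, hg, Bf, dform_symm, dform_mon, one_mul] at h2
  rw [MvPolynomial.coeff_zero]
  exact (mul_eq_zero.1 h2).resolve_left (fz_ne u)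

end Fam
end JackAux
end

open scoped Classical
set_option linter.all false
noncomputable section
namespace JackAux

/-- values at `b` of polynomials with natural coefficients -/
def NB : Subsemiring F := (Polynomial.eval₂RingHom (Nat.castRingHom F) (alpha - 1)).rangeS

lemma NB_b : alpha - 1 ∈ NB := ⟨Polynomial.X, by simp⟩

lemma NB_a : alpha ∈ NB := by
  have := add_mem NB_b (one_mem NB)
  simpa using this

lemma NB_nat (n : ℕ) : (n : F) ∈ NB := natCast_mem NB n

lemma fz_add (u v : ℕ →₀ ℕ) : ∃ n : ℕ, fz (u + v) = n * (fz u * fz v) := by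
  refine ⟨∏ i ∈ u.support ∪ v.support, Nat.choose (u i + v i) (v i), ?_⟩
  have h : ∀ w : ℕ →₀ ℕ, w.support ⊆ u.support ∪ v.support →
      fz w = ∏ i ∈ u.support ∪ v.support, (Nat.factorial (w i) : F) := by
    intro w hw
    rw [fz, zk, Finsupp.prod_of_support_subset _ hw _ (by simp)]
    simp
  rw [h _ Finsupp.support_add, h u Finset.subset_union_left, h v Finset.subset_union_right,
    ← Finset.prod_mul_distrib, Nat.cast_prod, ← Finset.prod_mul_distrib]
  refine Finset.prod_congr rfl fun i _ => ?_
  rw [Finsupp.add_apply, ← Nat.add_choose_mul_factorial_mul_factorial]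
  push_cast; ring

/-- divided power lattice cone -/
def Lam : Subsemiring (MvPolynomial ℕ F) where
  carrier := {f | ∀ m, fz m * MvPolynomial.coeff m f ∈ NB}
  zero_mem' := by intro m; simp
  add_mem' := by
    intro f g hf hg m
    rw [MvPolynomial.coeff_add, mul_add]
    exact add_mem (hf m) (hg m)
  one_mem' := by
    intro m
    rw [MvPolynomial.coeff_one]
    split_ifs with h
    · subst h; simp [fz, zk]
    · simp
  mul_mem' := by
    intro f g hf hg m
    rw [MvPolynomial.coeff_mul, Finset.mul_sum]
    refine sum_mem fun x hx => ?_
    rw [Finset.HasAntidiagonal.mem_antidiagonal] at hx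
    obtain ⟨n, hn⟩ := fz_add x.1 x.2
    rw [hx] at hn
    rw [hn]
    have := mul_mem (NB_nat n) (mul_mem (hf x.1) (hg x.2))
    convert this using 1
    ring

lemma mem_Lam {f : MvPolynomial ℕ F} : f ∈ Lam ↔ ∀ m, fz m * MvPolynomial.coeff m f ∈ NB := Iff.rfl

lemma Lam_mon (u : ℕ →₀ ℕ) (c : F) (h : fz u * c ∈ NB) : MvPolynomial.monomial u c ∈ Lam := by
  intro m
  rw [MvPolynomial.coeff_monomial]
  split_ifs with h1
  · subst h1; exact h
  · simp

lemma Lam_C {c : F} (h : c ∈ NB) : (MvPolynomial.C c : MvPolynomial ℕ F) ∈ Lam :=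
  Lam_mon 0 c (by simpa [fz, zk] using h)

lemma fz_single (i n : ℕ) : fz (Finsupp.single i n) = Nat.factorial n := by
  rw [fz, zk, Finsupp.prod_single_index (by simp)]
  simp

lemma Lam_X (i : ℕ) : (MvPolynomial.X i : MvPolynomial ℕ F) ∈ Lam :=
  Lam_mon _ _ (by rw [fz_single]; simp)

lemma Lam_X2 (i : ℕ) : (MvPolynomial.C 2⁻¹ * (MvPolynomial.X i * MvPolynomial.X i) : MvPolynomial ℕ F) ∈ Lam := by
  have : (MvPolynomial.C 2⁻¹ * (MvPolynomial.X i * MvPolynomial.X i) : MvPolynomial ℕ F) =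
      MvPolynomial.monomial (Finsupp.single i 2) 2⁻¹ := by
    rw [← pow_two, MvPolynomial.X_pow_eq_monomial, MvPolynomial.C_mul_monomial, mul_one]
  rw [this]
  apply Lam_mon
  rw [fz_single]
  norm_num

lemma Lam_Pm (m : JPartition) : Pm m ∈ Lam :=
  Lam_mon _ _ (by rw [mul_inv_cancel₀ (fz_ne _)]; exact one_mem _)

lemma Lam_D (i : ℕ) {f : MvPolynomial ℕ F} (hf : f ∈ Lam) : D i f ∈ Lam := by
  intro m
  rw [D_def, MvPolynomial.coeff_pderiv]
  have := hf (m + Finsupp.single i 1)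
  rw [fz, zk_add, ← fz] at this
  convert this using 1
  ring

lemma Lam_yv (i : ℕ) : yv F i ∈ Lam := mul_mem (Lam_C (NB_nat _)) (Lam_X i)

lemma Lam_yv2 (i : ℕ) : MvPolynomial.C 2⁻¹ * (yv F i * yv F i) ∈ Lam := by
  have : MvPolynomial.C 2⁻¹ * (yv F i * yv F i) = MvPolynomial.C ((i + 1 : ℕ) : F) * MvPolynomial.C ((i + 1 : ℕ) : F) *
      (MvPolynomial.C 2⁻¹ * (MvPolynomial.X i * MvPolynomial.X i)) := by
    rw [yv]; ring
  rw [this]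
  exact mul_mem (mul_mem (Lam_C (NB_nat _)) (Lam_C (NB_nat _))) (Lam_X2 i)

lemma half_two (x : MvPolynomial ℕ F) : MvPolynomial.C 2⁻¹ * (x + x) = x := by
  rw [← two_mul, ← mul_assoc, ← C_two, ← map_mul]
  simp

lemma Lam_half (φ : ℕ → ℕ → MvPolynomial ℕ F) (h1 : ∀ c d, φ c d = φ d c) (h2 : ∀ c d, φ c d ∈ Lam)
    (h3 : ∀ c, MvPolynomial.C 2⁻¹ * φ c c ∈ Lam) (K : ℕ) :
    MvPolynomial.C 2⁻¹ * ∑ c ∈ Finset.range K, ∑ d ∈ Finset.range K, φ c d ∈ Lam := by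
  induction K with
  | zero => simp
  | succ K ih =>
    have : MvPolynomial.C 2⁻¹ * ∑ c ∈ Finset.range (K + 1), ∑ d ∈ Finset.range (K + 1), φ c d =
        MvPolynomial.C 2⁻¹ * (∑ c ∈ Finset.range K, ∑ d ∈ Finset.range K, φ c d) +
        (∑ c ∈ Finset.range K, φ c K) + MvPolynomial.C 2⁻¹ * φ K K := by
      rw [Finset.sum_range_succ, Finset.sum_range_succ (φ K)]
      simp only [Finset.sum_range_succ, Finset.sum_add_distrib]
      rw [Finset.sum_congr rfl (fun d _ => h1 K d), ← half_two (∑ c ∈ Finset.range K, φ c K),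
        half_two]
      conv_rhs => rw [← half_two (∑ c ∈ Finset.range K, φ c K)]
      ring
    rw [this]
    exact add_mem (add_mem ih (sum_mem fun c _ => h2 _ _)) (h3 K)

lemma Lam_even (n : ℕ) (h : Even n) : (MvPolynomial.C ((n : F) / 2) : MvPolynomial ℕ F) ∈ Lam := by
  obtain ⟨m, rfl⟩ := h
  apply Lam_C
  have : ((m + m : ℕ) : F) / 2 = m := by push_cast; ring
  rw [this]
  exact NB_nat m

lemma Lam_S2 (K n : ℕ) {g : MvPolynomial ℕ F} (hg : g ∈ Lam) : S2 K n g ∈ Lam := by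
  have : S2 K n g = MvPolynomial.C 2⁻¹ * ∑ c ∈ Finset.range K, ∑ d ∈ Finset.range K,
      MvPolynomial.C (n : F) * (yv F (n + c + d) * D c (D d g)) := by
    simp only [← Finset.mul_sum]
    rw [← mul_assoc, ← map_mul, S2, div_eq_inv_mul]
  rw [this]
  apply Lam_half
  · intro c d
    rw [D_comm, add_right_comm]
  · intro c d
    exact mul_mem (Lam_C (NB_nat _)) (mul_mem (Lam_yv _) (Lam_D _ (Lam_D _ hg)))
  · intro c
    have : MvPolynomial.C 2⁻¹ * (MvPolynomial.C (n : F) * (yv F (n + c + c) * D c (D c g))) =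
        MvPolynomial.C (((n * (n + c + c + 1) : ℕ) : F) / 2) * (MvPolynomial.X (n + c + c) * D c (D c g)) := by
      rw [yv, div_eq_inv_mul, Nat.cast_mul, map_mul, map_mul]; ring
    rw [this]
    refine mul_mem (Lam_even _ ?_) (mul_mem (Lam_X _) (Lam_D _ (Lam_D _ hg)))
    rcases Nat.even_or_odd n with h | h
    · exact h.mul_right _
    · apply Even.mul_left
      rw [add_assoc n c c]
      exact (h.add_even (Even.add_self c)).add_one

lemma Lam_SG (n c M : ℕ) : MvPolynomial.C 2⁻¹ *
    SG M (fun r => ((min (min n c) (min (r + 1) (M - r)) : ℕ) : F)) ∈ Lam := by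
  have : SG M (fun r => ((min (min n c) (min (r + 1) (M - r)) : ℕ) : F)) =
      ∑ r ∈ Finset.range M, ∑ s ∈ Finset.range M, if r + s + 1 = M then
        MvPolynomial.C ((min (min n c) (min (r + 1) (s + 1)) : ℕ) : F) * (yv F r * yv F s) else 0 := by
    rw [SG]
    refine Finset.sum_congr rfl fun r hr => ?_
    rw [Finset.mem_range] at hr
    rw [Finset.sum_eq_single (M - 1 - r)]
    · rw [if_pos (by omega), show M - 1 - r + 1 = M - r by omega]
    · intro s _ hs
      rw [if_neg (by omega)]
    · intro h
      rw [Finset.mem_range] at h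
      omega
  rw [this]
  apply Lam_half
  · intro r s
    rw [add_comm r s, min_comm (r + 1), mul_comm (yv F r)]
  · intro r s
    split_ifs
    · exact mul_mem (Lam_C (NB_nat _)) (mul_mem (Lam_yv _) (Lam_yv _))
    · exact zero_mem _
  · intro r
    split_ifs
    · rw [mul_left_comm]
      exact mul_mem (Lam_C (NB_nat _)) (Lam_yv2 _)
    · rw [mul_zero]; exact zero_mem _

lemma Lam_RR (n c : ℕ) : RR alpha (alpha - 1) n c ∈ Lam := by
  rw [RR]
  refine add_mem ?_ ?_
  · rcases Nat.eq_zero_or_pos n with h | h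
    · subst h; simp
    rcases Nat.eq_zero_or_pos c with h' | h'
    · subst h'; simp
    have : MvPolynomial.C ((alpha - 1) / 2 * n * c) * yv F (n + c - 1) =
        MvPolynomial.C (alpha - 1) * (MvPolynomial.C (((n * c * (n + c) : ℕ) : F) / 2) *
          MvPolynomial.X (n + c - 1)) := by
      rw [yv, show n + c - 1 + 1 = n + c by omega, ← mul_assoc, ← mul_assoc, ← map_mul, ← map_mul]
      congr 2
      push_cast; ring
    rw [this]
    refine mul_mem (Lam_C NB_b) (mul_mem (Lam_even _ ?_) (Lam_X _))
    rcases Nat.even_or_odd n with h1 | h1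
    · exact (h1.mul_right _).mul_right _
    · rcases Nat.even_or_odd c with h2 | h2
      · exact (h2.mul_left _).mul_right _
      · exact (h1.add_odd h2).mul_left _
  · rw [div_eq_mul_inv, map_mul, mul_assoc]
    exact mul_mem (Lam_C NB_a) (Lam_SG n c _)

lemma Lam_WW (K i j : ℕ) {g : MvPolynomial ℕ F} (hg : g ∈ Lam) : WW K i j g ∈ Lam :=
  sum_mem fun _ _ => sum_mem fun _ _ => mul_mem (mul_mem (Lam_yv _) (Lam_yv _)) (Lam_D _ (Lam_D _ hg))

lemma Lam_WW2 (K i : ℕ) {g : MvPolynomial ℕ F} (hg : g ∈ Lam) : MvPolynomial.C 2⁻¹ * WW K i i g ∈ Lam := by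
  rw [WW]
  apply Lam_half
  · intro c d
    rw [D_comm, mul_comm (yv F (i + c))]
  · intro c d
    exact mul_mem (mul_mem (Lam_yv _) (Lam_yv _)) (Lam_D _ (Lam_D _ hg))
  · intro c
    rw [← mul_assoc]
    exact mul_mem (Lam_yv2 _) (Lam_D _ (Lam_D _ hg))

lemma Lam_st2 (K : ℕ) {f g : MvPolynomial ℕ F} (hf : f ∈ Lam) (hg : g ∈ Lam) :
    st2 alpha (alpha - 1) K f g ∈ Lam := by
  rw [st2]
  refine add_mem (add_mem (sum_mem fun i _ => mul_mem (Lam_D _ hf) (add_mem ?_ (Lam_S2 _ _ hg)))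
    (sum_mem fun i _ => mul_mem (Lam_D _ hg) (Lam_S2 _ _ hf))) ?_
  · exact sum_mem fun c _ => mul_mem (Lam_RR _ _) (Lam_D _ hg)
  · apply Lam_half
    · intro i j
      rw [D_comm, WW_comm]
    · intro i j
      exact mul_mem (Lam_D _ (Lam_D _ hf)) (Lam_WW _ _ _ hg)
    · intro i
      rw [mul_left_comm]
      exact mul_mem (Lam_D _ (Lam_D _ hf)) (Lam_WW2 _ _ hg)

lemma Lam_st1 (K : ℕ) {f g : MvPolynomial ℕ F} (hf : f ∈ Lam) (hg : g ∈ Lam) (hK : VK K g) :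
    st1 K f g ∈ Lam := by
  rw [st1]
  refine sum_mem fun a _ => mul_mem (Lam_D _ hf) ?_
  rw [Ad_eq_sum hK]
  exact sum_mem fun i _ => mul_mem (Lam_yv _) (Lam_D _ hg)

lemma Fil_Pm (m : JPartition) : Pm m ∈ Fil F (psize m : ℤ) := by
  intro u hu
  rw [Pm, MvPolynomial.coeff_monomial] at hu
  have : ex m = u := by
    by_contra h
    rw [if_neg h] at hu
    exact hu rfl
  rw [← this, wt0_ex]

theorem main_thm (J : JPartition → SymA) (hJ : IsJackFamily J)
    (g : JPartition → JPartition → JPartition → F) (hg : IsStructCoeffs J g)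
    (pi mu nu : JPartition) (h : psize mu + psize nu ≤ psize pi + 2) : g pi mu nu ∈ NB := by
  set K := psize mu + psize nu with hK
  have h1 := main_claim (Φ := Ph J) alpha_ne (Ph_one hJ) (Ph_T hJ) K (psize mu) (psize mu) (psize nu)
    (Pm mu) (Pm nu) le_rfl (by positivity) (by omega) (by omega) (Fil_Pm mu) (Fil_Pm nu)
  obtain ⟨r, hr, hr2⟩ := h1
  set S := (hg.1 mu nu).toFinset with hS
  set Q : MvPolynomial ℕ F := ∑ p ∈ S, g p mu nu • Pm p with hQ
  have hPQ : Ph J (Pm mu) * Ph J (Pm nu) = Ph J Q := by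
    funext l
    rw [Pi.mul_apply, Ph_Pm hJ, Ph_Pm hJ, hg.2 mu nu l, hQ, map_sum, Finset.sum_apply,
      finsum_eq_sum_of_support_subset (s := S)]
    · refine Finset.sum_congr rfl fun p _ => ?_
      rw [map_smul, Pi.smul_apply, Ph_Pm hJ, smul_eq_mul]
    · intro p hp
      rw [hS, Set.Finite.coe_toFinset]
      exact left_ne_zero_of_mul hp
  rw [hPQ, ← map_sub] at hr2
  have h3 := Ph_inj hJ hr2
  have h4 : MvPolynomial.coeff (ex pi) r = 0 := by
    by_contra hne
    have := hr _ hne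
    rw [wt0_ex] at this
    omega
  rw [h3, MvPolynomial.coeff_sub, sub_eq_zero] at h4
  have h5 : fz (ex pi) * MvPolynomial.coeff (ex pi) Q = g pi mu nu := by
    rw [hQ, MvPolynomial.coeff_sum]
    have : ∀ p ∈ S, MvPolynomial.coeff (ex pi) (g p mu nu • Pm p) =
        if p = pi then g pi mu nu * (fz (ex pi))⁻¹ else 0 := by
      intro p _
      rw [MvPolynomial.coeff_smul, Pm, MvPolynomial.coeff_monomial]
      by_cases hp : p = pi
      · subst hp; simp
      · rw [if_neg hp, if_neg (fun h => hp (ex_inj h)), smul_zero]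
    rw [Finset.sum_congr rfl this, Finset.sum_ite_eq']
    split_ifs with hm
    · rw [mul_left_comm, mul_inv_cancel₀ (fz_ne _), mul_one]
    · rw [mul_zero]
      by_contra hne
      exact hm ((Set.Finite.mem_toFinset _).2 (Ne.symm hne))
  rw [← h5, h4]
  have hL : Pm mu * Pm nu + st1 K (Pm mu) (Pm nu) + st2 alpha (alpha - 1) K (Pm mu) (Pm nu) ∈ Lam :=
    add_mem (add_mem (mul_mem (Lam_Pm _) (Lam_Pm _)) (Lam_st1 K (Lam_Pm _) (Lam_Pm _)
      (VK_of_Fil (Fil_Pm nu) (by omega)))) (Lam_st2 K (Lam_Pm _) (Lam_Pm _))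
  exact hL _

end JackAux
end

/-- **Corollary 1.12.** If `|π| ≥ |μ| + |ν| - 2` then the structure coefficient
`g^π_{μ,ν}(α)` is a polynomial in `b = α - 1` with non-negative integer coefficients. -/
theorem statement4
    (J : JPartition → SymA) (hJ : IsJackFamily J)
    (g : JPartition → JPartition → JPartition → F) (hg : IsStructCoeffs J g)
    (pi mu nu : JPartition) (h : psize mu + psize nu ≤ psize pi + 2) :
    ∃ c : Polynomial ℕ,
      g pi mu nu = Polynomial.eval (alpha - 1) (c.map (Nat.castRingHom F)) := by
  obtain ⟨c, hc⟩ := JackAux.main_thm J hJ g hg pi mu nu h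
  exact ⟨c, by rw [← hc, Polynomial.eval_map]; rfl⟩

end
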